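/- The Riemann zeta-function has no zeros in the region σ ≥ 1 − 1/(6.315·log(|t|/17)) for |t| ≥ 24. That is, for every complex number s = σ + it with |t| ≥ 24 and σ ≥ 1 − 1/(6.315·log(|t|/17)), one has ζ(s) ≠ 0. -/

import Mathlib

section

open Complex Metric Filter Topology

/-- A nonzero entire function divided by its zeros at a finite set of points. -/
lemma exists_entire_factor (T : Finset ℂ) (f : ℂ → ℂ) (hf : Differentiable ℂ f)
    (hf0 : ∃ z, f z ≠ 0) :
    ∃ (g : ℂ → ℂ) (n : ℂ → ℕ), Differentiable ℂ g ∧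
      (∀ z, f z = (∏ ρ ∈ T, (z - ρ) ^ n ρ) * g z) ∧ ∀ ρ ∈ T, g ρ ≠ 0 := by
  classical
  induction T using Finset.induction_on generalizing f with
  | empty => exact ⟨f, fun _ => 0, hf, by simp, by simp⟩
  | insert a T ha ih =>
    obtain ⟨p, hp⟩ := hf.analyticAt a
    have hp0 : p ≠ 0 := by
      rintro rfl
      have h1 : ∀ᶠ z in 𝓝 a, f z = 0 := hp.eventually_eq_zero
      have h2 : f = 0 := by
        have hA : AnalyticOnNhd ℂ f Set.univ := fun z _ => hf.analyticAt z
        have := hA.eqOn_zero_of_preconnected_of_eventuallyEq_zero isPreconnected_univ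
          (Set.mem_univ a) h1
        funext z; exact this (Set.mem_univ z)
      obtain ⟨z, hz⟩ := hf0
      exact hz (by rw [h2]; rfl)
    have hdiff : ∀ k : ℕ, Differentiable ℂ ((Function.swap dslope a)^[k] f) := by
      intro k
      induction k with
      | zero => exact hf
      | succ k ihk =>
        rw [Function.iterate_succ_apply']
        rw [← differentiableOn_univ] at ihk ⊢
        exact (Complex.differentiableOn_dslope Filter.univ_mem).2 ihk
    set F := (Function.swap dslope a)^[p.order] f with hF
    have hFe : ∀ z, f z = (z - a) ^ p.order * F z := fun z => by
      simpa using hp.eq_pow_order_mul_iterate_dslope z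
    have hFa : F a ≠ 0 := hp.iterate_dslope_fslope_ne_zero hp0
    obtain ⟨g, n, hg, hfac, hne⟩ := ih F (hdiff _) ⟨a, hFa⟩
    refine ⟨g, Function.update n a p.order, hg, fun z => ?_, fun ρ hρ => ?_⟩
    · rw [Finset.prod_insert ha, hFe, hfac z, Function.update_self, mul_assoc]
      congr 2
      refine Finset.prod_congr rfl fun ρ hρ => ?_
      rw [Function.update_of_ne (by rintro rfl; exact ha hρ)]
    · rcases Finset.mem_insert.1 hρ with rfl | h
      · intro h0
        exact hFa (by rw [hfac, h0, mul_zero])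
      · exact hne ρ h

/-- Variation of the logarithmic derivative of a nonvanishing function of controlled growth. -/
lemma norm_logDeriv_sub_le {g : ℂ → ℂ} (hg : Differentiable ℂ g) {R A : ℝ} (hR : 0 < R)
    (hA : 0 < A) (h0 : ∀ z ∈ ball (0 : ℂ) R, g z ≠ 0)
    (hb : ∀ z ∈ ball (0 : ℂ) R, ‖g z‖ ≤ Real.exp A * ‖g 0‖) {s : ℂ} (hs : ‖s‖ ≤ R / 4) :
    ‖logDeriv g s - logDeriv g 0‖ ≤ 128 * A / R ^ 2 * ‖s‖ := by
  have hg0 : g 0 ≠ 0 := h0 0 (by simpa)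
  have hdd : Differentiable ℂ (deriv g) := fun z => (hg.analyticAt z).deriv.differentiableAt
  have hL : DifferentiableOn ℂ (logDeriv g) (ball 0 R) := fun z hz =>
    ((hdd z).div (hg z) (h0 z hz)).differentiableWithinAt
  obtain ⟨h, hh0, hh⟩ := hL.isExactOn_ball.with_val_at 0 0
  have hexp : ∀ z ∈ ball (0 : ℂ) R, g z = g 0 * Complex.exp (h z) := by
    have key : ∀ z ∈ ball (0 : ℂ) R, HasDerivWithinAt (fun z => g z * Complex.exp (-h z)) 0
        (ball 0 R) z := by
      intro z hz
      have h1 := (hg z).hasDerivAt.mul ((hh z hz).neg.cexp)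
      refine HasDerivAt.hasDerivWithinAt (h1.congr_deriv ?_)
      rw [logDeriv_apply]
      have := h0 z hz
      field_simp
      ring
    intro z hz
    have h3 := (convex_ball (0 : ℂ) R).norm_image_sub_le_of_norm_hasDerivWithin_le (C := 0) key
      (by simp) (mem_ball_self hR) hz
    simp only [zero_mul, norm_le_zero_iff, hh0, neg_zero, Complex.exp_zero, mul_one] at h3
    rw [sub_eq_zero] at h3
    rw [← h3, mul_assoc, ← Complex.exp_add]; simp
  have hre : Set.MapsTo h (ball 0 R) {z | z.re ≤ A} := by
    intro z hz
    have h1 := hb z hz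
    rw [hexp z hz, norm_mul, Complex.norm_exp, mul_comm] at h1
    have h2 := le_of_mul_le_mul_right h1 (norm_pos_iff.2 hg0)
    exact Real.exp_le_exp.1 h2
  have hhd : DifferentiableOn ℂ h (ball 0 R) := fun z hz =>
    (hh z hz).differentiableAt.differentiableWithinAt
  have hbd : ∀ z : ℂ, ‖z‖ ≤ R / 2 → ‖h z‖ ≤ 2 * A := by
    intro z hz
    have hz' : z ∈ ball (0 : ℂ) R := by rw [mem_ball_zero_iff]; linarith
    refine (borelCaratheodory_zero hA hhd hre hR hz' hh0).trans ?_
    rw [div_le_iff₀ (by linarith)]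
    nlinarith
  have hd1 : ∀ z : ℂ, ‖z‖ ≤ 3 * R / 8 → ‖logDeriv g z‖ ≤ 16 * A / R := by
    intro z hz
    have hz' : z ∈ ball (0 : ℂ) R := by rw [mem_ball_zero_iff]; linarith
    rw [← (hh z hz').deriv]
    have h1 := norm_deriv_le_of_forall_mem_sphere_norm_le (c := z) (R := R / 8) (C := 2 * A)
      (f := h) (by linarith) ?_ ?_
    · refine h1.trans (le_of_eq ?_); field_simp; ring
    · refine DifferentiableOn.diffContOnCl (hhd.mono ?_)
      intro w hw
      have hw' := closure_ball_subset_closedBall hw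
      rw [mem_closedBall, dist_eq_norm] at hw'
      rw [mem_ball_zero_iff]
      have : ‖w‖ ≤ ‖w - z‖ + ‖z‖ := by simpa using norm_add_le (w - z) z
      linarith
    · intro w hw
      rw [mem_sphere, dist_eq_norm] at hw
      have : ‖w‖ ≤ ‖w - z‖ + ‖z‖ := by simpa using norm_add_le (w - z) z
      exact hbd w (by linarith)
  have hd2 : ∀ z ∈ closedBall (0 : ℂ) (R / 4), ‖deriv (logDeriv g) z‖ ≤ 128 * A / R ^ 2 := by
    intro z hz
    rw [mem_closedBall_zero_iff] at hz
    have h1 := norm_deriv_le_of_forall_mem_sphere_norm_le (c := z) (R := R / 8) (C := 16 * A / R)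
      (f := logDeriv g) (by linarith) ?_ ?_
    · refine h1.trans (le_of_eq ?_); field_simp; ring
    · refine DifferentiableOn.diffContOnCl (hL.mono ?_)
      intro w hw
      have hw' := closure_ball_subset_closedBall hw
      rw [mem_closedBall, dist_eq_norm] at hw'
      rw [mem_ball_zero_iff]
      have : ‖w‖ ≤ ‖w - z‖ + ‖z‖ := by simpa using norm_add_le (w - z) z
      linarith
    · intro w hw
      rw [mem_sphere, dist_eq_norm] at hw
      have : ‖w‖ ≤ ‖w - z‖ + ‖z‖ := by simpa using norm_add_le (w - z) z
      exact hd1 w (by linarith)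
  have := (convex_closedBall (0 : ℂ) (R / 4)).norm_image_sub_le_of_norm_deriv_le
    (f := logDeriv g) (x := 0) (y := s) ?_ hd2 ?_ ?_
  · simpa using this
  · intro z hz
    rw [mem_closedBall_zero_iff] at hz
    exact (hL z (by rw [mem_ball_zero_iff]; linarith)).differentiableAt
      (isOpen_ball.mem_nhds (by rw [mem_ball_zero_iff]; linarith))
  · rw [mem_closedBall_zero_iff, norm_zero]; linarith
  · simpa using hs

end

section

open Complex Metric Filter Topology ComplexConjugate

lemma finite_zeros_closedBall {f : ℂ → ℂ} (hf : Differentiable ℂ f) (hf0 : ∃ z, f z ≠ 0) (R : ℝ) :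
    {z | f z = 0 ∧ ‖z‖ ≤ R}.Finite := by
  by_contra h
  have hinf : {z | f z = 0 ∧ ‖z‖ ≤ R}.Infinite := h
  obtain ⟨x, -, hx⟩ := hinf.exists_accPt_of_subset_isCompact (isCompact_closedBall (0 : ℂ) R)
    (fun z hz => by simpa using hz.2)
  have hA : AnalyticOnNhd ℂ f Set.univ := fun z _ => hf.analyticAt z
  have hfr : ∃ᶠ z in 𝓝[≠] x, f z = 0 := (accPt_iff_frequently_nhdsNE.1 hx).mono fun z hz => hz.1
  have := hA.eqOn_zero_of_preconnected_of_frequently_eq_zero isPreconnected_univ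
    (Set.mem_univ x) hfr
  obtain ⟨z, hz⟩ := hf0
  exact hz (this (Set.mem_univ z))

lemma exists_factor_of_growth {f : ℂ → ℂ} (hf : Differentiable ℂ f) (h0 : f 0 ≠ 0)
    {R A : ℝ} (hR : 0 < R) (hA : 0 < A)
    (hgr : ∀ z, ‖z‖ ≤ 3 * R → ‖f z‖ ≤ Real.exp A * ‖f 0‖) :
    ∃ (T : Finset ℂ) (n : ℂ → ℕ) (L : ℂ → ℂ), (∀ ρ, ρ ∈ T ↔ f ρ = 0 ∧ ‖ρ‖ ≤ R) ∧
      (∀ ρ ∈ T, 1 ≤ n ρ) ∧ (∀ s, f s ≠ 0 → logDeriv f s = ∑ ρ ∈ T, n ρ * (1 / (s - ρ)) + L s) ∧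
      ∀ s, ‖s‖ ≤ R / 4 → ‖L s - L 0‖ ≤ 128 * A / R ^ 2 * ‖s‖ := by
  classical
  have hfin := finite_zeros_closedBall hf ⟨0, h0⟩ R
  obtain ⟨g, n, hg, hfac, hne⟩ := exists_entire_factor hfin.toFinset f hf ⟨0, h0⟩
  have hT : ∀ ρ, ρ ∈ hfin.toFinset ↔ f ρ = 0 ∧ ‖ρ‖ ≤ R := fun ρ => by simp
  set T := hfin.toFinset
  have hgne : ∀ z ∈ ball (0 : ℂ) R, g z ≠ 0 := by
    intro z hz hgz
    rw [mem_ball_zero_iff] at hz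
    exact hne z ((hT z).2 ⟨by rw [hfac, hgz, mul_zero], hz.le⟩) hgz
  refine ⟨T, n, logDeriv g, hT, ?_, ?_, fun s hs => norm_logDeriv_sub_le hg hR hA hgne ?_ hs⟩
  · intro ρ hρ
    by_contra h
    have hn : n ρ = 0 := by omega
    have h1 := ((hT ρ).1 hρ).1
    rw [hfac, mul_eq_zero, or_iff_left (hne ρ hρ), Finset.prod_eq_zero_iff] at h1
    obtain ⟨a, ha, h2⟩ := h1
    have h3 : ρ = a := sub_eq_zero.1 (eq_zero_of_pow_eq_zero h2)
    rw [← h3, hn] at h2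
    simp at h2
  · intro s hs
    have hfs : f = fun z => (∏ ρ ∈ T, (z - ρ) ^ n ρ) * g z := funext hfac
    have hmul := hs
    rw [hfac, mul_ne_zero_iff, Finset.prod_ne_zero_iff] at hmul
    rw [hfs, logDeriv_mul s (Finset.prod_ne_zero_iff.2 hmul.1) hmul.2 (by fun_prop) (hg s)]
    congr 1
    rw [logDeriv_prod (f := fun ρ z => (z - ρ) ^ n ρ) hmul.1 (fun i _ => by fun_prop)]
    refine Finset.sum_congr rfl fun ρ _ => ?_
    rw [logDeriv_fun_pow (by fun_prop), logDeriv_apply]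
    simp
  · have hfr : ∀ z ∈ frontier (ball (0 : ℂ) (3 * R)), ‖g z‖ ≤ Real.exp A * ‖g 0‖ := by
      intro z hz
      rw [frontier_ball _ (by positivity), mem_sphere_zero_iff_norm] at hz
      have h1 : ‖g z‖ * ∏ ρ ∈ T, (2 * R) ^ n ρ ≤ Real.exp A * ‖f 0‖ := by
        refine le_trans ?_ (hgr z hz.le)
        rw [hfac z, norm_mul, norm_prod, mul_comm]
        gcongr with ρ hρ
        rw [norm_pow]
        gcongr
        have := ((hT ρ).1 hρ).2
        have := norm_sub_norm_le z ρ
        linarith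
      have h2 : ‖f 0‖ ≤ ‖g 0‖ * ∏ ρ ∈ T, (2 * R) ^ n ρ := by
        rw [hfac 0, norm_mul, norm_prod, mul_comm]
        gcongr with ρ hρ
        rw [norm_pow]
        gcongr
        have := ((hT ρ).1 hρ).2
        rw [zero_sub, norm_neg]
        linarith
      have hP : 0 < ∏ ρ ∈ T, (2 * R) ^ n ρ := Finset.prod_pos fun ρ _ => by positivity
      refine le_of_mul_le_mul_right (h1.trans ?_) hP
      rw [mul_assoc]
      gcongr
    intro z hz
    rw [mem_ball_zero_iff] at hz
    exact norm_le_of_forall_mem_frontier_norm_le isBounded_ball hg.diffContOnCl hfr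
      (subset_closure (by rw [mem_ball_zero_iff]; linarith))

lemma logDeriv_one_sub_conj {f : ℂ → ℂ} (hfe : ∀ s, f (1 - conj s) = conj (f s)) (s : ℂ) :
    logDeriv f (1 - conj s) = -conj (logDeriv f s) := by
  have h1 : (fun w => f (1 - w)) = conj ∘ f ∘ conj := by
    funext w
    simpa using hfe (conj w)
  have h2 := congrArg (fun F => deriv F (conj s)) h1
  simp only [deriv_comp_const_sub, deriv_conj_conj, Function.comp_apply,
    Complex.conj_conj] at h2
  rw [logDeriv_apply, logDeriv_apply, map_div₀, hfe, ← h2]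
  ring

lemma tendsto_growth_div_sq (K B : ℝ) :
    Tendsto (fun R : ℝ => (K * (1 + 3 * R) ^ (3 / 2 : ℝ) + B) / R ^ 2) atTop (𝓝 0) := by
  have h1 : Tendsto (fun R : ℝ => R ^ (-(1 / 2) : ℝ)) atTop (𝓝 0) :=
    tendsto_rpow_neg_atTop (by norm_num)
  have h2 : Tendsto (fun R : ℝ => (1 / R + 3)) atTop (𝓝 (0 + 3)) := by
    refine Tendsto.add_const _ ?_
    exact (tendsto_inv_atTop_zero (𝕜 := ℝ)).congr fun r => (one_div r).symm
  have h3 : Tendsto (fun R : ℝ => (1 / R + 3) ^ (3 / 2 : ℝ)) atTop (𝓝 ((0 + 3) ^ (3 / 2 : ℝ))) :=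
    h2.rpow_const (Or.inl (by norm_num))
  have h4 : Tendsto (fun R : ℝ => B * (1 / R ^ 2)) atTop (𝓝 (B * 0)) := by
    refine Tendsto.const_mul _ ?_
    simpa using (tendsto_pow_neg_atTop (𝕜 := ℝ) (n := 2) (by norm_num))
  have h5 := ((h3.mul h1).const_mul K).add h4
  simp only [mul_zero, add_zero] at h5
  refine h5.congr' ?_
  filter_upwards [eventually_gt_atTop 0] with R hR
  have : 1 + 3 * R = (1 / R + 3) * R := by field_simp
  rw [this, Real.mul_rpow (by positivity) hR.le]
  have h6 : R ^ (3 / 2 : ℝ) = R ^ (-(1 / 2) : ℝ) * R ^ 2 := by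
    rw [← Real.rpow_natCast, ← Real.rpow_add hR]; norm_num
  rw [h6]
  field_simp

/-- Lower bound for a combination of logarithmic derivatives of an entire function of order less
than two with the symmetry `s ↦ 1 - conj s`. -/
theorem half_sum_zeros_le {f : ℂ → ℂ} (hf : Differentiable ℂ f) (h0 : f 0 ≠ 0)
    (hfe : ∀ s, f (1 - conj s) = conj (f s)) {K : ℝ} (hK : 0 ≤ K)
    (hgr : ∀ z, ‖f z‖ ≤ Real.exp (K * (1 + ‖z‖) ^ (3 / 2 : ℝ)))
    {ι : Type*} (J : Finset ι) (C s : ι → ℂ) (hC : (∑ j ∈ J, C j).im = 0)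
    (hs : ∀ j ∈ J, f (s j) ≠ 0)
    (hΦ : ∀ ρ, f ρ = 0 → 0 ≤ (∑ j ∈ J, C j * (1 / (s j - ρ) + 1 / (s j - 1 + conj ρ))).re)
    (Z : Finset ℂ) (hZ : ∀ ρ ∈ Z, f ρ = 0) :
    (1 / 2) * ∑ ρ ∈ Z, (∑ j ∈ J, C j * (1 / (s j - ρ) + 1 / (s j - 1 + conj ρ))).re ≤
      (∑ j ∈ J, C j * logDeriv f (s j)).re := by
  set Φ : ℂ → ℝ := fun ρ => (∑ j ∈ J, C j * (1 / (s j - ρ) + 1 / (s j - 1 + conj ρ))).re with hΦdef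
  set B : ℝ := |Real.log ‖f 0‖| + 1
  have hB : 0 < B := by positivity
  set E : ℝ := ∑ j ∈ J, ‖C j‖ * (‖s j‖ + ‖1 - conj (s j)‖)
  have hEv : ∀ᶠ R : ℝ in atTop, (1 / 2) * ∑ ρ ∈ Z, Φ ρ ≤
      (∑ j ∈ J, C j * logDeriv f (s j)).re +
        64 * E * ((K * (1 + 3 * R) ^ (3 / 2 : ℝ) + B) / R ^ 2) := by
    have hJ : ∀ᶠ R : ℝ in atTop, ∀ j ∈ J, ‖s j‖ ≤ R / 4 ∧ ‖1 - conj (s j)‖ ≤ R / 4 := by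
      rw [Filter.eventually_all_finset]
      intro j _
      filter_upwards [eventually_ge_atTop (4 * ‖s j‖), eventually_ge_atTop (4 * ‖1 - conj (s j)‖)]
        with R h1 h2
      constructor <;> linarith
    have hZ' : ∀ᶠ R : ℝ in atTop, ∀ ρ ∈ Z, ‖ρ‖ ≤ R := by
      rw [Filter.eventually_all_finset]
      exact fun ρ _ => eventually_ge_atTop _
    filter_upwards [hJ, hZ', eventually_gt_atTop 0] with R hRJ hRZ hR
    set A : ℝ := K * (1 + 3 * R) ^ (3 / 2 : ℝ) + B
    have hA : 0 < A := by positivity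
    obtain ⟨T, n, L, hT, hn, hlog, hL⟩ := exists_factor_of_growth hf h0 hR hA (fun z hz => by
      refine (hgr z).trans ?_
      rw [← Real.exp_log (norm_pos_iff.2 h0), ← Real.exp_add, Real.exp_le_exp]
      have h1 : K * (1 + ‖z‖) ^ (3 / 2 : ℝ) ≤ K * (1 + 3 * R) ^ (3 / 2 : ℝ) := by gcongr
      have h2 := neg_abs_le (Real.log ‖f 0‖)
      simp only [A, B]
      linarith)
    have hsum : ∑ ρ ∈ Z, Φ ρ ≤ ∑ ρ ∈ T, n ρ * Φ ρ := by
      have hsub : Z ⊆ T := fun ρ hρ => (hT ρ).2 ⟨hZ ρ hρ, hRZ ρ hρ⟩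
      refine (Finset.sum_le_sum_of_subset_of_nonneg hsub fun ρ hρ _ => hΦ ρ ((hT ρ).1 hρ).1).trans
        ?_
      refine Finset.sum_le_sum fun ρ hρ => ?_
      have h1 : (1 : ℝ) ≤ n ρ := by exact_mod_cast hn ρ hρ
      nlinarith [hΦ ρ ((hT ρ).1 hρ).1]
    have hj : ∀ j ∈ J, 2 * logDeriv f (s j) =
        ∑ ρ ∈ T, n ρ * (1 / (s j - ρ) + 1 / (s j - 1 + conj ρ)) +
          (L (s j) - conj (L (1 - conj (s j)))) := by
      intro j hj
      have h1 := hlog _ (hs j hj)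
      have h2 := hlog (1 - conj (s j)) (by rw [hfe]; simpa using hs j hj)
      have h3 : logDeriv f (s j) = -conj (logDeriv f (1 - conj (s j))) := by
        rw [logDeriv_one_sub_conj hfe]; simp
      rw [two_mul]
      nth_rewrite 2 [h3]
      rw [h1, h2, map_add, map_sum]
      simp only [mul_add, Finset.sum_add_distrib]
      have h4 : ∑ ρ ∈ T, conj ((n ρ : ℂ) * (1 / (1 - conj (s j) - ρ))) =
          -∑ ρ ∈ T, n ρ * (1 / (s j - 1 + conj ρ)) := by
        rw [← Finset.sum_neg_distrib]
        refine Finset.sum_congr rfl fun ρ _ => ?_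
        simp only [map_mul, map_natCast, map_div₀, map_one, map_sub, Complex.conj_conj]
        rw [show (1 : ℂ) - s j - conj ρ = -(s j - 1 + conj ρ) by ring, div_neg, mul_neg]
      rw [h4]
      ring
    have hmain : 2 * (∑ j ∈ J, C j * logDeriv f (s j)).re = ∑ ρ ∈ T, n ρ * Φ ρ +
        (∑ j ∈ J, C j * (L (s j) - conj (L (1 - conj (s j))))).re := by
      have h1 : 2 * ∑ j ∈ J, C j * logDeriv f (s j) = ∑ ρ ∈ T, (n ρ : ℂ) * ∑ j ∈ J, C j *
          (1 / (s j - ρ) + 1 / (s j - 1 + conj ρ)) +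
          ∑ j ∈ J, C j * (L (s j) - conj (L (1 - conj (s j)))) := by
        simp only [Finset.mul_sum]
        rw [Finset.sum_comm, ← Finset.sum_add_distrib]
        refine Finset.sum_congr rfl fun j hjm => ?_
        rw [mul_left_comm, hj j hjm, mul_add, Finset.mul_sum]
        congr 1
        refine Finset.sum_congr rfl fun ρ _ => ?_
        ring
      have h2 := congrArg Complex.re h1
      rw [Complex.add_re, Complex.re_sum] at h2
      rw [show (2 : ℂ) = ((2 : ℝ) : ℂ) by norm_num, Complex.re_ofReal_mul] at h2
      rw [h2]
      congr 1
      refine Finset.sum_congr rfl fun ρ _ => ?_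
      rw [show ((n ρ : ℕ) : ℂ) = ((n ρ : ℝ) : ℂ) by norm_num, Complex.re_ofReal_mul]
    have herr : -(128 * E * (A / R ^ 2)) ≤
        (∑ j ∈ J, C j * (L (s j) - conj (L (1 - conj (s j))))).re := by
      have h1 : ∑ j ∈ J, C j * (L (s j) - conj (L (1 - conj (s j)))) =
          (∑ j ∈ J, C j) * (L 0 - conj (L 0)) +
          ∑ j ∈ J, C j * ((L (s j) - L 0) - conj (L (1 - conj (s j)) - L 0)) := by
        rw [Finset.sum_mul, ← Finset.sum_add_distrib]
        refine Finset.sum_congr rfl fun j _ => ?_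
        rw [map_sub]; ring
      have h2 : ((∑ j ∈ J, C j) * (L 0 - conj (L 0))).re = 0 := by
        rw [Complex.mul_re, hC]; simp
      rw [h1, Complex.add_re, h2, zero_add]
      refine neg_le_of_abs_le ((Complex.abs_re_le_norm _).trans ?_)
      refine (norm_sum_le _ _).trans ?_
      rw [show 128 * E * (A / R ^ 2) = E * (128 * A / R ^ 2) by ring, Finset.sum_mul]
      refine Finset.sum_le_sum fun j hj => ?_
      rw [norm_mul, mul_assoc]
      gcongr
      refine (norm_sub_le _ _).trans ?_
      rw [Complex.norm_conj, add_mul, mul_comm ‖s j‖, mul_comm ‖1 - conj (s j)‖]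
      exact add_le_add (hL _ (hRJ j hj).1) (hL _ (hRJ j hj).2)
    linarith
  have hlim := ((tendsto_growth_div_sq K B).const_mul (64 * E)).const_add
    (∑ j ∈ J, C j * logDeriv f (s j)).re
  rw [mul_zero, add_zero] at hlim
  exact ge_of_tendsto hlim hEv

/-- The Riemann xi-function, normalised by `ξ 0 = 1`. -/
noncomputable def riemannXi (s : ℂ) : ℂ := 1 + s * (s - 1) * completedRiemannZeta₀ s

lemma differentiable_riemannXi : Differentiable ℂ riemannXi := by
  have := differentiable_completedZeta₀
  unfold riemannXi
  fun_prop

lemma riemannXi_zero : riemannXi 0 = 1 := by simp [riemannXi]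

lemma riemannXi_one_sub (s : ℂ) : riemannXi (1 - s) = riemannXi s := by
  rw [riemannXi, riemannXi, completedRiemannZeta₀_one_sub]; ring

lemma riemannXi_eq {s : ℂ} (hs : 0 < s.re) (h1 : s ≠ 1) :
    riemannXi s = s * (s - 1) * Gammaℝ s * riemannZeta s := by
  have h0 : s ≠ 0 := by rintro rfl; simp at hs
  have h2 : Gammaℝ s ≠ 0 := Gammaℝ_ne_zero_of_re_pos hs
  have h3 : (1 : ℂ) - s ≠ 0 := sub_ne_zero.2 (Ne.symm h1)
  rw [riemannZeta_def_of_ne_zero h0, completedRiemannZeta_eq, riemannXi]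
  field_simp
  ring

lemma riemannXi_conj (s : ℂ) : riemannXi (conj s) = conj (riemannXi s) := by
  have hA : AnalyticOnNhd ℂ riemannXi Set.univ := fun z _ => differentiable_riemannXi.analyticAt z
  have hB : AnalyticOnNhd ℂ (fun s => conj (riemannXi (conj s))) Set.univ := by
    have : Differentiable ℂ (conj ∘ riemannXi ∘ conj) := fun z =>
      differentiableAt_conj_conj_iff.2 (differentiable_riemannXi (conj z))
    exact fun z _ => this.analyticAt z
  have hev : riemannXi =ᶠ[𝓝 2] fun s => conj (riemannXi (conj s)) := by
    have h1 : ∀ᶠ s : ℂ in 𝓝 2, 1 < s.re :=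
      (isOpen_lt continuous_const Complex.continuous_re).mem_nhds (by simp)
    filter_upwards [h1] with s hs
    have hne : ∀ z : ℂ, 1 < z.re → z ≠ 1 := by rintro z hz rfl; simp at hz
    have hs' : 1 < (conj s).re := by simpa using hs
    rw [riemannXi_eq (by linarith) (hne _ hs), riemannXi_eq (by linarith) (hne _ hs')]
    have hG : Gammaℝ (conj s) = conj (Gammaℝ s) := by
      rw [Gammaℝ_def, Gammaℝ_def, map_mul, ← Complex.Gamma_conj]
      have := Complex.cpow_conj Real.pi (-s / 2)
        (by rw [Complex.arg_ofReal_of_nonneg Real.pi_pos.le]; exact Real.pi_ne_zero.symm)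
      rw [Complex.conj_ofReal] at this
      rw [← this, map_div₀, map_div₀, map_neg, show conj (2 : ℂ) = 2 from map_ofNat _ 2]
    rw [hG, riemannZeta_conj]
    simp
  have := hA.eqOn_of_preconnected_of_eventuallyEq hB isPreconnected_univ (Set.mem_univ 2) hev
    (Set.mem_univ s)
  simp only at this
  rw [this]; simp

lemma riemannXi_one_sub_conj (s : ℂ) : riemannXi (1 - conj s) = conj (riemannXi s) := by
  rw [riemannXi_one_sub, riemannXi_conj]

lemma norm_completedRiemannZeta₀_strip_le :
    ∃ B : ℝ, 0 ≤ B ∧ ∀ s : ℂ, 0 ≤ s.re → s.re ≤ 2 → ‖completedRiemannZeta₀ s‖ ≤ B := by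
  set P := HurwitzZeta.hurwitzEvenFEPair 0
  have hconv : ∀ s, MellinConvergent P.f_modif s := fun s =>
    (P.isStrongFEPair_toStrongFEPair.hasMellin s).1
  have h0 := (hconv 0).norm
  have h1 := (hconv 1).norm
  refine ⟨(∫ t in Set.Ioi (0 : ℝ), (‖(t : ℂ) ^ ((0 : ℂ) - 1) • P.f_modif t‖ +
    ‖(t : ℂ) ^ ((1 : ℂ) - 1) • P.f_modif t‖)) / 2, ?_, fun s hs0 hs2 => ?_⟩
  · refine div_nonneg (MeasureTheory.integral_nonneg fun t => by positivity) (by norm_num)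
  · change ‖mellin P.f_modif (s / 2) / 2‖ ≤ _
    rw [norm_div, Complex.norm_ofNat]
    gcongr
    refine (MeasureTheory.norm_integral_le_integral_norm _).trans ?_
    refine MeasureTheory.integral_mono_ae (hconv (s / 2)).norm (h0.add h1) ?_
    filter_upwards [MeasureTheory.ae_restrict_mem measurableSet_Ioi] with t ht
    rw [Set.mem_Ioi] at ht
    simp only [norm_smul]
    rw [← add_mul]
    gcongr
    rw [Complex.norm_cpow_eq_rpow_re_of_pos ht, Complex.norm_cpow_eq_rpow_re_of_pos ht,
      Complex.norm_cpow_eq_rpow_re_of_pos ht]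
    have hre : (s / 2 - 1).re = s.re / 2 - 1 := by
      rw [show s / 2 = s / (2 : ℝ) by norm_num, Complex.sub_re, Complex.div_ofReal_re]; simp
    rw [hre]
    simp only [zero_sub, neg_re, one_re, sub_self, zero_re]
    rcases le_total 1 t with h | h
    · have := Real.rpow_le_rpow_of_exponent_le h (show s.re / 2 - 1 ≤ 0 by linarith)
      have h2 : 0 ≤ t ^ (-1 : ℝ) := by positivity
      linarith
    · have := Real.rpow_le_rpow_of_exponent_ge ht h (show -1 ≤ s.re / 2 - 1 by linarith)
      have h2 : 0 ≤ t ^ (0 : ℝ) := by positivity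
      exact this.trans (le_add_of_nonneg_right h2)

lemma norm_Gamma_le_Gamma_re {s : ℂ} (hs : 0 < s.re) : ‖Complex.Gamma s‖ ≤ Real.Gamma s.re := by
  rw [Complex.Gamma_eq_integral hs, Real.Gamma_eq_integral hs, Complex.GammaIntegral]
  refine (MeasureTheory.norm_integral_le_integral_norm _).trans (le_of_eq ?_)
  refine MeasureTheory.setIntegral_congr_fun measurableSet_Ioi fun x hx => ?_
  rw [Set.mem_Ioi] at hx
  simp only [norm_mul]
  rw [Complex.norm_cpow_eq_rpow_re_of_pos hx, Complex.norm_of_nonneg (Real.exp_pos _).le]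
  simp

lemma Gamma_le_exp {x : ℝ} (hx : 1 ≤ x) : Real.Gamma x ≤ Real.exp (2 * (x + 2) ^ (3 / 2 : ℝ)) := by
  have hx0 : 0 < x := by linarith
  have h1 : Real.Gamma x ≤ Real.Gamma (x + 1) := by
    rw [Real.Gamma_add_one hx0.ne']
    exact le_mul_of_one_le_left (Real.Gamma_pos_of_pos hx0).le hx
  have hc : x ≤ (⌈x⌉₊ : ℝ) := Nat.le_ceil x
  have hc' : (⌈x⌉₊ : ℝ) < x + 1 := Nat.ceil_lt_add_one hx0.le
  have h2 : Real.Gamma (x + 1) ≤ Real.Gamma (⌈x⌉₊ + 1) :=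
    Real.Gamma_strictMonoOn_Ici.monotoneOn (by simp; linarith) (by simp; linarith) (by linarith)
  rw [Real.Gamma_nat_eq_factorial] at h2
  have h3 : ((⌈x⌉₊).factorial : ℝ) ≤ (⌈x⌉₊ : ℝ) ^ ⌈x⌉₊ := by exact_mod_cast Nat.factorial_le_pow _
  have hn : (0 : ℝ) < ⌈x⌉₊ := by linarith
  have h4 : (⌈x⌉₊ : ℝ) ^ ⌈x⌉₊ = Real.exp (Real.log ⌈x⌉₊ * ⌈x⌉₊) := by
    rw [← Real.rpow_natCast, Real.rpow_def_of_pos hn]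
  refine h1.trans (h2.trans (h3.trans (h4.le.trans (Real.exp_le_exp.2 ?_))))
  have h5 : Real.log ⌈x⌉₊ ≤ 2 * (⌈x⌉₊ : ℝ) ^ (1 / 2 : ℝ) := by
    have := Real.log_le_rpow_div hn.le (show (0 : ℝ) < 1 / 2 by norm_num)
    linarith
  calc Real.log ⌈x⌉₊ * ⌈x⌉₊ ≤ 2 * (⌈x⌉₊ : ℝ) ^ (1 / 2 : ℝ) * ⌈x⌉₊ := by gcongr
    _ = 2 * (⌈x⌉₊ : ℝ) ^ (3 / 2 : ℝ) := by
      rw [mul_assoc, ← Real.rpow_add_one hn.ne']; norm_num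
    _ ≤ _ := by gcongr; linarith

lemma norm_riemannZeta_le_of_two_le {s : ℂ} (hs : 2 ≤ s.re) :
    ‖riemannZeta s‖ ≤ ∑' n : ℕ, 1 / ((n : ℝ) + 1) ^ 2 := by
  rw [zeta_eq_tsum_one_div_nat_add_one_cpow (by linarith)]
  have hsum : Summable fun n : ℕ => 1 / ((n : ℝ) + 1) ^ 2 := by
    have := (summable_nat_add_iff 1).2 (Real.summable_one_div_nat_pow.2 (show 1 < 2 by norm_num))
    simpa using this
  refine tsum_of_norm_bounded hsum.hasSum fun n => ?_
  have hn : (1 : ℝ) ≤ (n : ℝ) + 1 := by linarith [Nat.cast_nonneg (α := ℝ) n]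
  rw [norm_div, norm_one, show (n : ℂ) + 1 = ((n + 1 : ℝ) : ℂ) by push_cast; rfl,
    Complex.norm_cpow_eq_rpow_re_of_pos (by linarith), ← Real.rpow_natCast]
  gcongr
  exact_mod_cast hs

lemma norm_riemannXi_le : ∃ K : ℝ, 0 ≤ K ∧
    ∀ z, ‖riemannXi z‖ ≤ Real.exp (K * (1 + ‖z‖) ^ (3 / 2 : ℝ)) := by
  obtain ⟨B, hB, hstrip⟩ := norm_completedRiemannZeta₀_strip_le
  set M : ℝ := ∑' n : ℕ, 1 / ((n : ℝ) + 1) ^ 2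
  have hM : 0 ≤ M := tsum_nonneg fun n => by positivity
  have hsq : ∀ z : ℂ, (1 + ‖z‖) ^ 2 ≤ Real.exp (2 * (1 + ‖z‖) ^ (3 / 2 : ℝ)) ∧
      1 ≤ (1 + ‖z‖) ^ (3 / 2 : ℝ) := by
    intro z
    have hz : 1 ≤ 1 + ‖z‖ := by linarith [norm_nonneg z]
    refine ⟨?_, Real.one_le_rpow hz (by norm_num)⟩
    have h1 : 1 + ‖z‖ ≤ (1 + ‖z‖) ^ (3 / 2 : ℝ) := by
      nth_rewrite 1 [← Real.rpow_one (1 + ‖z‖)]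
      exact Real.rpow_le_rpow_of_exponent_le hz (by norm_num)
    have h2 : 1 + ‖z‖ ≤ Real.exp (1 + ‖z‖) := by
      linarith [Real.add_one_le_exp (1 + ‖z‖)]
    calc (1 + ‖z‖) ^ 2 ≤ Real.exp (1 + ‖z‖) ^ 2 := by gcongr
      _ = Real.exp (2 * (1 + ‖z‖)) := by rw [← Real.exp_nat_mul]; norm_num
      _ ≤ _ := by gcongr
  have hhalf : ∀ z : ℂ, 1 / 2 ≤ z.re →
      ‖riemannXi z‖ ≤ Real.exp ((M + B + 5) * (1 + ‖z‖) ^ (3 / 2 : ℝ)) := by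
    intro z hz
    obtain ⟨h1, h2⟩ := hsq z
    set y := (1 + ‖z‖) ^ (3 / 2 : ℝ)
    have hfac : ‖z * (z - 1)‖ ≤ (1 + ‖z‖) ^ 2 := by
      have : ‖z - 1‖ ≤ ‖z‖ + 1 := by simpa using norm_sub_le z 1
      rw [norm_mul]
      nlinarith [norm_nonneg z, norm_nonneg (z - 1)]
    rcases le_total z.re 2 with h | h
    · have h3 : ‖riemannXi z‖ ≤ (1 + B) * (1 + ‖z‖) ^ 2 := by
        refine (norm_add_le _ _).trans ?_
        rw [norm_one, norm_mul]
        have h4 := hstrip z (by linarith) h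
        have h5 : ‖z * (z - 1)‖ * ‖completedRiemannZeta₀ z‖ ≤ (1 + ‖z‖) ^ 2 * B := by gcongr
        nlinarith [norm_nonneg z]
      have h4 : 1 + B ≤ Real.exp B := by linarith [Real.add_one_le_exp B]
      calc ‖riemannXi z‖ ≤ (1 + B) * (1 + ‖z‖) ^ 2 := h3
        _ ≤ Real.exp B * Real.exp (2 * y) := by gcongr
        _ = Real.exp (B + 2 * y) := by rw [Real.exp_add]
        _ ≤ _ := by gcongr; nlinarith
    · rw [riemannXi_eq (by linarith) (by rintro rfl; norm_num at h), norm_mul, norm_mul]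
      have hG : ‖Gammaℝ z‖ ≤ Real.exp (3 * y) := by
        rw [Gammaℝ_def, norm_mul, Complex.norm_cpow_eq_rpow_re_of_pos Real.pi_pos]
        have hre : (z / 2).re = z.re / 2 := by
          rw [show z / 2 = z / (2 : ℝ) by norm_num, Complex.div_ofReal_re]
        have hre' : (-z / 2).re = -z.re / 2 := by
          rw [show -z / 2 = -z / (2 : ℝ) by norm_num, Complex.div_ofReal_re]; simp
        have h3 := norm_Gamma_le_Gamma_re (s := z / 2) (by rw [hre]; linarith)
        have h4 := Gamma_le_exp (x := z.re / 2) (by linarith)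
        rw [hre] at h3
        have h5 : Real.pi ^ (-z / 2).re ≤ 1 := by
          rw [hre']
          exact Real.rpow_le_one_of_one_le_of_nonpos (by linarith [Real.pi_gt_three]) (by linarith)
        have h6 : (z.re / 2 + 2) ≤ 5 / 4 * (1 + ‖z‖) := by
          have := Complex.re_le_norm z
          have : 2 ≤ ‖z‖ := by linarith
          linarith
        have h7 : (z.re / 2 + 2) ^ (3 / 2 : ℝ) ≤ (3 / 2) * y := by
          calc (z.re / 2 + 2) ^ (3 / 2 : ℝ) ≤ (5 / 4 * (1 + ‖z‖)) ^ (3 / 2 : ℝ) := by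
                gcongr
            _ = (5 / 4) ^ (3 / 2 : ℝ) * y := by
                rw [Real.mul_rpow (by norm_num) (by positivity)]
            _ ≤ _ := by
                gcongr
                rw [show (3 / 2 : ℝ) = 1 + 1 / 2 by norm_num, Real.rpow_add (by norm_num),
                  Real.rpow_one, ← Real.sqrt_eq_rpow]
                have : √(5 / 4 : ℝ) ≤ 1.12 := Real.sqrt_le_left (by norm_num) |>.2 (by norm_num)
                linarith
        calc _ ≤ 1 * Real.exp (2 * (z.re / 2 + 2) ^ (3 / 2 : ℝ)) := by
              gcongr; exact h3.trans h4
          _ ≤ _ := by rw [one_mul]; exact Real.exp_le_exp.2 (by linarith)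
      have hz := norm_riemannZeta_le_of_two_le h
      have h4 : M ≤ Real.exp M := by linarith [Real.add_one_le_exp M]
      calc ‖z * (z - 1)‖ * ‖Gammaℝ z‖ * ‖riemannZeta z‖
          ≤ Real.exp (2 * y) * Real.exp (3 * y) * Real.exp M := by
            gcongr
            · exact hfac.trans h1
            · exact hz.trans h4
        _ = Real.exp (2 * y + 3 * y + M) := by rw [Real.exp_add, Real.exp_add]
        _ ≤ _ := by gcongr; nlinarith
  refine ⟨(M + B + 5) * 4, by positivity, fun z => ?_⟩
  have h2 := (hsq z).2
  rcases le_total (1 / 2) z.re with h | h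
  · refine (hhalf z h).trans ?_
    gcongr
    linarith
  · rw [← riemannXi_one_sub]
    refine (hhalf (1 - z) (by simp; linarith)).trans ?_
    rw [mul_assoc]
    gcongr
    have h3 : 1 + ‖1 - z‖ ≤ 2 * (1 + ‖z‖) := by
      have : ‖1 - z‖ ≤ 1 + ‖z‖ := by simpa using norm_sub_le 1 z
      linarith [norm_nonneg z]
    calc (1 + ‖1 - z‖) ^ (3 / 2 : ℝ) ≤ (2 * (1 + ‖z‖)) ^ (3 / 2 : ℝ) := by gcongr
      _ = 2 ^ (3 / 2 : ℝ) * (1 + ‖z‖) ^ (3 / 2 : ℝ) := by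
          rw [Real.mul_rpow (by norm_num) (by positivity)]
      _ ≤ _ := by
          gcongr
          calc (2 : ℝ) ^ (3 / 2 : ℝ) ≤ 2 ^ (2 : ℝ) := by
                gcongr <;> norm_num
            _ = 4 := by norm_num

/-- The error of the trapezoidal rule for `1 / w` on `[w, w + 1]`. -/
noncomputable def trapErr (w : ℂ) : ℂ := log (w + 1) - log w - (1 / w + 1 / (w + 1)) / 2

lemma norm_trapErr_le {w : ℂ} (hw : 0 < w.re) (h10 : 10 ≤ ‖w + 1 / 2‖) :
    ‖trapErr w‖ ≤ 0.175 / ‖w + 1 / 2‖ ^ 3 := by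
  have hw0 : w ≠ 0 := by rintro rfl; simp at hw
  have hw1 : w + 1 ≠ 0 := by
    intro h; have := congrArg Complex.re h; simp at this; linarith
  have hh : w + 1 / 2 ≠ 0 := by rw [← norm_pos_iff]; linarith
  set c := w + 1 / 2 with hc
  set v : ℂ := 1 / (2 * c) with hv
  have hvn : ‖v‖ = 1 / (2 * ‖c‖) := by rw [hv]; simp
  have hv20 : ‖v‖ ≤ 1 / 20 := by
    rw [hvn]; apply one_div_le_one_div_of_le <;> linarith
  have hcre : 0 < c.re := by rw [hc]; simp; linarith
  have hlog : ∀ u : ℂ, ‖u‖ < 1 → log (c * (1 + u)) = log c + log (1 + u) := by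
    intro u hu
    have hur : 0 < (1 + u).re := by
      have := Complex.abs_re_le_norm u
      have := neg_abs_le u.re
      simp; linarith
    have hne : 1 + u ≠ 0 := by rintro h; rw [h] at hur; simp at hur
    refine Complex.log_mul hh hne ?_
    have h1 := Complex.abs_arg_lt_pi_div_two_iff.2 (Or.inl hcre)
    have h2 := Complex.abs_arg_lt_pi_div_two_iff.2 (Or.inl hur)
    rw [abs_lt] at h1 h2
    constructor <;> linarith [h1.1, h1.2, h2.1, h2.2]
  have hv1 : ‖v‖ < 1 := by linarith
  have e1 : w + 1 = c * (1 + v) := by rw [hv]; field_simp; rw [hc]; ring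
  have e2 : w = c * (1 + -v) := by rw [hv]; field_simp; rw [hc]; ring
  have hA := Complex.norm_log_sub_logTaylor_le 3 hv1
  have hB := Complex.norm_log_sub_logTaylor_le 3 (show ‖-v‖ < 1 by rwa [norm_neg])
  rw [norm_neg] at hB
  have ht : ∀ u : ℂ, Complex.logTaylor (3 + 1) u = u - u ^ 2 / 2 + u ^ 3 / 3 := by
    intro u
    rw [Complex.logTaylor_succ, Complex.logTaylor_succ, Complex.logTaylor_succ,
      Complex.logTaylor_succ, Complex.logTaylor_zero]
    simp
    ring
  rw [ht] at hA hB
  have hv2 : 1 - v ^ 2 ≠ 0 := by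
    intro h
    have h1 : v ^ 2 = 1 := by linear_combination -h
    have h2 := congrArg norm h1
    rw [norm_pow, norm_one] at h2
    nlinarith [norm_nonneg v]
  have hmean : (1 / w + 1 / (w + 1)) / 2 = 2 * v / (1 - v ^ 2) := by
    have e3 : w * (w + 1) = c ^ 2 * (1 - v ^ 2) := by
      nth_rewrite 1 [e2]; rw [e1]; ring
    have e4 : (1 / w + 1 / (w + 1)) / 2 = c / (w * (w + 1)) := by
      rw [hc]; field_simp; ring
    rw [e4, e3, hv]
    field_simp
  have hdec : trapErr w = (log (1 + v) - (v - v ^ 2 / 2 + v ^ 3 / 3)) -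
      (log (1 + -v) - (-v - (-v) ^ 2 / 2 + (-v) ^ 3 / 3)) -
      v ^ 3 * (4 / 3 + 2 * v ^ 2 / (1 - v ^ 2)) := by
    rw [trapErr, hmean, e1, hlog v hv1]
    nth_rewrite 1 [e2]
    rw [hlog (-v) (by rwa [norm_neg])]
    field_simp
    ring
  have hn : ‖trapErr w‖ ≤ ‖v‖ ^ 4 * (1 - ‖v‖)⁻¹ / 4 + ‖v‖ ^ 4 * (1 - ‖v‖)⁻¹ / 4 +
      ‖v‖ ^ 3 * (4 / 3 + 2 * ‖v‖ ^ 2 / (1 - ‖v‖ ^ 2)) := by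
    rw [hdec]
    refine (norm_sub_le _ _).trans (add_le_add ((norm_sub_le _ _).trans (add_le_add ?_ ?_)) ?_)
    · refine hA.trans (le_of_eq ?_); norm_num
    · refine hB.trans (le_of_eq ?_); norm_num
    · rw [norm_mul, norm_pow]
      gcongr
      refine (norm_add_le _ _).trans ?_
      rw [norm_div, norm_div, norm_mul, norm_pow]
      have h1 : 1 - ‖v‖ ^ 2 ≤ ‖1 - v ^ 2‖ := by
        have := norm_sub_norm_le (1 : ℂ) (v ^ 2)
        rwa [norm_one, norm_pow] at this
      have h2 : 0 < 1 - ‖v‖ ^ 2 := by nlinarith [norm_nonneg v]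
      simp only [Complex.norm_ofNat]
      gcongr
  have hx0 := norm_nonneg v
  set x := ‖v‖
  have h1 : (1 - x)⁻¹ ≤ 20 / 19 := by
    rw [inv_le_comm₀ (by linarith) (by norm_num)]; linarith
  have h2 : 2 * x ^ 2 / (1 - x ^ 2) ≤ 2 / 399 := by
    rw [div_le_div_iff₀ (by nlinarith) (by norm_num)]; nlinarith
  have h3 : x ^ 4 ≤ x ^ 3 / 20 := by
    have : 0 ≤ x ^ 3 := by positivity
    nlinarith
  have h4 : ‖trapErr w‖ ≤ 1.4 * x ^ 3 := by
    have h5 : x ^ 4 * (1 - x)⁻¹ ≤ x ^ 3 / 20 * (20 / 19) := by gcongr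
    have h6 : x ^ 3 * (4 / 3 + 2 * x ^ 2 / (1 - x ^ 2)) ≤ x ^ 3 * (4 / 3 + 2 / 399) := by gcongr
    have : 0 ≤ x ^ 3 := by positivity
    nlinarith
  refine h4.trans (le_of_eq ?_)
  rw [hvn]
  have : ‖c‖ ≠ 0 := by positivity
  field_simp
  norm_num

/-- The error in the two-term asymptotic expansion of the digamma function. -/
noncomputable def digammaErr (z : ℂ) : ℂ := digamma z - log z + 1 / (2 * z)

lemma digammaErr_eq {z : ℂ} (hz : 0 < z.re) : digammaErr z = digammaErr (z + 1) + trapErr z := by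
  have h0 : ∀ m : ℕ, z ≠ -m := by
    rintro m rfl
    simp at hz
    linarith [Nat.cast_nonneg (α := ℝ) m]
  have hz0 : z ≠ 0 := by simpa using h0 0
  have hz1 : z + 1 ≠ 0 := fun h => h0 1 (by push_cast; linear_combination h)
  rw [digammaErr, digammaErr, trapErr, digamma_apply_add_one z h0]
  field_simp
  ring

lemma log_Gamma_hasDerivAt {x : ℝ} (hx : 0 < x) :
    ∃ d : ℝ, HasDerivAt (Real.log ∘ Real.Gamma) d x ∧ digamma x = d := by
  have h0 : ∀ m : ℕ, (x : ℂ) ≠ -m := by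
    intro m h
    have := congrArg Complex.re h
    simp at this
    linarith [Nat.cast_nonneg (α := ℝ) m]
  have hG := (differentiableAt_Gamma (x : ℂ) h0).hasDerivAt
  have hR : HasDerivAt Real.Gamma (deriv Gamma (x : ℂ)).re x := hG.real_of_complex
  have hpos := Real.Gamma_pos_of_pos hx
  refine ⟨(deriv Gamma (x : ℂ)).re / Real.Gamma x, hR.log hpos.ne', ?_⟩
  have h1 := hG.comp_ofReal
  have h2 := hR.ofReal_comp
  have h3 : (fun y : ℝ => Gamma (y : ℂ)) = fun y : ℝ => ((Real.Gamma y : ℝ) : ℂ) := by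
    funext y; rw [Complex.Gamma_ofReal]
  rw [h3] at h1
  have h4 := h1.unique h2
  rw [digamma_def, logDeriv_apply, h4, Complex.Gamma_ofReal]
  push_cast
  rfl

lemma abs_digamma_sub_log_le {x : ℝ} (hx : 0 < x) :
    ‖digamma (x : ℂ) - log (x : ℂ)‖ ≤ 1 / x := by
  obtain ⟨d, hd, hdx⟩ := log_Gamma_hasDerivAt hx
  obtain ⟨e, he, hex⟩ := log_Gamma_hasDerivAt (show 0 < x + 1 by linarith)
  have hrec : (e : ℂ) = d + 1 / x := by
    have := digamma_apply_add_one (x : ℂ) (by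
      intro m h
      have := congrArg Complex.re h
      simp at this
      linarith [Nat.cast_nonneg (α := ℝ) m])
    rw [← hdx, ← hex]
    push_cast
    rw [this]
    ring
  have hrec' : e = d + 1 / x := by exact_mod_cast hrec
  have hconv := Real.convexOn_log_Gamma
  have hx' : x ∈ Set.Ioi (0 : ℝ) := hx
  have hx1 : x + 1 ∈ Set.Ioi (0 : ℝ) := by simp; linarith
  have hsl : slope (Real.log ∘ Real.Gamma) x (x + 1) = Real.log x := by
    rw [slope_def_field]
    simp only [Function.comp_apply, add_sub_cancel_left, div_one]
    rw [Real.Gamma_add_one hx.ne', Real.log_mul hx.ne' (Real.Gamma_pos_of_pos hx).ne']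
    ring
  have h1 : d ≤ Real.log x := by
    rw [← hsl]; exact hconv.le_slope_of_hasDerivAt hx' hx1 (by linarith) hd
  have h2 : Real.log x ≤ e := by
    rw [← hsl]; exact hconv.slope_le_of_hasDerivAt hx' hx1 (by linarith) he
  rw [hdx, ← Complex.ofReal_log hx.le, ← Complex.ofReal_sub, Complex.norm_real, Real.norm_eq_abs,
    abs_le]
  constructor <;> linarith

lemma summable_trapBound : Summable fun m : ℕ => 0.175 / ((m : ℝ) + 10) ^ 3 := by
  have := (summable_nat_add_iff 10).2 (Real.summable_one_div_nat_pow.2 (show 1 < 3 by norm_num))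
  refine (this.mul_left 0.175).congr fun m => ?_
  push_cast
  ring

lemma norm_trapErr_add_nat_le {z : ℂ} (hz : 10 < z.re) (m : ℕ) :
    ‖trapErr (z + m)‖ ≤ 0.175 / ((m : ℝ) + 10) ^ 3 := by
  have h1 : (m : ℝ) + 10 ≤ ‖z + m + 1 / 2‖ := by
    refine le_trans ?_ (Complex.re_le_norm _)
    simp
    linarith
  have h2 : (0 : ℝ) ≤ m := Nat.cast_nonneg m
  refine (norm_trapErr_le (by simp; linarith) (by linarith)).trans ?_
  gcongr

lemma differentiableOn_trapErr : DifferentiableOn ℂ trapErr {z | 0 < z.re} := by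
  intro z hz
  have hz' : 0 < z.re := hz
  have h1 : z + 1 ∈ slitPlane := Or.inl (by simp; linarith)
  have h2 : z ∈ slitPlane := Or.inl hz'
  have h3 := slitPlane_ne_zero h1
  have h4 := slitPlane_ne_zero h2
  unfold trapErr
  refine DifferentiableAt.differentiableWithinAt ?_
  fun_prop (disch := assumption)

lemma digammaErr_eq_sum {z : ℂ} (hz : 0 < z.re) (n : ℕ) :
    digammaErr z = digammaErr (z + n) + ∑ m ∈ Finset.range n, trapErr (z + m) := by
  induction n with
  | zero => simp
  | succ n ih =>
    rw [Finset.sum_range_succ, ih, digammaErr_eq (z := z + n)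
      (by simp; linarith [Nat.cast_nonneg (α := ℝ) n])]
    push_cast
    rw [add_assoc z]
    ring

lemma digammaErr_ofReal {x : ℝ} (hx : 10 < x) : digammaErr x = ∑' m : ℕ, trapErr (x + m) := by
  have hs : Summable fun m : ℕ => trapErr ((x : ℂ) + m) :=
    Summable.of_norm_bounded summable_trapBound (norm_trapErr_add_nat_le (by simpa using hx))
  have h1 := hs.hasSum.tendsto_sum_nat
  have h2 : Tendsto (fun n : ℕ => digammaErr ((x : ℂ) + n)) atTop (𝓝 0) := by
    have hlim : Tendsto (fun n : ℕ => 2 / ((n : ℝ) + 1)) atTop (𝓝 0) := by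
      have := (tendsto_one_div_add_atTop_nhds_zero_nat (𝕜 := ℝ)).const_mul 2
      rw [mul_zero] at this
      exact this.congr fun n => by ring
    refine squeeze_zero_norm (fun n => ?_) hlim
    have hn : (0 : ℝ) ≤ n := Nat.cast_nonneg n
    have h3 := abs_digamma_sub_log_le (x := x + n) (by linarith)
    rw [digammaErr]
    push_cast at h3 ⊢
    refine (norm_add_le _ _).trans ?_
    have h4 : ‖1 / (2 * ((x : ℂ) + n))‖ ≤ 1 / (x + n) := by
      rw [show 1 / (2 * ((x : ℂ) + n)) = ((1 / (2 * (x + n)) : ℝ) : ℂ) by push_cast; rfl,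
        Complex.norm_real, Real.norm_of_nonneg (by positivity)]
      apply one_div_le_one_div_of_le <;> linarith
    have h5 : 1 / (x + n) ≤ 1 / ((n : ℝ) + 1) := by
      apply one_div_le_one_div_of_le <;> linarith
    calc _ ≤ 1 / (x + n) + 1 / (x + n) := add_le_add h3 h4
      _ ≤ 1 / ((n : ℝ) + 1) + 1 / ((n : ℝ) + 1) := add_le_add h5 h5
      _ = _ := by ring
  have h3 := h2.add h1
  rw [zero_add] at h3
  refine tendsto_nhds_unique (tendsto_const_nhds.congr fun n => ?_) h3
  exact digammaErr_eq_sum (by simp; linarith) n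

lemma digammaErr_eq_tsum {z : ℂ} (hz : 10 < z.re) : digammaErr z = ∑' m : ℕ, trapErr (z + m) := by
  have hopen : IsOpen {z : ℂ | 10 < z.re} := isOpen_lt continuous_const Complex.continuous_re
  have hconv : Convex ℝ {z : ℂ | 10 < z.re} := convex_halfSpace_re_gt 10
  have h1 : DifferentiableOn ℂ (fun z => ∑' m : ℕ, trapErr (z + m)) {z : ℂ | 10 < z.re} := by
    refine Complex.differentiableOn_tsum_of_summable_norm summable_trapBound (fun m => ?_) hopen
      fun m w hw => norm_trapErr_add_nat_le hw m
    refine differentiableOn_trapErr.comp (by fun_prop) fun w hw => ?_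
    have hw' : 10 < w.re := hw
    change 0 < (w + m).re
    simp
    linarith [Nat.cast_nonneg (α := ℝ) m]
  have h2 : DifferentiableOn ℂ digammaErr {z : ℂ | 10 < z.re} := by
    intro w hw
    have hw' : 10 < w.re := hw
    have hw2 : w ∈ slitPlane := Or.inl (by linarith)
    have hw3 := slitPlane_ne_zero hw2
    have hG : ∀ᶠ u in 𝓝 w, DifferentiableAt ℂ Gamma u := by
      filter_upwards [hopen.mem_nhds hw] with u hu
      have hu' : 10 < u.re := hu
      refine differentiableAt_Gamma u fun m h => ?_
      rw [h] at hu'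
      simp at hu'
      linarith [Nat.cast_nonneg (α := ℝ) m]
    have hA : AnalyticAt ℂ Gamma w := Complex.analyticAt_iff_eventually_differentiableAt.2 hG
    have hne : Gamma w ≠ 0 := Gamma_ne_zero_of_re_pos (by linarith)
    have hdg : DifferentiableAt ℂ digamma w := hA.deriv.differentiableAt.div hG.self_of_nhds hne
    refine DifferentiableAt.differentiableWithinAt ?_
    unfold digammaErr
    fun_prop (disch := first | assumption | simpa)
  have hfr : ∃ᶠ w in 𝓝[≠] (11 : ℂ), digammaErr w = ∑' m : ℕ, trapErr (w + m) := by
    have ht : Tendsto (fun n : ℕ => ((11 + 1 / ((n : ℝ) + 1) : ℝ) : ℂ)) atTop (𝓝[≠] 11) := by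
      refine tendsto_nhdsWithin_iff.2 ⟨?_, Eventually.of_forall fun n => ?_⟩
      · have := (tendsto_one_div_add_atTop_nhds_zero_nat (𝕜 := ℝ)).const_add 11
        rw [add_zero] at this
        have h := (Complex.continuous_ofReal.tendsto (11 : ℝ)).comp this
        have e : ((11 : ℝ) : ℂ) = 11 := by norm_num
        rw [e] at h
        exact h
      · rw [Set.mem_compl_singleton_iff]
        intro h
        have h' := congrArg Complex.re h
        rw [Complex.ofReal_re] at h'
        have : 0 < 1 / ((n : ℝ) + 1) := by positivity
        simp at h'
        simp at this
        linarith
    refine ht.frequently (Eventually.of_forall fun n => ?_).frequently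
    exact digammaErr_ofReal (by have : 0 < 1 / ((n : ℝ) + 1) := by positivity
                                linarith)
  exact (h2.analyticOnNhd hopen).eqOn_of_preconnected_of_frequently_eq (h1.analyticOnNhd hopen)
    hconv.isPreconnected (show (11 : ℂ) ∈ {z : ℂ | 10 < z.re} by simp; norm_num) hfr hz

lemma norm_trapErr_le_of_abs {z : ℂ} (hz : 0 < z.re) (hr : 15 ≤ z.re + |z.im|) :
    ‖trapErr z‖ ≤ 0.25 * (1 / (z.re + |z.im|) ^ 2 - 1 / (z.re + |z.im| + 1) ^ 2) := by
  set r := z.re + |z.im| with hrdef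
  have hn : (r + 1 / 2) ^ 2 ≤ 2 * ‖z + 1 / 2‖ ^ 2 := by
    rw [← Complex.normSq_eq_norm_sq, Complex.normSq_apply]
    simp only [add_re, add_im]
    norm_num
    nlinarith [sq_nonneg (z.re + 1 / 2 - |z.im|), abs_mul_abs_self z.im]
  set q := ‖z + 1 / 2‖ with hq
  have hq0 : 0 ≤ q := norm_nonneg _
  have h10 : 10 ≤ q := by nlinarith
  refine (norm_trapErr_le hz h10).trans ?_
  have hq3 : (r + 1 / 2) ^ 3 ≤ 2.8285 * q ^ 3 := by
    have h1 : r + 1 / 2 ≤ 1.41422 * q := by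
      refine abs_le_of_sq_le_sq' (by nlinarith) (by positivity) |>.2
    calc (r + 1 / 2) ^ 3 ≤ (1.41422 * q) ^ 3 := by gcongr
      _ ≤ _ := by rw [mul_pow]; gcongr; norm_num
  have e1 : 0.25 * (1 / r ^ 2 - 1 / (r + 1) ^ 2) =
      0.5 * (r + 1 / 2) / (r ^ 2 * (r + 1) ^ 2) := by
    field_simp; ring
  rw [e1, div_le_div_iff₀ (by positivity) (by positivity)]
  have h2 : r ^ 2 * (r + 1) ^ 2 ≤ (r + 1 / 2) ^ 4 := by
    have : r * (r + 1) ≤ (r + 1 / 2) ^ 2 := by nlinarith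
    calc r ^ 2 * (r + 1) ^ 2 = (r * (r + 1)) ^ 2 := by ring
      _ ≤ ((r + 1 / 2) ^ 2) ^ 2 := by gcongr
      _ = _ := by ring
  calc 0.175 * (r ^ 2 * (r + 1) ^ 2) ≤ 0.175 * (r + 1 / 2) ^ 4 := by gcongr
    _ = 0.175 * (r + 1 / 2) * (r + 1 / 2) ^ 3 := by ring
    _ ≤ 0.175 * (r + 1 / 2) * (2.8285 * q ^ 3) := by gcongr
    _ ≤ 0.5 * (r + 1 / 2) * q ^ 3 := by
      have : 0 ≤ (r + 1 / 2) * q ^ 3 := by positivity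
      nlinarith

lemma norm_digammaErr_le_add {z : ℂ} (hz : 0 < z.re) (hr : 15 ≤ z.re + |z.im|) (n : ℕ) {E : ℝ}
    (hE : ‖digammaErr (z + n)‖ ≤ E) :
    ‖digammaErr z‖ ≤ E + 0.25 * (1 / (z.re + |z.im|) ^ 2 - 1 / (z.re + |z.im| + n) ^ 2) := by
  induction n generalizing E with
  | zero => simpa using hE
  | succ n ih =>
    have hz' : 0 < (z + n).re := by simp; linarith [Nat.cast_nonneg (α := ℝ) n]
    have h1 := norm_trapErr_le_of_abs hz'
      (by simp; linarith [Nat.cast_nonneg (α := ℝ) n])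
    have h2 : ‖digammaErr (z + n)‖ ≤ E + ‖trapErr (z + n)‖ := by
      rw [digammaErr_eq hz']
      refine (norm_add_le _ _).trans ?_
      push_cast at hE
      rw [← add_assoc] at hE
      linarith
    have h3 := ih (h2.trans (add_le_add_right h1 E))
    simp only [add_re, natCast_re, add_im, natCast_im, add_zero] at h3
    push_cast
    have e : z.re + (n : ℝ) + |z.im| = z.re + |z.im| + n := by ring
    rw [e] at h3
    rw [← add_assoc]
    linarith

lemma tendsto_digammaErr_add_nat {z : ℂ} (hz : 0 < z.re) :
    Tendsto (fun n : ℕ => digammaErr (z + n)) atTop (𝓝 0) := by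
  have hs : Summable fun m : ℕ => trapErr ((z + 11) + m) :=
    Summable.of_norm_bounded summable_trapBound (norm_trapErr_add_nat_le (by simp; linarith))
  have h1 := hs.hasSum.tendsto_sum_nat
  rw [← digammaErr_eq_tsum (by simp; linarith)] at h1
  have h2 : Tendsto (fun n : ℕ => digammaErr (z + 11 + n)) atTop (𝓝 0) := by
    have := (tendsto_const_nhds (x := digammaErr (z + 11))).sub h1
    rw [sub_self] at this
    refine this.congr fun n => ?_
    rw [digammaErr_eq_sum (z := z + 11) (by simp; linarith) n]
    ring
  rw [← tendsto_add_atTop_iff_nat 11]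
  refine h2.congr fun n => ?_
  push_cast
  congr 1
  ring

/-- Stirling's formula for the digamma function with an explicit error term. -/
lemma norm_digammaErr_le {z : ℂ} (hz : 0 < z.re) (hr : 15 ≤ z.re + |z.im|) :
    ‖digammaErr z‖ ≤ 0.25 / (z.re + |z.im|) ^ 2 := by
  have h1 : Tendsto (fun n : ℕ => ‖digammaErr (z + n)‖ + 0.25 / (z.re + |z.im|) ^ 2) atTop
      (𝓝 (0 + 0.25 / (z.re + |z.im|) ^ 2)) := by
    have := (tendsto_digammaErr_add_nat hz).norm
    rw [norm_zero] at this
    exact this.add_const _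
  rw [zero_add] at h1
  refine ge_of_tendsto' h1 fun n => (norm_digammaErr_le_add hz hr n le_rfl).trans ?_
  have : 0 ≤ 1 / (z.re + |z.im| + n) ^ 2 := by positivity
  have e : 0.25 / (z.re + |z.im|) ^ 2 = 0.25 * (1 / (z.re + |z.im|) ^ 2) := by ring
  linarith

/-- The archimedean part of `-ζ'/ζ`. -/
noncomputable def archPart (s : ℂ) : ℂ :=
  1 / s + 1 / (s - 1) - (Real.log Real.pi : ℂ) / 2 + digamma (s / 2) / 2

lemma logDeriv_Gammaℝ {s : ℂ} (hs : 0 < s.re) :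
    logDeriv Gammaℝ s = -(Real.log Real.pi : ℂ) / 2 + digamma (s / 2) / 2 := by
  have hs2 : 0 < (s / 2).re := by
    rw [show s / 2 = ((1 / 2 : ℝ) : ℂ) * s by push_cast; ring, re_ofReal_mul]; linarith
  have hpi : (Real.pi : ℂ) ≠ 0 := by exact_mod_cast Real.pi_ne_zero
  have h1 : HasDerivAt (fun s : ℂ => (Real.pi : ℂ) ^ (-s / 2))
      ((Real.pi : ℂ) ^ (-s / 2) * Complex.log Real.pi * (-1 / 2)) s := by
    have : HasDerivAt (fun s : ℂ => -s / 2) (-1 / 2) s := ((hasDerivAt_id s).neg).div_const 2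
    exact this.const_cpow (Or.inl hpi)
  have hGd : DifferentiableAt ℂ Gamma (s / 2) := by
    refine differentiableAt_Gamma _ fun m h => ?_
    rw [h] at hs2
    simp at hs2
    linarith [Nat.cast_nonneg (α := ℝ) m]
  have h2 : HasDerivAt (fun s : ℂ => Gamma (s / 2)) (deriv Gamma (s / 2) * (1 / 2)) s :=
    hGd.hasDerivAt.comp s ((hasDerivAt_id s).div_const 2)
  have hG : Gamma (s / 2) ≠ 0 := Gamma_ne_zero_of_re_pos hs2
  have hp : (Real.pi : ℂ) ^ (-s / 2) ≠ 0 := by rw [cpow_def_of_ne_zero hpi]; exact exp_ne_zero _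
  have h3 := (h1.mul h2).deriv
  have h4 : Gammaℝ = (fun s : ℂ => (Real.pi : ℂ) ^ (-s / 2)) * fun s => Gamma (s / 2) := by
    ext s; simp [Gammaℝ_def]
  rw [logDeriv_apply, h4, h3, Pi.mul_apply, digamma_def, logDeriv_apply, Complex.ofReal_log
    Real.pi_pos.le]
  field_simp

lemma neg_logDeriv_riemannZeta {s : ℂ} (hs : 1 < s.re) :
    -logDeriv riemannZeta s = archPart s - logDeriv riemannXi s := by
  have hs0 : s ≠ 0 := by rintro rfl; simp at hs; linarith
  have hs1 : s ≠ 1 := by rintro rfl; simp at hs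
  have hs1' : s - 1 ≠ 0 := sub_ne_zero.2 hs1
  have hev : riemannXi =ᶠ[𝓝 s] fun s => s * (s - 1) * Gammaℝ s * riemannZeta s := by
    filter_upwards [(isOpen_lt continuous_const Complex.continuous_re).mem_nhds hs] with z hz
    have hz : 1 < z.re := hz
    exact riemannXi_eq (by linarith) (by rintro rfl; simp at hz)
  have hζ := riemannZeta_ne_zero_of_one_lt_re hs
  have hΓ : Gammaℝ s ≠ 0 := Gammaℝ_ne_zero_of_re_pos (by linarith)
  have hΓd : DifferentiableAt ℂ Gammaℝ s := by
    by_contra h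
    have h' := differentiable_Gammaℝ_inv.differentiableAt (x := s) |>.inv (inv_ne_zero hΓ)
    exact h (h'.congr_of_eventuallyEq (Eventually.of_forall fun z => by simp))
  rw [(logDeriv_congr_nhds hev).self_of_nhds,
    logDeriv_mul (f := fun s => s * (s - 1) * Gammaℝ s) (g := riemannZeta) s
      (mul_ne_zero (mul_ne_zero hs0 hs1') hΓ) hζ (by fun_prop) (differentiableAt_riemannZeta hs1),
    logDeriv_mul (f := fun s => s * (s - 1)) (g := Gammaℝ) s (mul_ne_zero hs0 hs1') hΓ
      (by fun_prop) hΓd,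
    logDeriv_mul (f := fun s => s) (g := fun s => s - 1) s hs0 hs1' (by fun_prop) (by fun_prop),
    logDeriv_Gammaℝ (by linarith), logDeriv_id', logDeriv_apply (fun s : ℂ => s - 1)]
  simp only [deriv_sub_const, deriv_id'']
  rw [archPart]
  ring

lemma norm_archPart_high_sub_le {b : ℂ} {T : ℝ} (hT : 60 ≤ T) (hb : 1 < b.re) (hb2 : ‖b‖ ≤ 5 / 2) :
    ‖archPart (b + T * I) - ((Real.log (T / (2 * Real.pi)) / 2 : ℝ) + Real.pi / 4 * I
      + (b + 3) / (2 * (T * I)))‖ ≤ 6.5 / T ^ 2 := by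
  have hT0 : (T : ℂ) ≠ 0 := by exact_mod_cast (by linarith : T ≠ 0)
  have hTI : ‖(T : ℂ) * I‖ = T := by simp; linarith
  set s := b + T * I with hs
  have hsre : s.re = b.re := by simp [hs]
  have hs0 : s ≠ 0 := by intro h; rw [h] at hsre; simp at hsre; linarith
  have hs1 : s - 1 ≠ 0 := by
    intro h; have := congrArg Complex.re h; simp [hsre] at this; linarith
  have hb1 : ‖b - 1‖ ≤ 5 / 2 := by
    refine le_trans ?_ hb2
    rw [← sq_le_sq₀ (norm_nonneg _) (norm_nonneg _), ← Complex.normSq_eq_norm_sq,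
      ← Complex.normSq_eq_norm_sq, Complex.normSq_apply, Complex.normSq_apply]
    simp
    nlinarith
  set u := b / (T * I) with hu
  have hun : ‖u‖ ≤ 5 / 2 / T := by rw [hu, norm_div, hTI]; gcongr
  have hu24 : ‖u‖ ≤ 1 / 24 := hun.trans (by rw [div_le_iff₀ (by linarith)]; linarith)
  have hur : 0 < (1 + u).re := by
    have := Complex.abs_re_le_norm u
    have := neg_abs_le u.re
    simp; linarith
  have hne : 1 + u ≠ 0 := by rintro h; rw [h] at hur; simp at hur
  have hlog : log (s / 2) = (Real.log (T / 2) : ℂ) + Real.pi / 2 * I + log (1 + u) := by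
    have e : s / 2 = ((T / 2 : ℝ) : ℂ) * (I * (1 + u)) := by
      rw [hs, hu]; push_cast; field_simp; ring
    rw [e, Complex.log_ofReal_mul (by linarith) (mul_ne_zero I_ne_zero hne),
      Complex.log_mul I_ne_zero hne, Complex.log_I]
    · ring
    · have h2 := Complex.abs_arg_lt_pi_div_two_iff.2 (Or.inl hur)
      rw [abs_lt] at h2
      rw [arg_I]
      constructor <;> linarith [h2.1, h2.2, Real.pi_pos]
  have him : |s.im - T| ≤ 5 / 2 := by
    have : s.im - T = b.im := by simp [hs]
    rw [this]; exact (Complex.abs_im_le_norm b).trans hb2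
  have hr : (T - 3 / 2) / 2 ≤ (s / 2).re + |(s / 2).im| := by
    have e1 : (s / 2).re = s.re / 2 := by simp
    have e2 : (s / 2).im = s.im / 2 := by simp
    rw [e1, e2, hsre]
    have := le_abs_self (s.im / 2)
    have := (abs_le.1 him).1
    linarith
  have hD := norm_digammaErr_le (z := s / 2) (by simp [hsre]; linarith) (by linarith)
  have hD' : ‖digammaErr (s / 2)‖ ≤ 1 / (T - 3 / 2) ^ 2 := by
    refine hD.trans ?_
    have : 1 / (T - 3 / 2) ^ 2 = 0.25 / ((T - 3 / 2) / 2) ^ 2 := by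
      have : T - 3 / 2 ≠ 0 := by linarith
      field_simp; norm_num
    rw [this]
    have : 0 < (T - 3 / 2) / 2 := by linarith
    gcongr
  have hlog1 := Complex.norm_log_one_add_sub_self_le (z := u) (by linarith)
  have hdg : digamma (s / 2) = digammaErr (s / 2) + log (s / 2) - 1 / s := by
    rw [digammaErr]; field_simp; ring
  have hsn : T - 5 / 2 ≤ ‖s‖ := by
    have := norm_sub_norm_le (T * I) (-b)
    rw [hTI, norm_neg, sub_neg_eq_add, add_comm (T * I)] at this
    linarith
  have hsn1 : T - 5 / 2 ≤ ‖s - 1‖ := by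
    have := norm_sub_norm_le (T * I) (-(b - 1))
    rw [hTI, norm_neg, sub_neg_eq_add, show T * I + (b - 1) = s - 1 by rw [hs]; ring] at this
    linarith
  have hdec : archPart s - ((Real.log (T / (2 * Real.pi)) / 2 : ℝ) + Real.pi / 4 * I
      + (b + 3) / (2 * (T * I))) = -(b / (2 * (T * I) * s)) - (b - 1) / (T * I * (s - 1))
      + (log (1 + u) - u) / 2 + digammaErr (s / 2) / 2 := by
    rw [archPart, hdg, hlog, show T / (2 * Real.pi) = T / 2 / Real.pi by field_simp,
      Real.log_div (by linarith) Real.pi_ne_zero, hu]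
    have e1 : b = s - T * I := by rw [hs]; ring
    have hI := I_ne_zero
    rw [e1]
    push_cast
    field_simp
    ring
  rw [hdec]
  have t1 : ‖b / (2 * (T * I) * s)‖ ≤ 5 / 4 / (T * (T - 5 / 2)) := by
    rw [norm_div, norm_mul, norm_mul, hTI, norm_ofNat, show 2 * T * ‖s‖ = 2 * (T * ‖s‖) by ring,
      div_mul_eq_div_div, ]
    have : 0 < T - 5 / 2 := by linarith
    have h2 : ‖b‖ / 2 ≤ 5 / 4 := by linarith
    gcongr
  have t2 : ‖(b - 1) / (T * I * (s - 1))‖ ≤ 5 / 2 / (T * (T - 5 / 2)) := by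
    rw [norm_div, norm_mul, hTI]
    have : 0 < T - 5 / 2 := by linarith
    gcongr
  have t3 : ‖(log (1 + u) - u) / 2‖ ≤ 1.64 / T ^ 2 := by
    rw [norm_div, norm_ofNat]
    have h1 : (1 - ‖u‖)⁻¹ ≤ 1.0437 := by
      rw [inv_le_comm₀ (by linarith) (by norm_num)]; norm_num at hu24 ⊢; linarith
    have h2 : ‖u‖ ^ 2 ≤ 6.25 / T ^ 2 := by
      calc ‖u‖ ^ 2 ≤ (5 / 2 / T) ^ 2 := by gcongr
        _ = 6.25 / T ^ 2 := by rw [div_pow]; norm_num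
    calc _ ≤ (6.25 / T ^ 2 * 1.0437 / 2) / 2 := by
          have : 0 ≤ (1 - ‖u‖)⁻¹ := inv_nonneg.2 (by linarith)
          refine div_le_div_of_nonneg_right (hlog1.trans ?_) (by norm_num)
          gcongr
      _ = (6.25 * 1.0437 / 4) / T ^ 2 := by ring
      _ ≤ _ := by gcongr; norm_num
  have t4 : ‖digammaErr (s / 2) / 2‖ ≤ 1 / 2 / (T - 3 / 2) ^ 2 := by
    rw [norm_div, norm_ofNat]
    calc _ ≤ 1 / (T - 3 / 2) ^ 2 / 2 := by gcongr
      _ = _ := by ring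
  have hfin : 15 / 4 / (T * (T - 5 / 2)) + 1.64 / T ^ 2 + 1 / 2 / (T - 3 / 2) ^ 2 ≤ 6.5 / T ^ 2 :=
    by
    have h1 : 15 / 4 / (T * (T - 5 / 2)) ≤ 4 / T ^ 2 := by
      rw [div_le_div_iff₀ (by nlinarith) (by positivity)]; nlinarith
    have h2 : 1 / 2 / (T - 3 / 2) ^ 2 ≤ 0.6 / T ^ 2 := by
      rw [div_le_div_iff₀ (by nlinarith) (by positivity)]; nlinarith
    calc _ ≤ 4 / T ^ 2 + 1.64 / T ^ 2 + 0.6 / T ^ 2 := by linarith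
      _ = 6.24 / T ^ 2 := by ring
      _ ≤ _ := by gcongr; norm_num
  calc _ ≤ ‖b / (2 * (T * I) * s)‖ + ‖(b - 1) / (T * I * (s - 1))‖ + ‖(log (1 + u) - u) / 2‖
        + ‖digammaErr (s / 2) / 2‖ := by
        refine (norm_add_le _ _).trans (add_le_add_left ((norm_add_le _ _).trans
          (add_le_add_left ((norm_sub_le _ _).trans ?_) _)) _)
        rw [norm_neg]
    _ ≤ 15 / 4 / (T * (T - 5 / 2)) + 1.64 / T ^ 2 + 1 / 2 / (T - 3 / 2) ^ 2 := by
        have : 15 / 4 / (T * (T - 5 / 2)) = 5 / 4 / (T * (T - 5 / 2)) + 5 / 2 / (T * (T - 5 / 2))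
          := by
          ring
        linarith
    _ ≤ _ := hfin

lemma digamma_eq_add_nat {z : ℂ} (hz : 0 < z.re) (n : ℕ) :
    digamma z = digamma (z + n) - ∑ m ∈ Finset.range n, 1 / (z + m) := by
  induction n with
  | zero => simp
  | succ n ih =>
    have h := digamma_apply_add_one (z + n) (fun m h => by
      have := congrArg Complex.re h
      simp at this
      linarith [Nat.cast_nonneg (α := ℝ) m, Nat.cast_nonneg (α := ℝ) n])
    rw [Finset.sum_range_succ, ih]
    push_cast
    rw [← add_assoc, h]
    simp only [one_div]
    ring

lemma norm_archPart_low_sub_le {b : ℂ} (hb : 1 < b.re) (hb2 : ‖b - 1‖ ≤ 3 / 2) :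
    ‖archPart b - (1 / (b - 1) - ∑ m ∈ Finset.range 15, 1 / (b + 2 * (m + 1)) - 1 / (2 * (b + 32))
      + (Real.log (33 / (2 * Real.pi)) / 2 : ℝ) + (b - 1) / 66)‖ ≤ 0.00101 := by
  have hbre : (b / 2).re = b.re / 2 := by simp
  have hbp : 0 < (b / 2).re := by rw [hbre]; linarith
  have hb0 : b ≠ 0 := by rintro rfl; simp at hb; linarith
  have hb32 : b + 32 ≠ 0 := by
    intro h; have := congrArg Complex.re h; simp at this; linarith
  set u := (b - 1) / 33 with hu
  have hun : ‖u‖ ≤ 1 / 22 := by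
    rw [hu, norm_div, norm_ofNat]; linarith
  have hur : 0 < (1 + u).re := by
    have := Complex.abs_re_le_norm u
    have := neg_abs_le u.re
    simp; linarith
  have hne : 1 + u ≠ 0 := by rintro h; rw [h] at hur; simp at hur
  have hlog : log (b / 2 + 16) = (Real.log (33 / 2) : ℂ) + log (1 + u) := by
    have e : b / 2 + 16 = ((33 / 2 : ℝ) : ℂ) * (1 + u) := by
      rw [hu]; push_cast; ring
    rw [e, Complex.log_ofReal_mul (by norm_num) hne]
  have hre16 : (b / 2 + 16).re = b.re / 2 + 16 := by simp
  have hr : 33 / 2 ≤ (b / 2 + 16).re + |(b / 2 + 16).im| := by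
    rw [hre16]; linarith [abs_nonneg (b / 2 + 16).im]
  have hD := norm_digammaErr_le (z := b / 2 + 16) (by rw [hre16]; linarith) (by linarith)
  have hD' : ‖digammaErr (b / 2 + 16)‖ ≤ 0.25 / (33 / 2) ^ 2 := hD.trans (by gcongr)
  have hlog1 := Complex.norm_log_one_add_sub_self_le (z := u) (by linarith)
  have h1 : (1 - ‖u‖)⁻¹ ≤ 22 / 21 := by
    rw [inv_le_comm₀ (by linarith) (by norm_num)]; norm_num at hun ⊢; linarith
  have h2 : ‖log (1 + u) - u‖ ≤ (1 / 22) ^ 2 * (22 / 21) / 2 := by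
    refine hlog1.trans ?_
    have : 0 ≤ (1 - ‖u‖)⁻¹ := inv_nonneg.2 (by linarith)
    gcongr
  have hdg : digamma (b / 2) = digammaErr (b / 2 + 16) + log (b / 2 + 16) - 1 / (b + 32) -
      ∑ m ∈ Finset.range 16, 1 / (b / 2 + m) := by
    have := digamma_eq_add_nat hbp 16
    rw [this, digammaErr]
    push_cast
    rw [show 2 * (b / 2 + 16) = b + 32 by ring]
    ring
  have hsum : ∑ m ∈ Finset.range 16, 1 / (b / 2 + (m : ℂ)) =
      2 / b + 2 * ∑ m ∈ Finset.range 15, 1 / (b + 2 * ((m : ℂ) + 1)) := by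
    rw [Finset.sum_range_succ', Finset.mul_sum, add_comm]
    congr 1
    · simp
    · refine Finset.sum_congr rfl fun m _ => ?_
      have h3 : b + 2 * ((m : ℂ) + 1) ≠ 0 := by
        intro h; have := congrArg Complex.re h; simp at this
        linarith [Nat.cast_nonneg (α := ℝ) m]
      have h4 : b / 2 + ((m + 1 : ℕ) : ℂ) = (b + 2 * ((m : ℂ) + 1)) / 2 := by push_cast; ring
      rw [h4]
      field_simp
  have hdec : archPart b - (1 / (b - 1) - ∑ m ∈ Finset.range 15, 1 / (b + 2 * (m + 1))
      - 1 / (2 * (b + 32)) + (Real.log (33 / (2 * Real.pi)) / 2 : ℝ) + (b - 1) / 66) =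
      (log (1 + u) - u) / 2 + digammaErr (b / 2 + 16) / 2 := by
    rw [archPart, hdg, hlog, hsum, show 33 / (2 * Real.pi) = 33 / 2 / Real.pi by field_simp,
      Real.log_div (by norm_num) Real.pi_ne_zero, hu, mul_comm 2 (b + 32), ← div_div 1 (b + 32) 2]
    push_cast
    ring
  rw [hdec]
  refine (norm_add_le _ _).trans ?_
  rw [norm_div, norm_div, norm_ofNat]
  calc _ ≤ (1 / 22) ^ 2 * (22 / 21) / 2 / 2 + 0.25 / (33 / 2) ^ 2 / 2 := by gcongr
    _ ≤ (0.00101 : ℝ) := by norm_num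

end

section

open Complex

lemma hasSum_neg_logDeriv_riemannZeta {s : ℂ} (hs : 1 < s.re) :
    HasSum (LSeries.term (fun n => (ArithmeticFunction.vonMangoldt n : ℂ)) s)
      (-logDeriv riemannZeta s) := by
  have h := (ArithmeticFunction.LSeriesSummable_vonMangoldt hs).hasSum
  have h2 := ArithmeticFunction.LSeries_vonMangoldt_eq_deriv_riemannZeta_div hs
  rw [LSeries] at h2
  rw [h2] at h
  rw [logDeriv_apply, ← neg_div]
  exact h

/-- Mertens' positivity argument for a combination of several abscissae. -/
theorem sum_neg_logDeriv_riemannZeta_nonneg {ι : Type*} (J : Finset ι) (C b : ι → ℂ)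
    (hb : ∀ j ∈ J, 1 < (b j).re)
    (hf : ∀ n : ℕ, 2 ≤ n → ∃ r : ℝ, 0 ≤ r ∧ ∑ j ∈ J, C j * (n : ℂ) ^ (-b j) = r)
    (K : Finset ℕ) (a : ℕ → ℝ) (hP : ∀ θ : ℝ, 0 ≤ ∑ k ∈ K, a k * Real.cos (k * θ)) (γ : ℝ) :
    0 ≤ ∑ k ∈ K, a k * (∑ j ∈ J, C j * -logDeriv riemannZeta (b j + (k * γ : ℝ) * I)).re := by
  have h1 : ∀ k ∈ K, HasSum (fun n => a k * (∑ j ∈ J, C j *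
      LSeries.term (fun n => (ArithmeticFunction.vonMangoldt n : ℂ)) (b j + (k * γ : ℝ) * I) n).re)
      (a k * (∑ j ∈ J, C j * -logDeriv riemannZeta (b j + (k * γ : ℝ) * I)).re) := by
    intro k _
    refine (Complex.hasSum_re (hasSum_sum fun j hj => ?_)).mul_left _
    exact (hasSum_neg_logDeriv_riemannZeta (by simpa using hb j hj)).mul_left _
  refine (hasSum_sum h1).nonneg fun n => ?_
  rcases Nat.lt_or_ge n 2 with hn | hn
  · have : ∀ s, LSeries.term (fun n => (ArithmeticFunction.vonMangoldt n : ℂ)) s n = 0 := by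
      intro s
      interval_cases n
      · simp
      · simp [LSeries.term]
    simp [this]
  · obtain ⟨r, hr, hr'⟩ := hf n hn
    have hn0 : n ≠ 0 := by omega
    have hnC : (n : ℂ) ≠ 0 := by exact_mod_cast hn0
    have hterm : ∀ k : ℕ, (∑ j ∈ J, C j *
        LSeries.term (fun n => (ArithmeticFunction.vonMangoldt n : ℂ)) (b j + (k * γ : ℝ) * I) n).re
        = ArithmeticFunction.vonMangoldt n * r * Real.cos (k * (γ * Real.log n)) := by
      intro k
      have h2 : ∀ j, C j * LSeries.term (fun n => (ArithmeticFunction.vonMangoldt n : ℂ))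
          (b j + (k * γ : ℝ) * I) n = (ArithmeticFunction.vonMangoldt n : ℂ) *
          (C j * (n : ℂ) ^ (-b j)) * exp ((-(k * (γ * Real.log n)) : ℝ) * I) := by
        intro j
        rw [LSeries.term_of_ne_zero hn0, cpow_add _ _ hnC, cpow_neg,
          cpow_def_of_ne_zero hnC (((k * γ : ℝ) : ℂ) * I), ← natCast_log]
        have : exp ((-(k * (γ * Real.log n)) : ℝ) * I) =
            (exp ((Real.log n : ℂ) * (((k * γ : ℝ) : ℂ) * I)))⁻¹ := by
          rw [← exp_neg]; congr 1; push_cast; ring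
        rw [this]
        field_simp
      rw [Finset.sum_congr rfl fun j _ => h2 j, ← Finset.sum_mul, ← Finset.mul_sum, hr',
        ← ofReal_mul, re_ofReal_mul, exp_ofReal_mul_I_re, Real.cos_neg]
    simp only [hterm]
    have h3 := hP (γ * Real.log n)
    have h4 := mul_nonneg (mul_nonneg (ArithmeticFunction.vonMangoldt_nonneg (n := n)) hr) h3
    rw [Finset.mul_sum] at h4
    refine h4.trans_eq (Finset.sum_congr rfl fun k _ => by ring)

end

section

open Complex ComplexConjugate

lemma riemannXi_ne_zero_of_one_lt_re {s : ℂ} (hs : 1 < s.re) : riemannXi s ≠ 0 := by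
  have hs0 : s ≠ 0 := by rintro rfl; simp at hs; linarith
  have hs1 : s ≠ 1 := by rintro rfl; simp at hs
  rw [riemannXi_eq (by linarith) hs1]
  exact mul_ne_zero (mul_ne_zero (mul_ne_zero hs0 (sub_ne_zero.2 hs1))
    (Gammaℝ_ne_zero_of_re_pos (by linarith))) (riemannZeta_ne_zero_of_one_lt_re hs)

lemma re_sum_mul_le_of_norm_sub_le {ι : Type*} (J : Finset ι) (C x y : ι → ℂ) {E W : ℝ}
    (hE : 0 ≤ E) (hW : ∑ j ∈ J, ‖C j‖ ≤ W) (h : ∀ j ∈ J, ‖x j - y j‖ ≤ E) :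
    (∑ j ∈ J, C j * x j).re ≤ (∑ j ∈ J, C j * y j).re + W * E := by
  have h1 : ‖∑ j ∈ J, C j * x j - ∑ j ∈ J, C j * y j‖ ≤ W * E := by
    rw [← Finset.sum_sub_distrib]
    calc _ ≤ ∑ j ∈ J, ‖C j * x j - C j * y j‖ := norm_sum_le _ _
      _ ≤ ∑ j ∈ J, ‖C j‖ * E := by
        refine Finset.sum_le_sum fun j hj => ?_
        rw [← mul_sub, norm_mul]
        exact mul_le_mul_of_nonneg_left (h j hj) (norm_nonneg _)
      _ ≤ W * E := by rw [← Finset.sum_mul]; exact mul_le_mul_of_nonneg_right hW hE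
  have h2 := (Complex.re_le_norm _).trans h1
  rw [sub_re] at h2
  linarith

section

variable {ι : Type*} (J : Finset ι) (C b : ι → ℂ) {f₀ W : ℝ}

lemma re_sum_neg_logDeriv_high_le (hb : ∀ j ∈ J, 1 < (b j).re) (hb2 : ∀ j ∈ J, ‖b j‖ ≤ 5 / 2)
    (hW : ∑ j ∈ J, ‖C j‖ ≤ W) (hC : ∑ j ∈ J, C j = f₀) (hCb : (∑ j ∈ J, C j * b j).im = 0)
    {T : ℝ} (hT : 60 ≤ T) :
    (∑ j ∈ J, C j * -logDeriv riemannZeta (b j + T * I)).re ≤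
      f₀ * (Real.log (T / (2 * Real.pi)) / 2) + W * (6.5 / T ^ 2) -
      (∑ j ∈ J, C j * logDeriv riemannXi (b j + T * I)).re := by
  have h1 := re_sum_mul_le_of_norm_sub_le J C (fun j => archPart (b j + T * I)) _ (by positivity) hW
    (fun j hj => norm_archPart_high_sub_le hT (hb j hj) (hb2 j hj))
  have h2 : ∑ j ∈ J, C j * -logDeriv riemannZeta (b j + T * I) =
      ∑ j ∈ J, C j * archPart (b j + T * I) - ∑ j ∈ J, C j * logDeriv riemannXi (b j + T * I) := by
    rw [← Finset.sum_sub_distrib]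
    refine Finset.sum_congr rfl fun j hj => ?_
    rw [neg_logDeriv_riemannZeta (by simpa using hb j hj), mul_sub]
  have h3 : (∑ j ∈ J, C j * ((Real.log (T / (2 * Real.pi)) / 2 : ℝ) + Real.pi / 4 * I
      + (b j + 3) / (2 * (T * I)))) = ((f₀ * (Real.log (T / (2 * Real.pi)) / 2) : ℝ) : ℂ)
      + ((f₀ * (Real.pi / 4) - (∑ j ∈ J, C j * b j).re / (2 * T) - 3 * f₀ / (2 * T) : ℝ) : ℂ) * I
        := by
    obtain ⟨r, e⟩ : ∃ r : ℝ, ∑ j ∈ J, C j * b j = r :=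
      ⟨(∑ j ∈ J, C j * b j).re, by apply Complex.ext <;> simp [hCb]⟩
    have hT0 : (T : ℂ) ≠ 0 := by exact_mod_cast (by linarith : T ≠ 0)
    have e2 : ∀ j, C j * (((Real.log (T / (2 * Real.pi)) / 2 : ℝ) : ℂ) + Real.pi / 4 * I
      + (b j + 3) / (2 * (T * I))) = C j * (((Real.log (T / (2 * Real.pi)) / 2 : ℝ) : ℂ)
        + Real.pi / 4 * I + 3 / (2 * (T * I))) + C j * b j * (1 / (2 * (T * I))) := by
      intro j; ring
    rw [Finset.sum_congr rfl fun j _ => e2 j, Finset.sum_add_distrib, ← Finset.sum_mul,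
      ← Finset.sum_mul, hC, e, ofReal_re]
    push_cast
    have hI := I_ne_zero
    field_simp
    ring_nf
    simp only [I_sq]
    ring
  rw [h2, sub_re]
  rw [h3, add_re, ofReal_re, re_ofReal_mul, I_re, mul_zero, add_zero] at h1
  linarith

lemma re_sum_neg_logDeriv_low_le (hb : ∀ j ∈ J, 1 < (b j).re) (hb2 : ∀ j ∈ J, ‖b j - 1‖ ≤ 3 / 2)
    (hW : ∑ j ∈ J, ‖C j‖ ≤ W) (hC : ∑ j ∈ J, C j = f₀) :
    (∑ j ∈ J, C j * -logDeriv riemannZeta (b j)).re ≤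
      (∑ j ∈ J, C j * (1 / (b j - 1) - ∑ m ∈ Finset.range 15, 1 / (b j + 2 * (m + 1))
        - 1 / (2 * (b j + 32)) + (b j - 1) / 66)).re + f₀ * (Real.log (33 / (2 * Real.pi)) / 2)
      + W * 0.00101 - (∑ j ∈ J, C j * logDeriv riemannXi (b j)).re := by
  have h1 := re_sum_mul_le_of_norm_sub_le J C (fun j => archPart (b j)) _ (by norm_num) hW
    (fun j hj => norm_archPart_low_sub_le (hb j hj) (hb2 j hj))
  have h2 : ∑ j ∈ J, C j * -logDeriv riemannZeta (b j) =
      ∑ j ∈ J, C j * archPart (b j) - ∑ j ∈ J, C j * logDeriv riemannXi (b j) := by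
    rw [← Finset.sum_sub_distrib]
    refine Finset.sum_congr rfl fun j hj => ?_
    rw [neg_logDeriv_riemannZeta (hb j hj), mul_sub]
  have h3 : (∑ j ∈ J, C j * (1 / (b j - 1) - ∑ m ∈ Finset.range 15, 1 / (b j + 2 * ((m : ℂ) + 1))
      - 1 / (2 * (b j + 32)) + (Real.log (33 / (2 * Real.pi)) / 2 : ℝ) + (b j - 1) / 66)) =
      (∑ j ∈ J, C j * (1 / (b j - 1) - ∑ m ∈ Finset.range 15, 1 / (b j + 2 * ((m : ℂ) + 1))
        - 1 / (2 * (b j + 32)) + (b j - 1) / 66)) +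
        ((f₀ * (Real.log (33 / (2 * Real.pi)) / 2) : ℝ) : ℂ) := by
    rw [ofReal_mul, ← hC, Finset.sum_mul, ← Finset.sum_add_distrib]
    refine Finset.sum_congr rfl fun j _ => ?_
    ring
  rw [h2, sub_re]
  rw [h3, add_re, ofReal_re] at h1
  linarith

/-- The basic inequality satisfied by a zero `ρ₀` of the zeta-function. -/
theorem zero_inequality (hb : ∀ j ∈ J, 1 < (b j).re) (hb1 : ∀ j ∈ J, ‖b j‖ ≤ 5 / 2)
    (hb2 : ∀ j ∈ J, ‖b j - 1‖ ≤ 3 / 2) (hW : ∑ j ∈ J, ‖C j‖ ≤ W) (hC : ∑ j ∈ J, C j = f₀)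
    (hCb : (∑ j ∈ J, C j * b j).im = 0)
    (hf : ∀ n : ℕ, 2 ≤ n → ∃ r : ℝ, 0 ≤ r ∧ ∑ j ∈ J, C j * (n : ℂ) ^ (-b j) = r)
    (a : ℕ → ℝ) (ha : ∀ k, 0 ≤ a k)
    (hP : ∀ θ : ℝ, 0 ≤ ∑ k ∈ Finset.range 5, a k * Real.cos (k * θ))
    {ρ₀ : ℂ} (h₀ : riemannXi ρ₀ = 0) (hβ : ρ₀.re ≠ 1 / 2) (hγ : 60 ≤ ρ₀.im)
    (hΦ : ∀ k : ℕ, k ≤ 4 → ∀ ρ, riemannXi ρ = 0 → 0 ≤ (∑ j ∈ J, C j *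
      (1 / (b j + (k * ρ₀.im : ℝ) * I - ρ) + 1 / (b j + (k * ρ₀.im : ℝ) * I - 1 + conj ρ))).re) :
    0 ≤ a 0 * ((∑ j ∈ J, C j * (1 / (b j - 1) - ∑ m ∈ Finset.range 15, 1 / (b j + 2 * (m + 1))
        - 1 / (2 * (b j + 32)) + (b j - 1) / 66)).re + f₀ * (Real.log (33 / (2 * Real.pi)) / 2)
        + W * 0.00101) +
      ∑ k ∈ Finset.Icc 1 4, a k * (f₀ * (Real.log (k * ρ₀.im / (2 * Real.pi)) / 2)
        + W * (6.5 / (k * ρ₀.im) ^ 2)) -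
      a 1 * (∑ j ∈ J, C j * (1 / (b j + ρ₀.im * I - ρ₀)
        + 1 / (b j + ρ₀.im * I - 1 + conj ρ₀))).re := by
  obtain ⟨K, hK, hgr⟩ := norm_riemannXi_le
  have hCim : (∑ j ∈ J, C j).im = 0 := by rw [hC, ofReal_im]
  have key : ∀ k : ℕ, k ≤ 4 → ∀ Z : Finset ℂ, (∀ ρ ∈ Z, riemannXi ρ = 0) → _ := fun k hk Z hZ =>
    half_sum_zeros_le differentiable_riemannXi (by rw [riemannXi_zero]; exact one_ne_zero)
      riemannXi_one_sub_conj hK hgr J C (fun j => b j + (k * ρ₀.im : ℝ) * I) hCim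
      (fun j hj => riemannXi_ne_zero_of_one_lt_re (by simpa using hb j hj)) (hΦ k hk) Z hZ
  have hpos := sum_neg_logDeriv_riemannZeta_nonneg J C b hb hf (Finset.range 5) a hP ρ₀.im
  have hne : ρ₀ ≠ 1 - conj ρ₀ := by
    intro h
    have := congrArg Complex.re h
    simp at this
    exact hβ (by linarith)
  have hZ : ∀ ρ ∈ ({ρ₀, 1 - conj ρ₀} : Finset ℂ), riemannXi ρ = 0 := by
    intro ρ hρ
    simp only [Finset.mem_insert, Finset.mem_singleton] at hρ
    rcases hρ with rfl | rfl
    · exact h₀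
    · rw [riemannXi_one_sub_conj, h₀, map_zero]
  have k1 := key 1 (by norm_num) _ hZ
  rw [Finset.sum_pair hne] at k1
  simp only [map_sub, map_one, conj_conj, Nat.cast_one, one_mul] at k1
  have esym : (∑ j ∈ J, C j * (1 / (b j + ρ₀.im * I - (1 - conj ρ₀))
      + 1 / (b j + ρ₀.im * I - 1 + (1 - ρ₀)))).re = (∑ j ∈ J, C j * (1 / (b j + ρ₀.im * I - ρ₀)
      + 1 / (b j + ρ₀.im * I - 1 + conj ρ₀))).re := by
    congr 1
    refine Finset.sum_congr rfl fun j _ => ?_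
    rw [add_comm (1 / _)]
    congr 3 <;> ring
  rw [esym] at k1
  have k0 := key 0 (by norm_num) ∅ (by simp)
  have k2 := key 2 (by norm_num) ∅ (by simp)
  have k3 := key 3 (by norm_num) ∅ (by simp)
  have k4 := key 4 (by norm_num) ∅ (by simp)
  rw [Finset.sum_empty, mul_zero] at k0 k2 k3 k4
  have l0 := re_sum_neg_logDeriv_low_le J C b hb hb2 hW hC
  have hh : ∀ k : ℕ, 1 ≤ k → _ := fun k hk =>
    re_sum_neg_logDeriv_high_le J C b hb hb1 hW hC hCb (T := k * ρ₀.im) (by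
      have : (1 : ℝ) ≤ k := by exact_mod_cast hk
      nlinarith)
  have l1 := hh 1 le_rfl
  have l2 := hh 2 (by norm_num)
  have l3 := hh 3 (by norm_num)
  have l4 := hh 4 (by norm_num)
  rw [Finset.sum_range_succ, Finset.sum_range_succ, Finset.sum_range_succ, Finset.sum_range_succ,
    Finset.sum_range_one] at hpos
  rw [show Finset.Icc 1 4 = {1, 2, 3, 4} from rfl, Finset.sum_insert (by simp),
    Finset.sum_insert (by simp), Finset.sum_insert (by simp), Finset.sum_singleton]
  simp only [Nat.cast_zero, zero_mul, ofReal_zero, add_zero, Nat.cast_one, one_mul] at *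
  have m0 := mul_le_mul_of_nonneg_left (l0.trans (sub_le_self _ k0)) (ha 0)
  have m1 := mul_le_mul_of_nonneg_left (l1.trans (sub_le_sub_left k1 _)) (ha 1)
  have m2 := mul_le_mul_of_nonneg_left (l2.trans (sub_le_self _ k2)) (ha 2)
  have m3 := mul_le_mul_of_nonneg_left (l3.trans (sub_le_self _ k3)) (ha 3)
  have m4 := mul_le_mul_of_nonneg_left (l4.trans (sub_le_self _ k4)) (ha 4)
  refine hpos.trans ((add_le_add (add_le_add (add_le_add (add_le_add m0 m1) m2) m3) m4).trans
    (le_of_eq ?_))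
  push_cast
  ring

end

lemma riemannXi_eq_zero_iff {s : ℂ} (hs : 0 < s.re) (h1 : s ≠ 1) :
    riemannXi s = 0 ↔ riemannZeta s = 0 := by
  have hs0 : s ≠ 0 := by rintro rfl; simp at hs
  rw [riemannXi_eq hs h1, mul_eq_zero, or_iff_right]
  exact mul_ne_zero (mul_ne_zero hs0 (sub_ne_zero.2 h1)) (Gammaℝ_ne_zero_of_re_pos hs)

lemma re_lt_one_of_riemannXi_eq_zero {s : ℂ} (h : riemannXi s = 0) : s.re < 1 := by
  by_contra! hs
  have h1 : s ≠ 1 := by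
    rintro rfl
    have := riemannXi_one_sub 0
    rw [sub_zero, riemannXi_zero, h] at this
    exact zero_ne_one this
  exact riemannZeta_ne_zero_of_one_le_re hs ((riemannXi_eq_zero_iff (by linarith) h1).1 h)

lemma re_pos_of_riemannXi_eq_zero {s : ℂ} (h : riemannXi s = 0) : 0 < s.re := by
  have := re_lt_one_of_riemannXi_eq_zero (s := 1 - s) (by rw [riemannXi_one_sub, h])
  simp at this
  exact this

lemma three_four_one (θ : ℝ) :
    0 ≤ 3 + 4 * Real.cos θ + Real.cos (2 * θ) := by
  rw [Real.cos_two_mul]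
  nlinarith [sq_nonneg (1 + Real.cos θ)]

/-- A classical zero-free region. -/
theorem classical_zero_free_region {ρ : ℂ} (h : riemannXi ρ = 0) (hγ : 60 ≤ ρ.im) :
    1 ≤ 56 * (1 - ρ.re) * Real.log ρ.im := by
  set L := Real.log ρ.im with hL
  have hγ0 : 0 < ρ.im := by linarith
  have hL4 : 4 ≤ L := by
    rw [hL, Real.le_log_iff_exp_le hγ0]
    have := Real.exp_one_lt_d9
    have h4 : Real.exp 4 = Real.exp 1 ^ 4 := by rw [← Real.exp_nat_mul]; norm_num
    rw [h4]
    calc Real.exp 1 ^ 4 ≤ 2.7182818286 ^ 4 := by gcongr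
      _ ≤ 60 := by norm_num
      _ ≤ _ := hγ
  have hre1 := re_lt_one_of_riemannXi_eq_zero h
  have hre0 := re_pos_of_riemannXi_eq_zero h
  by_cases hhalf : ρ.re = 1 / 2
  · rw [hhalf]; linarith
  set δ := 1 / (8 * L) with hδ
  have hδ0 : 0 < δ := by positivity
  have hδ1 : δ ≤ 1 / 32 := by rw [hδ]; apply one_div_le_one_div_of_le <;> linarith
  set b : ℂ := ((1 + δ : ℝ) : ℂ) with hb
  have hbre : b.re = 1 + δ := ofReal_re _
  have key := zero_inequality (ι := Unit) (f₀ := 1) (W := 1) {()} (fun _ => 1) (fun _ => b)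
    (by simp [hbre, hδ0]) (by
      simp only [hb, Complex.norm_real, Real.norm_eq_abs]
      rw [abs_of_nonneg (by linarith)]; intros; linarith)
    (by
      intro _ _
      rw [show b - 1 = ((δ : ℝ) : ℂ) by rw [hb]; push_cast; ring, Complex.norm_real,
        Real.norm_of_nonneg hδ0.le]
      linarith) (by simp) (by simp) (by simp [hb])
    (fun n hn => ⟨(n : ℝ) ^ (-(1 + δ)), by positivity, by
      rw [Finset.sum_singleton, one_mul, hb, ← ofReal_neg, ofReal_cpow (by positivity)]
      simp⟩)
    (fun k => if k = 0 then 3 else if k = 1 then 4 else if k = 2 then 1 else 0)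
    (fun k => by split_ifs <;> norm_num)
    (fun θ => by
      have := three_four_one θ
      simp [Finset.sum_range_succ]
      linarith) h hhalf hγ (fun k _ ρ' hρ' => by
      have h1 := re_lt_one_of_riemannXi_eq_zero hρ'
      have h0 := re_pos_of_riemannXi_eq_zero hρ'
      have hpos : ∀ z : ℂ, 0 < z.re → 0 ≤ (1 / z).re := by
        intro z hz
        rw [one_div, inv_re]
        exact div_nonneg hz.le (normSq_nonneg z)
      rw [Finset.sum_singleton, one_mul, add_re]
      refine add_nonneg (hpos _ ?_) (hpos _ ?_)
      · rw [sub_re, add_re, hbre, re_ofReal_mul, I_re]; linarith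
      · rw [add_re, sub_re, add_re, hbre, re_ofReal_mul, I_re, conj_re, one_re]; linarith)
  simp only [Finset.sum_singleton, one_mul] at key
  rw [show Finset.Icc 1 4 = {1, 2, 3, 4} from rfl, Finset.sum_insert (by simp),
    Finset.sum_insert (by simp), Finset.sum_insert (by simp), Finset.sum_singleton] at key
  norm_num at key
  have hm : 0 ≤ ∑ x ∈ Finset.range 15, (b.re + 2 * ((x : ℝ) + 1)) / normSq (b + 2 * (x + 1)) :=
    Finset.sum_nonneg fun m _ => div_nonneg (by rw [hbre]; positivity) (normSq_nonneg _)
  have hm2 : 0 ≤ (b.re + 32) / normSq (b + 32) * (1 / 2) :=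
    mul_nonneg (div_nonneg (by rw [hbre]; positivity) (normSq_nonneg _)) (by norm_num)
  have hm3 : 0 ≤ (b.re - 1 + ρ.re) / normSq (b + ↑ρ.im * I - 1 + (starRingEnd ℂ) ρ) :=
    div_nonneg (by rw [hbre]; linarith) (normSq_nonneg _)
  have hd : 0 < 1 + δ - ρ.re := by linarith
  have e1 : (b.re - ρ.re) / normSq (b + ↑ρ.im * I - ρ) = 1 / (1 + δ - ρ.re) := by
    have : b + ↑ρ.im * I - ρ = ((1 + δ - ρ.re : ℝ) : ℂ) := by
      apply Complex.ext <;> simp [hb]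
    rw [this, normSq_ofReal, hbre]
    field_simp
  have e2 : (b.re - 1) / normSq (b - 1) = 1 / δ := by
    have : b - 1 = ((δ : ℝ) : ℂ) := by rw [hb]; push_cast; ring
    rw [this, normSq_ofReal, hbre]
    field_simp
    ring
  have hpi := Real.pi_gt_three
  have l1 : Real.log (33 / (2 * Real.pi)) ≤ 3 := by
    rw [Real.log_le_iff_le_exp (by positivity)]
    have h4 : Real.exp 3 = Real.exp 1 ^ 3 := by rw [← Real.exp_nat_mul]; norm_num
    have := Real.exp_one_gt_d9
    rw [h4, div_le_iff₀ (by positivity)]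
    have : (2.7 : ℝ) ^ 3 ≤ Real.exp 1 ^ 3 := by gcongr; linarith
    nlinarith
  have l2 : Real.log (ρ.im / (2 * Real.pi)) ≤ L :=
    Real.log_le_log (by positivity) (div_le_self hγ0.le (by linarith))
  have l3 : Real.log (2 * ρ.im / (2 * Real.pi)) ≤ L := by
    refine Real.log_le_log (by positivity) ?_
    rw [mul_div_mul_left _ _ (by norm_num)]
    exact div_le_self hγ0.le (by linarith)
  have l4 : 13 / 2 / ρ.im ^ 2 ≤ 1 / 100 := by
    rw [div_le_iff₀ (by positivity)]; nlinarith
  have l5 : 13 / 2 / (2 * ρ.im) ^ 2 ≤ 1 / 100 := by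
    rw [div_le_iff₀ (by positivity)]; nlinarith
  rw [e1, e2] at key
  have hδL : 1 / δ = 8 * L := by rw [hδ, one_div_one_div]
  have k2 : 4 * (1 / (1 + δ - ρ.re)) ≤ 28 * L := by
    rw [hδL] at key
    rw [hbre] at key hm2 hm hm3
    linarith
  have k3 : 4 ≤ 28 * L * (1 + δ - ρ.re) := by
    rw [mul_one_div, div_le_iff₀ hd] at k2
    exact k2
  have k4 : δ * L = 1 / 8 := by rw [hδ]; field_simp
  nlinarith

end

/-- Evaluation of an integer polynomial given by its list of coefficients. -/
def polyEval (x : ℝ) : List ℤ → ℝ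
  | [] => 0
  | c :: l => c + x * polyEval x l

def polyAdd : List ℤ → List ℤ → List ℤ
  | [], q => q
  | p, [] => p
  | a :: p, b :: q => (a + b) :: polyAdd p q

def polyMul : List ℤ → List ℤ → List ℤ
  | [], _ => []
  | a :: p, q => polyAdd (q.map (a * ·)) (0 :: polyMul p q)

/-- Evaluation of a polynomial in `y` whose coefficients are integer polynomials in `x`. -/
def bipolyEval (x y : ℝ) : List (List ℤ) → ℝ
  | [] => 0
  | c :: l => polyEval x c + y * bipolyEval x y l

def bipolyAdd : List (List ℤ) → List (List ℤ) → List (List ℤ)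
  | [], q => q
  | p, [] => p
  | a :: p, b :: q => polyAdd a b :: bipolyAdd p q

def bipolyMul : List (List ℤ) → List (List ℤ) → List (List ℤ)
  | [], _ => []
  | a :: p, q => bipolyAdd (q.map (polyMul a)) ([] :: bipolyMul p q)

/-- Numerator and denominator of a sum of fractions. -/
def fracSum : List (List (List ℤ) × List (List ℤ)) → List (List ℤ) × List (List ℤ)
  | [] => ([], [[1]])
  | f :: L =>
    (bipolyAdd (bipolyMul f.1 (fracSum L).2) (bipolyMul (fracSum L).1 f.2),
      bipolyMul f.2 (fracSum L).2)

noncomputable def fracEval (x y : ℝ) (L : List (List (List ℤ) × List (List ℤ))) : ℝ :=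
  (L.map fun f => bipolyEval x y f.1 / bipolyEval x y f.2).sum

/-- The coefficients of `(1 + s) ^ n * p (s / (1 + s))`, together with those of `(1 + s) ^ n`,
where `n` is the length of `p`. -/
def polyMoebius : List ℤ → List ℤ × List ℤ
  | [] => ([], [1])
  | c :: l =>
    let r := polyMoebius l
    let w := polyAdd r.2 (0 :: r.2)
    (polyAdd (w.map (c * ·)) (0 :: r.1), w)

def bipolyCheck (p : List (List ℤ)) : Bool :=
  p.all fun c => (polyMoebius c).1.all fun a => decide (0 ≤ a)

lemma polyEval_add (x : ℝ) (p q : List ℤ) :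
    polyEval x (polyAdd p q) = polyEval x p + polyEval x q := by
  fun_induction polyAdd p q with
  | case1 => simp [polyEval]
  | case2 => simp [polyEval]
  | case3 a p b q ih => simp only [polyEval, ih]; push_cast; ring

lemma polyEval_map_mul (x : ℝ) (a : ℤ) (p : List ℤ) :
    polyEval x (p.map (a * ·)) = a * polyEval x p := by
  induction p with
  | nil => simp [polyEval]
  | cons b p ih => simp only [List.map_cons, polyEval, ih]; push_cast; ring

lemma polyEval_mul (x : ℝ) (p q : List ℤ) :
    polyEval x (polyMul p q) = polyEval x p * polyEval x q := by
  induction p with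
  | nil => simp [polyEval, polyMul]
  | cons a p ih =>
    simp only [polyMul, polyEval_add, polyEval_map_mul, polyEval, ih]; push_cast; ring

lemma bipolyEval_add (x y : ℝ) (p q : List (List ℤ)) :
    bipolyEval x y (bipolyAdd p q) = bipolyEval x y p + bipolyEval x y q := by
  fun_induction bipolyAdd p q with
  | case1 => simp [bipolyEval]
  | case2 => simp [bipolyEval]
  | case3 a p b q ih => simp only [bipolyEval, ih, polyEval_add]; ring

lemma bipolyEval_map_mul (x y : ℝ) (a : List ℤ) (p : List (List ℤ)) :
    bipolyEval x y (p.map (polyMul a)) = polyEval x a * bipolyEval x y p := by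
  induction p with
  | nil => simp [bipolyEval]
  | cons b p ih => simp only [List.map_cons, bipolyEval, ih, polyEval_mul]; ring

lemma bipolyEval_mul (x y : ℝ) (p q : List (List ℤ)) :
    bipolyEval x y (bipolyMul p q) = bipolyEval x y p * bipolyEval x y q := by
  induction p with
  | nil => simp [bipolyEval, bipolyMul]
  | cons a p ih =>
    simp only [bipolyMul, bipolyEval_add, bipolyEval_map_mul, bipolyEval, polyEval, ih]; ring

lemma polyEval_nonneg {x : ℝ} (hx : 0 ≤ x) {p : List ℤ} (hp : ∀ a ∈ p, 0 ≤ a) :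
    0 ≤ polyEval x p := by
  induction p with
  | nil => simp [polyEval]
  | cons b p ih =>
    have h1 : (0 : ℝ) ≤ b := by exact_mod_cast hp b (by simp)
    have h2 := ih fun a ha => hp a (by simp [ha])
    simp only [polyEval]; positivity

lemma polyEval_moebius {s : ℝ} (hs : 0 ≤ s) (p : List ℤ) :
    polyEval s (polyMoebius p).2 = (1 + s) ^ p.length ∧
      polyEval s (polyMoebius p).1 = (1 + s) ^ p.length * polyEval (s / (1 + s)) p := by
  induction p with
  | nil => simp [polyMoebius, polyEval]
  | cons c p ih =>
    have h : 1 + s ≠ 0 := by positivity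
    simp only [polyMoebius, polyEval_add, polyEval_map_mul, polyEval, ih.1, ih.2, List.length_cons]
    constructor
    · push_cast; ring
    · field_simp
      push_cast; ring

lemma polyEval_nonneg_of_moebius {x : ℝ} (hx : 0 ≤ x) (hx1 : x < 1) {p : List ℤ}
    (hp : ∀ a ∈ (polyMoebius p).1, 0 ≤ a) : 0 ≤ polyEval x p := by
  have h1 : 0 < 1 - x := by linarith
  have hs : 0 ≤ x / (1 - x) := by positivity
  have h := (polyEval_moebius hs p).2
  have e : x / (1 - x) / (1 + x / (1 - x)) = x := by field_simp; ring
  rw [e] at h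
  have h2 := polyEval_nonneg hs hp
  rw [h] at h2
  exact nonneg_of_mul_nonneg_right h2 (by positivity)

lemma bipolyEval_nonneg {x y : ℝ} (hx : 0 ≤ x) (hx1 : x < 1) (hy : 0 ≤ y) {p : List (List ℤ)}
    (hp : bipolyCheck p = true) : 0 ≤ bipolyEval x y p := by
  induction p with
  | nil => simp [bipolyEval]
  | cons c p ih =>
    simp only [bipolyCheck, List.all_cons, Bool.and_eq_true, List.all_eq_true,
      decide_eq_true_eq] at hp ih
    have h1 := polyEval_nonneg_of_moebius hx hx1 hp.1
    have h2 := ih hp.2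
    simp only [bipolyEval]; positivity

lemma fracEval_nonneg {x y : ℝ} (hx : 0 ≤ x) (hx1 : x < 1) (hy : 0 ≤ y)
    {L : List (List (List ℤ) × List (List ℤ))} (hL : ∀ f ∈ L, 0 < bipolyEval x y f.2)
    (hc : bipolyCheck (fracSum L).1 = true) : 0 ≤ fracEval x y L := by
  have key : 0 < bipolyEval x y (fracSum L).2 ∧
      fracEval x y L = bipolyEval x y (fracSum L).1 / bipolyEval x y (fracSum L).2 := by
    clear hc
    induction L with
    | nil => simp [fracSum, fracEval, bipolyEval, polyEval]
    | cons f L ih =>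
      obtain ⟨h1, h2⟩ := ih fun f hf => hL f (by simp [hf])
      have h3 := hL f (by simp)
      simp only [fracSum, fracEval, List.map_cons, List.sum_cons, bipolyEval_add,
        bipolyEval_mul] at h2 ⊢
      refine ⟨by positivity, ?_⟩
      rw [h2]; field_simp
  rw [key.2]
  exact div_nonneg (bipolyEval_nonneg hx hx1 hy hc) key.1.le

section

open Complex

noncomputable def nearKernel (η : ℝ) (z : ℂ) : ℂ :=
  (2675 / 1000 : ℝ) / (z + (5.6 * η : ℝ)) +
  ((-5637 / 1000 : ℝ) * (z + (5.95 * η : ℝ)) + (3146 / 1000 : ℝ) * (4.9 * η : ℝ)) /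
    ((z + (5.95 * η : ℝ)) ^ 2 + (4.9 * η : ℝ) ^ 2) +
  (5019 / 1000 : ℝ) / (z + (6.3 * η : ℝ)) +
  ((708 / 1000 : ℝ) * (z + (6.3 * η : ℝ)) + (0 / 1000 : ℝ) * (9.8 * η : ℝ)) /
    ((z + (6.3 * η : ℝ)) ^ 2 + (9.8 * η : ℝ) ^ 2)

noncomputable def farKernel (z : ℂ) : ℂ :=
  (-3039 / 1000 : ℝ) / (z + (1.053 : ℝ)) + (1781 / 1000 : ℝ) / (z + (1.453 : ℝ))

def realFrac (c : ℤ) (X Y : List (List ℤ)) : List (List ℤ) × List (List ℤ) :=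
  (bipolyMul [[c]] X, bipolyAdd (bipolyMul X X) Y)

def pairFrac (c s : ℤ) (X W Y : List (List ℤ)) : List (List ℤ) × List (List ℤ) :=
  let S := bipolyAdd (bipolyMul X X) (bipolyMul W W)
  let T := bipolyAdd S (bipolyMul [[-1]] Y)
  (bipolyAdd (bipolyMul [[c]] (bipolyMul X (bipolyAdd S Y))) (bipolyMul [[s]] (bipolyMul W T)),
    bipolyAdd (bipolyMul T T) (bipolyMul [[4]] (bipolyMul (bipolyMul X X) Y)))

def nearFracs (X W : ℤ → List (List ℤ)) (Y : List (List ℤ)) :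
    List (List (List ℤ) × List (List ℤ)) :=
  [realFrac 2675 (X 560) Y, pairFrac (-5637) 3146 (X 595) (W 490) Y, realFrac 5019 (X 630) Y,
    pairFrac 708 0 (X 630) (W 980) Y]

def farFracs (X : ℤ → List (List ℤ)) (Y : List (List ℤ)) :
    List (List (List ℤ) × List (List ℤ)) :=
  [realFrac (-3039) (X 10530) Y, realFrac 1781 (X 14530) Y]

lemma realFrac_spec {τ υ D x y : ℝ} {c : ℤ} {X Y : List (List ℤ)} (hD : 0 < D) (hx : 0 < x)
    (hX : bipolyEval τ υ X = D * x) (hY : bipolyEval τ υ Y = D ^ 2 * y ^ 2) {z : ℂ}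
    (hz : z = x + y * I) :
    0 < bipolyEval τ υ (realFrac c X Y).2 ∧
      bipolyEval τ υ (realFrac c X Y).1 / bipolyEval τ υ (realFrac c X Y).2 =
        1000 / D * (((c / 1000 : ℝ) : ℂ) / z).re := by
  subst hz
  simp only [realFrac, bipolyEval_add, bipolyEval_mul, hX, hY]
  have h : 0 < x ^ 2 + y ^ 2 := by positivity
  refine ⟨by positivity, ?_⟩
  simp [bipolyEval, polyEval, div_re, normSq_apply]
  have h' : x * x + y * y ≠ 0 := by nlinarith
  field_simp

lemma pairFrac_spec {τ υ D x y w : ℝ} {c s : ℤ} {X W Y : List (List ℤ)} (hD : 0 < D) (hx : 0 < x)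
    (hX : bipolyEval τ υ X = D * x) (hW : bipolyEval τ υ W = D * w)
    (hY : bipolyEval τ υ Y = D ^ 2 * y ^ 2) {z : ℂ} (hz : z = x + y * I) :
    0 < bipolyEval τ υ (pairFrac c s X W Y).2 ∧
      bipolyEval τ υ (pairFrac c s X W Y).1 / bipolyEval τ υ (pairFrac c s X W Y).2 =
        1000 / D * ((((c / 1000 : ℝ) : ℂ) * z + ((s / 1000 : ℝ) : ℂ) * w) / (z ^ 2 + w ^ 2)).re :=
          by
  subst hz
  simp only [pairFrac, bipolyEval_add, bipolyEval_mul, hX, hY, hW]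
  have e1 : ∀ k : ℤ, bipolyEval τ υ [[k]] = k := by simp [bipolyEval, polyEval]
  have h : 0 < (x ^ 2 + w ^ 2 - y ^ 2) ^ 2 + 4 * x ^ 2 * y ^ 2 := by
    rcases eq_or_ne y 0 with rfl | hy
    · simp; positivity
    · positivity
  have h1 : normSq ((x + y * I) ^ 2 + (w : ℂ) ^ 2) =
      (x ^ 2 + w ^ 2 - y ^ 2) ^ 2 + 4 * x ^ 2 * y ^ 2 := by
    simp [normSq_apply, pow_two]; ring
  simp only [e1]
  have h2 : (D * x * (D * x) + D * w * (D * w) + ((-1 : ℤ) : ℝ) * (D ^ 2 * y ^ 2)) *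
      (D * x * (D * x) + D * w * (D * w) + ((-1 : ℤ) : ℝ) * (D ^ 2 * y ^ 2)) +
      ((4 : ℤ) : ℝ) * (D * x * (D * x) * (D ^ 2 * y ^ 2)) =
      D ^ 4 * ((x ^ 2 + w ^ 2 - y ^ 2) ^ 2 + 4 * x ^ 2 * y ^ 2) := by push_cast; ring
  rw [h2, div_re, h1]
  refine ⟨by positivity, ?_⟩
  generalize hM : (x ^ 2 + w ^ 2 - y ^ 2) ^ 2 + 4 * x ^ 2 * y ^ 2 = M at *
  simp [pow_two]
  field_simp
  ring

lemma nearFracs_spec {τ υ D x y η : ℝ} {X W : ℤ → List (List ℤ)} {Y : List (List ℤ)}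
    (hD : 0 < D) (hη : 0 ≤ η) (hx : 0 < x + 5.6 * η)
    (hX : ∀ u : ℤ, bipolyEval τ υ (X u) = D * (x + u / 100 * η))
    (hW : ∀ w : ℤ, bipolyEval τ υ (W w) = D * (w / 100 * η))
    (hY : bipolyEval τ υ Y = D ^ 2 * y ^ 2) :
    (∀ f ∈ nearFracs X W Y, 0 < bipolyEval τ υ f.2) ∧
      fracEval τ υ (nearFracs X W Y) = 1000 / D * (nearKernel η (x + y * I)).re := by
  have z : ∀ a b : ℝ, a = b → ((x : ℂ) + y * I) + (a : ℂ) = ((x + b : ℝ) : ℂ) + y * I := by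
    rintro a b rfl; push_cast; ring
  obtain ⟨p1, e1⟩ := realFrac_spec (c := 2675) hD (by norm_num; linarith) (hX 560) hY
    (z (5.6 * η) _ (by norm_num))
  obtain ⟨p2, e2⟩ := pairFrac_spec (c := -5637) (s := 3146) hD (by norm_num; linarith) (hX 595)
    (hW 490) hY (z (5.95 * η) _ (by norm_num))
  obtain ⟨p3, e3⟩ := realFrac_spec (c := 5019) hD (by norm_num; linarith) (hX 630) hY
    (z (6.3 * η) _ (by norm_num))
  obtain ⟨p4, e4⟩ := pairFrac_spec (c := 708) (s := 0) hD (by norm_num; linarith) (hX 630)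
    (hW 980) hY (z (6.3 * η) _ (by norm_num))
  refine ⟨by simp only [nearFracs, List.forall_mem_cons]; exact ⟨p1, p2, p3, p4, by simp⟩, ?_⟩
  simp only [nearFracs, fracEval, List.map_cons, List.map_nil, List.sum_cons, List.sum_nil,
    e1, e2, e3, e4, nearKernel, add_re]
  norm_num
  ring

lemma farFracs_spec {τ υ x y : ℝ} {X : ℤ → List (List ℤ)} {Y : List (List ℤ)}
    (hx : 0 < x + 1.053)
    (hX : ∀ u : ℤ, bipolyEval τ υ (X u) = 10000 * (x + u / 10000))
    (hY : bipolyEval τ υ Y = 10000 ^ 2 * y ^ 2) :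
    (∀ f ∈ farFracs X Y, 0 < bipolyEval τ υ f.2) ∧
      fracEval τ υ (farFracs X Y) = 1 / 10 * (farKernel (x + y * I)).re := by
  have z : ∀ a b : ℝ, a = b → ((x : ℂ) + y * I) + (a : ℂ) = ((x + b : ℝ) : ℂ) + y * I := by
    rintro a b rfl; push_cast; ring
  obtain ⟨p1, e1⟩ := realFrac_spec (c := -3039) (by norm_num) (by norm_num; linarith) (hX 10530) hY
    (z 1.053 _ (by norm_num))
  obtain ⟨p2, e2⟩ := realFrac_spec (c := 1781) (by norm_num) (by norm_num; linarith) (hX 14530) hY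
    (z 1.453 _ (by norm_num))
  refine ⟨by simp only [farFracs, List.forall_mem_cons]; exact ⟨p1, p2, by simp⟩, ?_⟩
  simp only [farFracs, fracEval, List.map_cons, List.map_nil, List.sum_cons, List.sum_nil,
    e1, e2, farKernel, add_re]
  norm_num
  ring

lemma fracEval_append (x y : ℝ) (L M : List (List (List ℤ) × List (List ℤ))) :
    fracEval x y (L ++ M) = fracEval x y L + fracEval x y M := by
  simp [fracEval]

lemma re_nearKernel_one_nonneg (v : ℝ) : 0 ≤ (nearKernel 1 ((-0.54 : ℝ) + v * I)).re := by
  have key : ∀ (Y : List (List ℤ)) (τ υ : ℝ), 0 ≤ τ → τ < 1 → 0 ≤ υ →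
      bipolyEval τ υ Y = 100 ^ 2 * v ^ 2 →
      bipolyCheck (fracSum (nearFracs (fun u => [[u - 54]]) (fun w => [[w]]) Y)).1 = true →
      0 ≤ (nearKernel 1 ((-0.54 : ℝ) + v * I)).re := by
    intro Y τ υ h1 h2 h3 hY hc
    obtain ⟨hp, he⟩ := nearFracs_spec (τ := τ) (υ := υ) (D := 100) (x := -0.54) (y := v) (η := 1)
      (X := fun u => [[u - 54]]) (W := fun w => [[w]]) (Y := Y) (by norm_num) (by norm_num)
      (by norm_num) (by intro u; simp [bipolyEval, polyEval]; ring)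
      (by intro u; simp [bipolyEval, polyEval]; ring) hY
    have h := fracEval_nonneg h1 h2 h3 hp hc
    rw [he] at h
    linarith
  have hv := sq_nonneg v
  rcases lt_or_ge (v ^ 2) 100 with h1 | h1
  · exact key [[0, 1000000]] (v ^ 2 / 100) 0 (by positivity) (by linarith) le_rfl
      (by simp [bipolyEval, polyEval]; ring) (by decide +kernel)
  rcases lt_or_ge (v ^ 2) 200 with h2 | h2
  · exact key [[1000000, 1000000]] ((v ^ 2 - 100) / 100) 0 (by linarith) (by linarith) le_rfl
      (by simp [bipolyEval, polyEval]; ring) (by decide +kernel)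
  rcases lt_or_ge (v ^ 2) 300 with h3 | h3
  · exact key [[2000000, 1000000]] ((v ^ 2 - 200) / 100) 0 (by linarith) (by linarith) le_rfl
      (by simp [bipolyEval, polyEval]; ring) (by decide +kernel)
  · exact key [[3000000], [1]] 0 (10000 * (v ^ 2 - 300)) le_rfl (by norm_num) (by linarith)
      (by simp [bipolyEval, polyEval]; ring) (by decide +kernel)

lemma re_kernels_nonneg {η : ℝ} (h0 : 0 ≤ η) (h1 : η < 0.12) (y : ℝ) :
    0 ≤ (nearKernel η ((1 - 1.46 * η : ℝ) + y * I)).re +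
      (farKernel ((1 - 1.46 * η : ℝ) + y * I)).re +
      (farKernel ((-0.54 * η : ℝ) + y * I)).re := by
  have hτ : 0 ≤ η / 0.12 := by positivity
  have hτ1 : η / 0.12 < 1 := by rw [div_lt_one (by norm_num)]; exact h1
  have hY : bipolyEval (η / 0.12) (y ^ 2) [[], [100000000]] = 10000 ^ 2 * y ^ 2 := by
    simp [bipolyEval, polyEval]; ring
  obtain ⟨p1, e1⟩ := nearFracs_spec (τ := η / 0.12) (υ := y ^ 2) (D := 10000)
    (x := 1 - 1.46 * η) (y := y) (η := η) (X := fun u => [[10000, 12 * (u - 146)]])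
    (W := fun w => [[0, 12 * w]]) (Y := [[], [100000000]]) (by norm_num) h0
    (by linarith) (by intro u; simp [bipolyEval, polyEval]; ring)
    (by intro u; simp [bipolyEval, polyEval]; ring) hY
  obtain ⟨p2, e2⟩ := farFracs_spec (τ := η / 0.12) (υ := y ^ 2)
    (x := 1 - 1.46 * η) (y := y) (X := fun u => [[10000 + u, 12 * (-146)]])
    (Y := [[], [100000000]]) (by linarith)
    (by intro u; simp [bipolyEval, polyEval]; ring) hY
  obtain ⟨p3, e3⟩ := farFracs_spec (τ := η / 0.12) (υ := y ^ 2)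
    (x := -0.54 * η) (y := y) (X := fun u => [[u, 12 * (-54)]])
    (Y := [[], [100000000]]) (by linarith)
    (by intro u; simp [bipolyEval, polyEval]; ring) hY
  have hc : bipolyCheck (fracSum (nearFracs (fun u => [[10000, 12 * (u - 146)]])
      (fun w => [[0, 12 * w]]) [[], [100000000]] ++
      (farFracs (fun u => [[10000 + u, 12 * (-146)]]) [[], [100000000]] ++
        farFracs (fun u => [[u, 12 * (-54)]]) [[], [100000000]]))).1 = true := by decide +kernel
  have h := fracEval_nonneg hτ hτ1 (sq_nonneg y) (by
    intro f hf
    simp only [List.mem_append] at hf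
    rcases hf with hf | hf | hf
    exacts [p1 f hf, p2 f hf, p3 f hf]) hc
  rw [fracEval_append, fracEval_append, e1, e2, e3] at h
  linarith

lemma nearKernel_mul {η : ℝ} (hη : η ≠ 0) (z : ℂ) :
    nearKernel η (η * z) = (η : ℂ)⁻¹ * nearKernel 1 z := by
  have h : (η : ℂ) ≠ 0 := by exact_mod_cast hη
  have e1 : ∀ a : ℂ, (η : ℂ) * z + a * η = η * (z + a) := by intro a; ring
  have e2 : ∀ a b : ℂ, (η * (z + a)) ^ 2 + (b * η) ^ 2 = η ^ 2 * ((z + a) ^ 2 + b ^ 2) := by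
    intro a b; ring
  have e3 : ∀ a w c d x : ℂ, (c * (η * a) + d * (w * η)) / (η ^ 2 * x) =
      (η : ℂ)⁻¹ * ((c * a + d * w) / x) := by
    intro a w c d x
    rw [show c * (η * a) + d * (w * η) = η * (c * a + d * w) by ring, pow_two (η : ℂ), mul_assoc,
      mul_div_mul_left _ _ h, div_eq_mul_inv, mul_inv]
    ring
  have e4 : ∀ a c : ℂ, c / (η * a) = (η : ℂ)⁻¹ * (c / a) := by
    intro a c; rw [div_eq_mul_inv, mul_inv]; ring
  simp only [nearKernel, mul_one, ofReal_mul, e1, e2, e3, e4]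
  ring

lemma shift_bound {η : ℝ} (h0 : 0 ≤ η) (h1 : η < 0.12) (A α β : ℤ) (hA : 1 ≤ A)
    (hc : bipolyCheck (fracSum (nearFracs (fun u => [[10000 * A, 12 * (u - 100)]])
      (fun w => [[0, 12 * w]]) [] ++
      (farFracs (fun u => [[10000 * A + u, -1200]]) [] ++
        [([[-10 * α, -(12 * β)]], [[1000000]])]))).1 = true) :
    (α / 10000 + β / 1000 * η : ℝ) ≤
      (nearKernel η ((A - η : ℝ)) + farKernel ((A - η : ℝ))).re := by
  have hA' : (1 : ℝ) ≤ A := by exact_mod_cast hA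
  have hτ : 0 ≤ η / 0.12 := by positivity
  have hτ1 : η / 0.12 < 1 := by rw [div_lt_one (by norm_num)]; exact h1
  have hY : bipolyEval (η / 0.12) 0 [] = 10000 ^ 2 * (0 : ℝ) ^ 2 := by simp [bipolyEval]
  obtain ⟨p1, e1⟩ := nearFracs_spec (τ := η / 0.12) (υ := 0) (D := 10000)
    (x := A - η) (y := 0) (η := η) (X := fun u => [[10000 * A, 12 * (u - 100)]])
    (W := fun w => [[0, 12 * w]]) (Y := []) (by norm_num) h0
    (by linarith) (by intro u; simp [bipolyEval, polyEval]; ring)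
    (by intro u; simp [bipolyEval, polyEval]; ring) hY
  obtain ⟨p2, e2⟩ := farFracs_spec (τ := η / 0.12) (υ := 0)
    (x := A - η) (y := 0) (X := fun u => [[10000 * A + u, -1200]])
    (Y := []) (by linarith)
    (by intro u; simp [bipolyEval, polyEval]; ring) hY
  have h := fracEval_nonneg hτ hτ1 le_rfl (by
    intro f hf
    simp only [List.mem_append, List.mem_singleton] at hf
    rcases hf with hf | hf | rfl
    exacts [p1 f hf, p2 f hf, by simp [bipolyEval, polyEval]]) hc
  rw [fracEval_append, fracEval_append, e1, e2] at h
  simp [fracEval, bipolyEval, polyEval] at h ⊢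
  have e : η / 0.12 * (12 * (β : ℝ)) = 100 * (β * η) := by ring
  rw [e] at h
  linarith

lemma shift_bounds {η : ℝ} (h0 : 0 ≤ η) (h1 : η < 0.12) :
    2.22015 - 0.192 * η ≤
      ∑ m ∈ Finset.range 15, (nearKernel η ((2 * m + 3 - η : ℝ)) +
        farKernel ((2 * m + 3 - η : ℝ))).re +
      1 / 2 * (nearKernel η ((33 - η : ℝ)) + farKernel ((33 - η : ℝ))).re := by
  have b0 := shift_bound h0 h1 3 5717 (-100) (by norm_num) (by decide +kernel)
  have b1 := shift_bound h0 h1 5 3268 (-30) (by norm_num) (by decide +kernel)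
  have b2 := shift_bound h0 h1 7 2282 (-15) (by norm_num) (by decide +kernel)
  have b3 := shift_bound h0 h1 9 1752 (-9) (by norm_num) (by decide +kernel)
  have b4 := shift_bound h0 h1 11 1421 (-7) (by norm_num) (by decide +kernel)
  have b5 := shift_bound h0 h1 13 1195 (-5) (by norm_num) (by decide +kernel)
  have b6 := shift_bound h0 h1 15 1031 (-4) (by norm_num) (by decide +kernel)
  have b7 := shift_bound h0 h1 17 907 (-4) (by norm_num) (by decide +kernel)
  have b8 := shift_bound h0 h1 19 809 (-3) (by norm_num) (by decide +kernel)
  have b9 := shift_bound h0 h1 21 730 (-3) (by norm_num) (by decide +kernel)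
  have b10 := shift_bound h0 h1 23 666 (-3) (by norm_num) (by decide +kernel)
  have b11 := shift_bound h0 h1 25 611 (-2) (by norm_num) (by decide +kernel)
  have b12 := shift_bound h0 h1 27 565 (-2) (by norm_num) (by decide +kernel)
  have b13 := shift_bound h0 h1 29 526 (-2) (by norm_num) (by decide +kernel)
  have b14 := shift_bound h0 h1 31 491 (-2) (by norm_num) (by decide +kernel)
  have b15 := shift_bound h0 h1 33 461 (-2) (by norm_num) (by decide +kernel)
  simp only [Finset.sum_range_succ, Finset.sum_range_zero]
  norm_num at *
  linarith

lemma kernel_inequality {η : ℝ} (h0 : 0 < η) (h1 : η < 0.12) :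
    1.40915121 * ((nearKernel η ((-η : ℝ)) + farKernel ((-η : ℝ))).re -
        (∑ m ∈ Finset.range 15, (nearKernel η ((2 * m + 3 - η : ℝ)) +
          farKernel ((2 * m + 3 - η : ℝ))).re) -
        1 / 2 * (nearKernel η ((33 - η : ℝ)) + farKernel ((33 - η : ℝ))).re +
        (2.10455 * η - 0.612274 - 1.507 * η) / 66 + 1.507 * 0.8295 + 19.7 * 0.00101) +
      1.507 / 2 * (2.40264 * 0.9955 + 1.4711 * 1.6886 + 0.6 * 2.0941 + 0.125 * 2.3818 +
        4.59874 / (6.315 * η)) +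
      19.7 * 6.5 / 64 ^ 2 * (2.40264 + 1.4711 / 4 + 0.6 / 9 + 0.125 / 16) -
      2.40264 * ((nearKernel η 0 + farKernel 0).re +
        (nearKernel η ((1 - 2 * η : ℝ)) + farKernel ((1 - 2 * η : ℝ))).re) < 0 := by
  have hb := shift_bounds h0.le h1
  generalize (∑ m ∈ Finset.range 15, (nearKernel η ((2 * m + 3 - η : ℝ)) +
    farKernel ((2 * m + 3 - η : ℝ))).re) = x4 at hb ⊢
  generalize (nearKernel η ((33 - η : ℝ)) + farKernel ((33 - η : ℝ))).re = x5 at hb ⊢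
  have hτ : 0 ≤ η / 0.12 := by positivity
  have hτ1 : η / 0.12 < 1 := by rw [div_lt_one (by norm_num)]; exact h1
  have hY : bipolyEval (η / 0.12) 0 [] = 10000 ^ 2 * (0 : ℝ) ^ 2 := by simp [bipolyEval]
  obtain ⟨p1, e1⟩ := nearFracs_spec (τ := η / 0.12) (υ := 0) (D := 10000)
    (x := 1 - 2 * η) (y := 0) (η := η) (X := fun u => [[10000, 12 * (u - 200)]])
    (W := fun w => [[0, 12 * w]]) (Y := []) (by norm_num) h0.le
    (by linarith) (by intro u; simp [bipolyEval, polyEval]; ring)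
    (by intro u; simp [bipolyEval, polyEval]; ring) hY
  obtain ⟨p2, e2⟩ := farFracs_spec (τ := η / 0.12) (υ := 0)
    (x := 1 - 2 * η) (y := 0) (X := fun u => [[10000 + u, -2400]])
    (Y := []) (by linarith)
    (by intro u; simp [bipolyEval, polyEval]; ring) hY
  obtain ⟨p3, e3⟩ := farFracs_spec (τ := η / 0.12) (υ := 0)
    (x := -η) (y := 0) (X := fun u => [[u, -1200]])
    (Y := []) (by linarith)
    (by intro u; simp [bipolyEval, polyEval]; ring) hY
  have hm : ∀ (k : ℤ) (L : List (List (List ℤ) × List (List ℤ))),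
      fracEval (η / 0.12) 0 (L.map fun f => (bipolyMul [[0, k]] f.1, f.2)) =
        k * (η / 0.12) * fracEval (η / 0.12) 0 L := by
    intro k L
    simp only [fracEval, List.map_map, ← List.sum_map_mul_left]
    congr 2
    funext f
    simp [bipolyEval_mul, bipolyEval, polyEval]
    ring
  have hc : bipolyCheck (fracSum (
      (nearFracs (fun u => [[10000, 12 * (u - 200)]]) (fun w => [[0, 12 * w]]) []).map
        (fun f => (bipolyMul [[0, 240264000]] f.1, f.2)) ++
      ((farFracs (fun u => [[10000 + u, -2400]]) []).map
        (fun f => (bipolyMul [[0, 240264000]] f.1, f.2)) ++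
      ((farFracs (fun u => [[u, -1200]]) []).map
        (fun f => (bipolyMul [[0, -140915121]] f.1, f.2)) ++
      [([[2109273, -75710888, -339989]], [[1]])])))).1 = true := by decide +kernel
  have h := fracEval_nonneg hτ hτ1 le_rfl (by
    intro f hf
    simp only [List.mem_append, List.mem_singleton, List.mem_map] at hf
    rcases hf with ⟨g, hg, rfl⟩ | ⟨g, hg, rfl⟩ | ⟨g, hg, rfl⟩ | rfl
    exacts [p1 g hg, p2 g hg, p3 g hg, by simp [bipolyEval, polyEval]]) hc
  rw [fracEval_append, fracEval_append, fracEval_append, hm, hm, hm, e1, e2, e3] at h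
  have n0 : (nearKernel η 0).re = η⁻¹ * (nearKernel 1 0).re := by
    have := nearKernel_mul h0.ne' 0
    rw [mul_zero] at this
    rw [this, ← ofReal_inv, re_ofReal_mul]
  have n1 : (nearKernel η ((-η : ℝ))).re = η⁻¹ * (nearKernel 1 (-1)).re := by
    have := nearKernel_mul h0.ne' (-1)
    rw [show (η : ℂ) * -1 = ((-η : ℝ) : ℂ) by push_cast; ring] at this
    rw [this, ← ofReal_inv, re_ofReal_mul]
  have g0 : nearKernel 1 0 = ((2.675 / 5.6 + (-5.637 * 5.95 + 3.146 * 4.9) / (5.95 ^ 2 + 4.9 ^ 2) +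
      5.019 / 6.3 + 0.708 * 6.3 / (6.3 ^ 2 + 9.8 ^ 2) : ℝ) : ℂ) := by
    simp only [nearKernel]; push_cast; norm_num
  have g1 : nearKernel 1 (-1) = ((2.675 / 4.6 + (-5.637 * 4.95 + 3.146 * 4.9) /
      (4.95 ^ 2 + 4.9 ^ 2) + 5.019 / 5.3 + 0.708 * 5.3 / (5.3 ^ 2 + 9.8 ^ 2) : ℝ) : ℂ) := by
    simp only [nearKernel]; push_cast; norm_num
  have f0 : farKernel 0 = ((-3.039 / 1.053 + 1.781 / 1.453 : ℝ) : ℂ) := by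
    simp only [farKernel]; push_cast; norm_num
  rw [g0, ofReal_re] at n0
  rw [g1, ofReal_re] at n1
  simp only [add_re, n0, n1, f0, ofReal_re, ofReal_zero, zero_mul, add_zero, fracEval,
    List.map_cons,
    List.map_nil, List.sum_cons, List.sum_nil, bipolyEval, polyEval] at h hb ⊢
  generalize (nearKernel η ((1 - 2 * η : ℝ))).re = x1 at *
  generalize (farKernel ((1 - 2 * η : ℝ))).re = x2 at *
  generalize (farKernel ((-η : ℝ))).re = x3 at *
  have h' := div_nonneg h h0.le
  have e : ∀ a b c : ℝ, (a * (η / 0.12) * (1000 / 10000 * x1) + (a * (η / 0.12) * (1 / 10 * x2) +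
      (b * (η / 0.12) * (1 / 10 * x3) + c))) / η =
      a / 1.2 * (x1 + x2) + b / 1.2 * x3 + c * η⁻¹ := by intros; field_simp; ring
  rw [e] at h'
  have e2 : (2109273 + η / (3 / 25) * (-75710888 + -(η / (3 / 25) * 339989))) * η⁻¹ =
    2109273 * η⁻¹ - 75710888 * (25 / 3) - 339989 * (625 / 9) * η := by field_simp; ring
  have e3 : 4.59874 / (6.315 * η) = 4.59874 / 6.315 * η⁻¹ := by field_simp
  have hi : 0 < η⁻¹ := by positivity
  rw [e3]
  push_cast at h'
  norm_num at h' ⊢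
  rw [e2] at h'
  linarith

end

section

open Complex ComplexConjugate

noncomputable def coef : Fin 8 → ℂ :=
  ![2.675, (-5.637 - 3.146 * I) / 2, (-5.637 + 3.146 * I) / 2, 5.019, 0.354, 0.354, -3.039, 1.781]

noncomputable def expo (η : ℝ) : Fin 8 → ℂ :=
  ![5.6 * η, (5.95 - 4.9 * I) * η, (5.95 + 4.9 * I) * η, 6.3 * η, (6.3 - 9.8 * I) * η,
    (6.3 + 9.8 * I) * η, 1.053, 1.453]

lemma norm_le_of_sq_le {z : ℂ} {a : ℝ} (ha : 0 ≤ a) (h : z.re * z.re + z.im * z.im ≤ a ^ 2) :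
    ‖z‖ ≤ a := by
  rw [← normSq_apply, normSq_eq_norm_sq] at h
  exact abs_le_of_sq_le_sq' h ha |>.2

lemma sum_norm_coef_le : ∑ j, ‖coef j‖ ≤ 19.7 := by
  have h1 : ‖(-5.637 - 3.146 * I) / 2‖ ≤ 3.23 := by
    apply norm_le_of_sq_le <;> norm_num
  have h2 : ‖(-5.637 + 3.146 * I) / 2‖ ≤ 3.23 := by
    apply norm_le_of_sq_le <;> norm_num
  simp [Fin.sum_univ_succ, coef] at h1 h2 ⊢
  norm_num at h1 h2 ⊢
  linarith

lemma sum_coef : ∑ j, coef j = (1.507 : ℝ) := by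
  simp [Fin.sum_univ_succ, coef]; norm_num; ring

lemma sum_coef_mul_expo (η : ℝ) : ∑ j, coef j * expo η j = (2.10455 * η - 0.612274 : ℝ) := by
  simp [Fin.sum_univ_succ, coef, expo]
  apply Complex.ext <;> simp <;> norm_num <;> ring

lemma sum_coef_mul_expo_sq (η : ℝ) :
    ∑ j, coef j * expo η j ^ 2 = (-4.4664725 * η ^ 2 + 0.390392678 : ℝ) := by
  simp [Fin.sum_univ_succ, coef, expo, pow_two]
  apply Complex.ext <;> simp <;> norm_num <;> ring

lemma norm_expo_le {η : ℝ} (h0 : 0 ≤ η) (h1 : η < 0.12) (j : Fin 8) : ‖expo η j‖ ≤ 1.453 := by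
  apply norm_le_of_sq_le (by norm_num)
  fin_cases j <;> simp [expo] <;> norm_num <;> nlinarith

lemma re_expo_ge {η : ℝ} (h0 : 0 ≤ η) (h1 : η < 0.12) (j : Fin 8) : 5.6 * η ≤ (expo η j).re := by
  fin_cases j <;> simp [expo] <;> norm_num <;> linarith

lemma sum_div_eq_kernel {η : ℝ} (h0 : 0 ≤ η) (h1 : η < 0.12) {z : ℂ} (hz : 0 < z.re + 5.6 * η) :
    ∑ j, coef j / (z + expo η j) = nearKernel η z + farKernel z := by
  have h : ∀ j, z + expo η j ≠ 0 := by
    intro j hj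
    have := re_expo_ge h0 h1 j
    have h2 := congrArg re hj
    simp only [add_re, zero_re] at h2
    linarith
  have k1 := h 1
  have k2 := h 2
  have k4 := h 4
  have k5 := h 5
  have hp : ∀ a b c s : ℂ, z + (a - b * I) * η ≠ 0 → z + (a + b * I) * η ≠ 0 →
      (c - s * I) / 2 / (z + (a - b * I) * η) + (c + s * I) / 2 / (z + (a + b * I) * η) =
      (c * (z + a * η) + s * (b * η)) / ((z + a * η) ^ 2 + (b * η) ^ 2) := by
    intro a b c s g1 g2
    have e : (z + a * η) ^ 2 + (b * η) ^ 2 = (z + (a - b * I) * η) * (z + (a + b * I) * η) := by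
      linear_combination (b * η) ^ 2 * I_sq
    rw [e]
    rw [div_add_div _ _ g1 g2, div_left_inj' (mul_ne_zero g1 g2)]
    linear_combination (-s * b * η) * I_sq
  simp only [expo, Fin.isValue, Matrix.cons_val] at k1 k2 k4 k5
  have p1 := hp 5.95 4.9 (-5.637) 3.146 k1 k2
  have p2 := hp 6.3 9.8 0.708 0 k4 k5
  simp [Fin.sum_univ_succ, coef, expo, nearKernel, farKernel]
  simp only [zero_mul, sub_zero, add_zero, show (0.708 : ℂ) / 2 = 0.354 by norm_num] at p2
  rw [show (2675 : ℂ) / 1000 = 2.675 by norm_num, show (-5637 : ℂ) / 1000 = -5.637 by norm_num,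
    show (3146 : ℂ) / 1000 = 3.146 by norm_num, show (5019 : ℂ) / 1000 = 5.019 by norm_num,
    show (708 : ℂ) / 1000 = 0.708 by norm_num, show (-3039 : ℂ) / 1000 = -3.039 by norm_num,
    show (1781 : ℂ) / 1000 = 1.781 by norm_num]
  linear_combination p1 + p2

lemma far_polynomial_nonneg {y : ℝ} (h0 : 0 ≤ y) (h1 : y ≤ 1) :
    0 ≤ 1.374 - 3.039 * y ^ 3 + 1.781 * y ^ 7 := by
  have h : ∀ k : ℕ, 0 ≤ y ^ k * (y - 0.9248) ^ 2 := fun k ↦ by positivity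
  have p : ∀ k : ℕ, 0 ≤ y ^ k ∧ y ^ k ≤ 1 := fun k ↦ ⟨by positivity, pow_le_one₀ h0 h1⟩
  nlinarith [h 0, h 1, h 2, h 3, h 4, h 5, p 1, p 2, p 3, p 4, p 5, p 6]

lemma sum_coef_mul_exp_nonneg {η L : ℝ} (h1 : η ≤ 0.1195) (hL : 0 ≤ L) :
    ∃ r : ℝ, 0 ≤ r ∧ ∑ j, coef j * exp (-(expo η j * L)) = r := by
  set e := Real.exp (-(5.6 * η * L)) with he
  set X := Real.exp (-(0.35 * η * L)) with hX
  set C := Real.cos (4.9 * η * L) with hC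
  set S := Real.sin (4.9 * η * L) with hS
  set u := Real.exp (-(1.053 * L)) with hu
  set v := Real.exp (-(1.453 * L)) with hv
  have hcs : S ^ 2 + C ^ 2 = 1 := Real.sin_sq_add_cos_sq _
  refine ⟨e * (2.675 + X * (-5.637 * C + 3.146 * S) + X ^ 2 * (5.019 + 0.708 * (C ^ 2 - S ^ 2))) -
    3.039 * u + 1.781 * v, ?_, ?_⟩
  · have hq : 1.374 * X ^ 2 ≤
        2.675 + X * (-5.637 * C + 3.146 * S) + X ^ 2 * (5.019 + 0.708 * (C ^ 2 - S ^ 2)) := by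
      have e1 : X ^ 2 = (X * C) ^ 2 + (X * S) ^ 2 := by linear_combination (-X ^ 2) * hcs
      nlinarith [sq_nonneg (X * C - 0.6475), sq_nonneg (X * S + 0.5356)]
    have hq2 : e * (1.374 * X ^ 2) ≤ e * (2.675 + X * (-5.637 * C + 3.146 * S) +
        X ^ 2 * (5.019 + 0.708 * (C ^ 2 - S ^ 2))) :=
      mul_le_mul_of_nonneg_left hq (Real.exp_pos _).le
    have hex : e * X ^ 2 = Real.exp (-(6.3 * η * L)) := by
      rw [he, hX, ← Real.exp_nat_mul, ← Real.exp_add]; congr 1; push_cast; ring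
    have hge : Real.exp (-(0.753 * L)) ≤ e * X ^ 2 := by
      rw [hex]; apply Real.exp_le_exp.2; nlinarith
    set y := Real.exp (-(L / 10)) with hy
    have hu2 : u = Real.exp (-(0.753 * L)) * y ^ 3 := by
      rw [hu, hy, ← Real.exp_nat_mul, ← Real.exp_add]; congr 1; push_cast; ring
    have hv2 : v = Real.exp (-(0.753 * L)) * y ^ 7 := by
      rw [hv, hy, ← Real.exp_nat_mul, ← Real.exp_add]; congr 1; push_cast; ring
    have hp := far_polynomial_nonneg (Real.exp_pos (-(L / 10))).le
      (Real.exp_le_one_iff.2 (by linarith))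
    have := mul_nonneg (Real.exp_pos (-(0.753 * L))).le hp
    rw [hu2, hv2]
    nlinarith
  · have hpair : ∀ a b : ℝ, exp (-((a - b * I) * η * L)) =
        Real.exp (-(a * η * L)) * (Real.cos (b * η * L) + Real.sin (b * η * L) * I) ∧
        exp (-((a + b * I) * η * L)) =
        Real.exp (-(a * η * L)) * (Real.cos (b * η * L) - Real.sin (b * η * L) * I) := by
      intro a b
      constructor
      · rw [ofReal_exp, ofReal_cos, ofReal_sin, ← exp_mul_I, ← exp_add]
        congr 1; push_cast; ring
      · rw [ofReal_exp, ofReal_cos, ofReal_sin, show Complex.cos ↑(b * η * L) - Complex.sin ↑(b * η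
        * L) * I =
          exp (-(b * η * L : ℝ) * I) by rw [exp_mul_I, Complex.cos_neg, Complex.sin_neg]; ring,
          ← exp_add]
        congr 1; push_cast; ring
    obtain ⟨g1, g2⟩ := hpair 5.95 4.9
    obtain ⟨g4, g5⟩ := hpair 6.3 9.8
    have d1 : Real.cos (9.8 * η * L) = C ^ 2 - S ^ 2 := by
      rw [hC, hS, show 9.8 * η * L = 2 * (4.9 * η * L) by ring, Real.cos_two_mul']
    have x1 : Real.exp (-(5.95 * η * L)) = e * X := by
      rw [he, hX, ← Real.exp_add]; congr 1; ring
    have x2 : Real.exp (-(6.3 * η * L)) = e * X ^ 2 := by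
      rw [he, hX, ← Real.exp_nat_mul, ← Real.exp_add]; congr 1; push_cast; ring
    have x0 : exp (-(5.6 * η * L)) = (e : ℂ) := by rw [he]; push_cast; rfl
    have x3 : exp (-(6.3 * η * L)) = (e * X ^ 2 : ℝ) := by rw [← x2]; push_cast; rfl
    have x4 : exp (-(1.053 * L)) = (u : ℂ) := by rw [hu]; push_cast; rfl
    have x5 : exp (-(1.453 * L)) = (v : ℂ) := by rw [hv]; push_cast; rfl
    rw [x1, ← hC, ← hS] at g1 g2
    rw [x2, d1] at g4 g5
    push_cast at g1 g2 g4 g5 x3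
    simp only [Fin.sum_univ_eight, coef, expo, Fin.isValue, Matrix.cons_val, x0, x3, x4, x5, g1,
      g2, g4, g5]
    push_cast
    linear_combination (-3.146 * e * X * S) * I_sq

lemma sum_coef_mul_cpow_nonneg {η : ℝ} (h1 : η ≤ 0.1195) {n : ℕ} (hn : 2 ≤ n) :
    ∃ r : ℝ, 0 ≤ r ∧ ∑ j, coef j * (n : ℂ) ^ (-((1 - η : ℝ) + expo η j)) = r := by
  have hn0 : (n : ℂ) ≠ 0 := by exact_mod_cast (by omega : n ≠ 0)
  obtain ⟨r, hr, e⟩ := sum_coef_mul_exp_nonneg h1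
    (Real.log_nonneg (by exact_mod_cast (by omega : 1 ≤ n) : (1 : ℝ) ≤ n))
  refine ⟨Real.exp (-((1 - η) * Real.log n)) * r, by positivity, ?_⟩
  rw [ofReal_mul, ← e, Finset.mul_sum]
  refine Finset.sum_congr rfl fun j _ ↦ ?_
  rw [cpow_def_of_ne_zero hn0, ofReal_exp, mul_left_comm, ← exp_add, natCast_log]
  congr 2
  push_cast
  ring

lemma sum_div_conj {η : ℝ} (h0 : 0 ≤ η) (h1 : η < 0.12) {z : ℂ} (hz : 0 < z.re + 5.6 * η) :
    ∑ j, coef j / (conj z + expo η j) = conj (∑ j, coef j / (z + expo η j)) := by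
  rw [sum_div_eq_kernel h0 h1 (by simpa using hz), sum_div_eq_kernel h0 h1 hz]
  simp only [nearKernel, farKernel, map_add, map_div₀, map_mul, map_pow, conj_ofReal]

lemma norm_sum_div_le {η r : ℝ} (h0 : 0 ≤ η) (h1 : η < 0.12) (hr : 0 < r) {z : ℂ}
    (hz : r ≤ z.re + 5.6 * η) : ‖∑ j, coef j / (z + expo η j)‖ ≤ 19.7 / r := by
  refine (norm_sum_le _ _).trans ?_
  calc ∑ j, ‖coef j / (z + expo η j)‖ ≤ ∑ j, ‖coef j‖ / r := by
        refine Finset.sum_le_sum fun j _ ↦ ?_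
        rw [norm_div]
        gcongr
        refine le_trans ?_ (re_le_norm _)
        rw [add_re]
        linarith [re_expo_ge h0 h1 j]
    _ = (∑ j, ‖coef j‖) / r := (Finset.sum_div _ _ _).symm
    _ ≤ 19.7 / r := by gcongr; exact sum_norm_coef_le

lemma differentiableAt_sum_div {η : ℝ} (h0 : 0 ≤ η) (h1 : η < 0.12) {z : ℂ}
    (hz : 0 < z.re + 5.6 * η) :
    DifferentiableAt ℂ (fun z ↦ ∑ j, coef j / (z + expo η j)) z := by
  refine DifferentiableAt.fun_sum fun j _ ↦ ?_
  refine (differentiableAt_const _).div (differentiableAt_id.add_const _) ?_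
  intro hj
  have h2 := congrArg re hj
  simp only [add_re, zero_re] at h2
  linarith [re_expo_ge h0 h1 j]

lemma re_sum_div_boundary {η : ℝ} (h0 : 0 < η) (h1 : η < 0.12) (y : ℝ) :
    0 ≤ (∑ j, coef j / (((-0.54 * η : ℝ) + y * I) + expo η j) +
      ∑ j, coef j / (((1 - 1.46 * η : ℝ) + y * I) + expo η j)).re := by
  rw [sum_div_eq_kernel h0.le h1 (by simp; linarith),
    sum_div_eq_kernel h0.le h1 (by simp; linarith)]
  have e := nearKernel_mul h0.ne' ((-0.54 : ℝ) + (y / η : ℝ) * I)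
  rw [show (η : ℂ) * ((-0.54 : ℝ) + (y / η : ℝ) * I) = (-0.54 * η : ℝ) + y * I by
    have : (η : ℂ) ≠ 0 := by exact_mod_cast h0.ne'
    push_cast; field_simp] at e
  have e2 : 0 ≤ (nearKernel η ((-0.54 * η : ℝ) + y * I)).re := by
    rw [e, ← ofReal_inv, re_ofReal_mul]
    exact mul_nonneg (by positivity) (re_nearKernel_one_nonneg _)
  have := re_kernels_nonneg h0.le h1 y
  simp only [add_re] at this ⊢
  linarith

lemma re_sum_div_symm {η : ℝ} (h0 : 0 ≤ η) (h1 : η < 0.12) {z : ℂ} (hz : z.re < 1 + 3.6 * η) :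
    (∑ j, coef j / ((1 - 2 * η : ℝ) - conj z + expo η j)).re =
    (∑ j, coef j / ((1 - 2 * η : ℝ) - z + expo η j)).re := by
  rw [show ((1 - 2 * η : ℝ) : ℂ) - conj z = conj ((1 - 2 * η : ℝ) - z) by rw [map_sub, conj_ofReal],
    sum_div_conj h0 h1 (by simp; linarith), conj_re]

/-- Positivity of the symmetrised kernel in the strip `-0.54 η ≤ re z ≤ 1 - 1.46 η`. -/
lemma re_sum_div_strip {η : ℝ} (h0 : 0 < η) (h1 : η < 0.12) {z : ℂ} (hz : -0.54 * η ≤ z.re)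
    (hz' : z.re ≤ 1 - 1.46 * η) :
    0 ≤ (∑ j, coef j / (z + expo η j) +
      ∑ j, coef j / ((1 - 2 * η : ℝ) - z + expo η j)).re := by
  set H : ℂ → ℂ := fun z ↦ ∑ j, coef j / (z + expo η j) +
      ∑ j, coef j / ((1 - 2 * η : ℝ) - z + expo η j) with hH
  have hd : ∀ w : ℂ, -0.54 * η ≤ w.re → w.re ≤ 1 - 1.46 * η → DifferentiableAt ℂ H w := by
    intro w g1 g2
    refine (differentiableAt_sum_div h0.le h1 (by linarith)).add ?_
    have := differentiableAt_sum_div (z := ((1 - 2 * η : ℝ) - w : ℂ)) h0.le h1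
      (by simp; linarith)
    exact this.comp w (differentiableAt_id.const_sub _)
  have hb : ∀ w : ℂ, -0.54 * η ≤ w.re → w.re ≤ 1 - 1.46 * η →
      ‖H w‖ ≤ 19.7 / (5.06 * η) + 19.7 / (5.06 * η) := by
    intro w g1 g2
    refine (norm_add_le _ _).trans (add_le_add ?_ ?_)
    · exact norm_sum_div_le h0.le h1 (by positivity) (by linarith)
    · exact norm_sum_div_le h0.le h1 (by positivity) (by simp; linarith)
  have hn : ∀ w, ‖exp (-H w)‖ = Real.exp (-(H w).re) := by
    intro w; rw [norm_exp, neg_re]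
  have hab : -0.54 * η ≠ 1 - 1.46 * η := by intro h; linarith
  have key : ‖exp (-H z)‖ ≤ 1 := by
    refine PhragmenLindelof.vertical_strip (a := -0.54 * η) (b := 1 - 1.46 * η)
      (f := fun w ↦ exp (-H w)) ?_ ?_ ?_ ?_ hz hz'
    · refine DifferentiableOn.diffContOnCl fun w hw ↦ ?_
      rw [closure_preimage_re, closure_Ioo hab] at hw
      exact ((hd w hw.1 hw.2).neg.cexp).differentiableWithinAt
    · refine ⟨0, div_pos Real.pi_pos (by linarith), 0, ?_⟩
      refine Asymptotics.IsBigO.of_bound (Real.exp (19.7 / (5.06 * η) + 19.7 / (5.06 * η))) ?_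
      rw [Filter.eventually_inf_principal]
      refine Filter.Eventually.of_forall fun w hw ↦ ?_
      simp only [zero_mul, Real.exp_zero, norm_one, mul_one]
      rw [hn]
      refine Real.exp_le_exp.2 ((neg_le_abs _).trans ((abs_re_le_norm _).trans ?_))
      exact hb w hw.1.le hw.2.le
    · intro w hw
      rw [hn, Real.exp_le_one_iff, neg_nonpos]
      have := re_sum_div_boundary h0 h1 w.im
      rw [add_re] at this
      rw [hH]
      simp only [add_re]
      rw [← re_sum_div_symm h0.le h1 (by linarith)]
      rw [show ((-0.54 * η : ℝ) : ℂ) + w.im * I = w by apply Complex.ext <;> simp [hw],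
        show ((1 - 1.46 * η : ℝ) : ℂ) + w.im * I = (1 - 2 * η : ℝ) - conj w by
          apply Complex.ext
          · simp [hw]; ring
          · simp] at this
      exact this
    · intro w hw
      rw [hn, Real.exp_le_one_iff, neg_nonpos]
      have := re_sum_div_boundary h0 h1 w.im
      rw [add_re, add_comm] at this
      rw [hH]
      simp only [add_re]
      rw [← re_sum_div_symm h0.le h1 (by linarith)]
      rw [show ((1 - 1.46 * η : ℝ) : ℂ) + w.im * I = w by apply Complex.ext <;> simp [hw],
        show ((-0.54 * η : ℝ) : ℂ) + w.im * I = (1 - 2 * η : ℝ) - conj w by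
          apply Complex.ext
          · simp [hw]; ring
          · simp] at this
      exact this
  rw [hn, Real.exp_le_one_iff, neg_nonpos] at key
  exact key

lemma sum_div_expansion {η : ℝ} (h0 : 0 ≤ η) (h1 : η < 0.12) {z : ℂ} (hz : 40 ≤ |z.im|) :
    ‖∑ j, coef j / (z + expo η j) - ((1.507 : ℝ) * z⁻¹ - (2.10455 * η - 0.612274 : ℝ) * (z⁻¹) ^ 2)‖
      ≤
      0.052 / z.im ^ 2 := by
  have hn : |z.im| ≤ ‖z‖ := abs_im_le_norm z
  have hz0 : z ≠ 0 := by rintro rfl; norm_num at hz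
  have hne : ∀ j, 38.5 ≤ ‖z + expo η j‖ := fun j ↦ by
    have := norm_sub_le (z + expo η j) (expo η j)
    rw [add_sub_cancel_right] at this
    linarith [norm_expo_le h0 h1 j]
  have e : ∑ j, coef j / (z + expo η j) -
      ((1.507 : ℝ) * z⁻¹ - (2.10455 * η - 0.612274 : ℝ) * (z⁻¹) ^ 2) =
      (-4.4664725 * η ^ 2 + 0.390392678 : ℝ) * (z⁻¹) ^ 3 -
        (z⁻¹) ^ 3 * ∑ j, coef j * (expo η j) ^ 3 / (z + expo η j) := by
    rw [← sum_coef, ← sum_coef_mul_expo, ← sum_coef_mul_expo_sq, Finset.sum_mul, Finset.sum_mul,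
      Finset.sum_mul, Finset.mul_sum, ← Finset.sum_sub_distrib, ← Finset.sum_sub_distrib,
      ← Finset.sum_sub_distrib]
    refine Finset.sum_congr rfl fun j _ ↦ ?_
    have : z + expo η j ≠ 0 := by
      intro h; have := hne j; rw [h, norm_zero] at this; norm_num at this
    field_simp
    ring
  have hs : ‖∑ j, coef j * (expo η j) ^ 3 / (z + expo η j)‖ ≤ 1.58 := by
    refine (norm_sum_le _ _).trans ?_
    calc ∑ j, ‖coef j * (expo η j) ^ 3 / (z + expo η j)‖ ≤ ∑ j, ‖coef j‖ * (1.453 ^ 3 / 38.5) := by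
          refine Finset.sum_le_sum fun j _ ↦ ?_
          rw [norm_div, norm_mul, norm_pow, mul_div_assoc]
          have := norm_expo_le h0 h1 j
          have := hne j
          gcongr
      _ = (∑ j, ‖coef j‖) * (1.453 ^ 3 / 38.5) := (Finset.sum_mul _ _ _).symm
      _ ≤ 19.7 * (1.453 ^ 3 / 38.5) := by gcongr; exact sum_norm_coef_le
      _ ≤ 1.58 := by norm_num
  have hm : ‖((-4.4664725 * η ^ 2 + 0.390392678 : ℝ) : ℂ)‖ ≤ 0.5 := by
    rw [norm_real, Real.norm_eq_abs, abs_le]; constructor <;> nlinarith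
  have h3 : ‖(z⁻¹) ^ 3‖ ≤ (1 / 40) / z.im ^ 2 := by
    rw [norm_pow, norm_inv, ← sq_abs, div_div, inv_pow, ← one_div]
    apply one_div_le_one_div_of_le
    · positivity
    · calc 40 * |z.im| ^ 2 ≤ ‖z‖ * ‖z‖ ^ 2 := by gcongr; linarith
        _ = ‖z‖ ^ 3 := by ring
  rw [e]
  refine (norm_sub_le _ _).trans ?_
  rw [norm_mul, norm_mul]
  calc _ ≤ 0.5 * ((1 / 40) / z.im ^ 2) + ((1 / 40) / z.im ^ 2) * 1.58 := by gcongr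
    _ = 0.052 / z.im ^ 2 := by ring

lemma re_sum_div_far {η : ℝ} (h0 : 0 ≤ η) (h1 : η < 0.12) {z : ℂ} (hz : 40 ≤ |z.im|)
    (hx : |z.re| ≤ 1) :
    (1.507 * z.re + (2.10455 * η - 0.612274) - 0.06) / z.im ^ 2 ≤
      (∑ j, coef j / (z + expo η j)).re := by
  have h := (abs_re_le_norm _).trans (sum_div_expansion h0 h1 hz)
  rw [sub_re] at h
  have h := (abs_le.1 h).1
  rw [sub_re, re_ofReal_mul, re_ofReal_mul, inv_re, pow_two (z⁻¹), mul_re, inv_re, inv_im,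
    normSq_apply] at h
  have hy : (1600 : ℝ) ≤ z.im ^ 2 := by rw [← sq_abs]; nlinarith
  set x := z.re
  set y := z.im
  have hx1 := abs_le.1 hx
  have hN : x * x + y * y = x ^ 2 + y ^ 2 := by ring
  rw [hN] at h
  have hp : 0 < x ^ 2 + y ^ 2 := by positivity
  have hyp : 0 < y ^ 2 := by linarith
  have hx2 : x ^ 2 ≤ 1 := by nlinarith
  have a1 : (1.507 * x - 0.001) / y ^ 2 ≤ 1.507 * (x / (x ^ 2 + y ^ 2)) := by
    rw [← mul_div_assoc, div_le_div_iff₀ hyp hp]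
    have : 1.507 * (x * x ^ 2) ≤ 1.507 * 1 := by nlinarith
    nlinarith
  have a2 : (2.10455 * η - 0.612274) / y ^ 2 ≤ -((2.10455 * η - 0.612274) *
      (x / (x ^ 2 + y ^ 2) * (x / (x ^ 2 + y ^ 2)) - -y / (x ^ 2 + y ^ 2) * (-y / (x ^ 2 + y ^
        2)))) := by
    have hm : 0 ≤ 0.612274 - 2.10455 * η := by linarith
    have : -(1 / y ^ 2) ≤ (x / (x ^ 2 + y ^ 2) * (x / (x ^ 2 + y ^ 2)) -
        -y / (x ^ 2 + y ^ 2) * (-y / (x ^ 2 + y ^ 2))) := by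
      rw [show (x / (x ^ 2 + y ^ 2) * (x / (x ^ 2 + y ^ 2)) -
        -y / (x ^ 2 + y ^ 2) * (-y / (x ^ 2 + y ^ 2))) = (x ^ 2 - y ^ 2) / (x ^ 2 + y ^ 2) ^ 2 by
          field_simp, ← neg_div, div_le_div_iff₀ hyp (by positivity)]
      nlinarith [mul_nonneg (sq_nonneg x) (sq_nonneg y), sq_nonneg (x ^ 2)]
    calc (2.10455 * η - 0.612274) / y ^ 2 = (0.612274 - 2.10455 * η) * (-(1 / y ^ 2)) := by ring
      _ ≤ _ := mul_le_mul_of_nonneg_left this hm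
      _ = _ := by ring
  have a3 : (1.507 * x + (2.10455 * η - 0.612274) - 0.06) / y ^ 2 =
      (1.507 * x - 0.001) / y ^ 2 + (2.10455 * η - 0.612274) / y ^ 2 - 0.052 / y ^ 2 -
        0.007 / y ^ 2 := by ring
  have a4 : 0 ≤ 0.007 / y ^ 2 := by positivity
  linarith

/-- Positivity of the symmetrised kernel in the strip `-η ≤ re z ≤ 1 - η`, provided that `z` is
far from the real axis unless `-0.54 η ≤ re z ≤ 1 - 1.46 η`. -/
lemma re_sum_div_nonneg {η : ℝ} (h0 : 0 < η) (h1 : η < 0.12) {z : ℂ} (hz : -η ≤ z.re)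
    (hz' : z.re ≤ 1 - η) (h : |z.im| < 40 → -0.54 * η ≤ z.re ∧ z.re ≤ 1 - 1.46 * η) :
    0 ≤ (∑ j, coef j / (z + expo η j) +
      ∑ j, coef j / ((1 - 2 * η : ℝ) - z + expo η j)).re := by
  rcases lt_or_ge |z.im| 40 with hi | hi
  · exact re_sum_div_strip h0 h1 (h hi).1 (h hi).2
  · have b1 := re_sum_div_far h0.le h1 hi (by rw [abs_le]; constructor <;> linarith)
    have b2 := re_sum_div_far (z := ((1 - 2 * η : ℝ) - z : ℂ)) h0.le h1 (by simpa using hi)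
      (by simp only [sub_re, ofReal_re]; rw [abs_le]; constructor <;> linarith)
    rw [sub_re, sub_im, ofReal_re, ofReal_im, zero_sub, neg_sq] at b2
    have : 0 ≤ (1.507 * z.re + (2.10455 * η - 0.612274) - 0.06) / z.im ^ 2 +
        (1.507 * (1 - 2 * η - z.re) + (2.10455 * η - 0.612274) - 0.06) / z.im ^ 2 := by
      rw [← add_div]
      apply div_nonneg _ (sq_nonneg _)
      linarith
    rw [add_re]
    linarith

lemma log_le_of_pow_le {x y c : ℝ} {n m : ℕ} (hn : 0 < n) (hx : 0 < x) (hxy : x ^ n ≤ y *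
  2.7182818283 ^ m)
    (h : m + (y - 1) ≤ n * c) : Real.log x ≤ c := by
  have hy : 0 < y := pos_of_mul_pos_left ((pow_pos hx n).trans_le hxy) (by positivity)
  have h1 : x ^ n ≤ y * Real.exp 1 ^ m := hxy.trans (by
    have := Real.exp_one_gt_d9.le
    gcongr)
  have h2 := Real.log_le_log (by positivity) h1
  rw [Real.log_pow, Real.log_mul hy.ne' (by positivity), Real.log_pow, Real.log_exp] at h2
  have h3 := Real.log_le_sub_one_of_pos hy
  have : (n : ℝ) * Real.log x ≤ n * c := by linarith
  exact le_of_mul_le_mul_left this (by exact_mod_cast hn)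

lemma le_log_of_le_pow {x y c : ℝ} {n m : ℕ} (hn : 0 < n) (hy : 0 < y)
    (hxy : 2.7182818286 ^ m ≤ y * x ^ n) (hx : 0 < x)
    (h : n * c ≤ m - (y - 1)) : c ≤ Real.log x := by
  have h1 : Real.exp 1 ^ m ≤ y * x ^ n := le_trans (by
    have := Real.exp_one_lt_d9.le
    gcongr) hxy
  have h2 := Real.log_le_log (by positivity) h1
  rw [Real.log_pow, Real.log_mul hy.ne' (by positivity), Real.log_pow, Real.log_exp] at h2
  have h3 := Real.log_le_sub_one_of_pos hy
  have : (n : ℝ) * c ≤ n * Real.log x := by linarith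
  exact le_of_mul_le_mul_left this (by exact_mod_cast hn)

lemma log_17_div_two_pi : Real.log (17 / (2 * Real.pi)) ≤ 0.9954 := by
  refine log_le_of_pow_le (n := 1) (m := 1) (y := 0.9954) one_pos (by positivity) ?_ (by norm_num)
  rw [pow_one, div_le_iff₀ (by positivity)]
  nlinarith [Real.pi_gt_d6]

lemma log_33_div_two_pi : Real.log (33 / (2 * Real.pi)) ≤ 1.659 := by
  refine log_le_of_pow_le (n := 3) (m := 5) (y := 0.977) (by norm_num) (by positivity) ?_ (by
    norm_num)
  have : 33 / (2 * Real.pi) ≤ 5.2522 := by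
    rw [div_le_iff₀ (by positivity)]
    nlinarith [Real.pi_gt_d6]
  calc _ ≤ (5.2522 : ℝ) ^ 3 := by gcongr
    _ ≤ _ := by norm_num

lemma log_three_le : Real.log 3 ≤ 1.09863 := by
  have h : (12 : ℕ) * Real.log 3 ≤ (19 : ℕ) * Real.log 2 + 0.01365 := by
    rw [← Real.log_pow, ← Real.log_pow]
    have h1 := Real.log_le_sub_one_of_pos (show (0 : ℝ) < 3 ^ 12 / 2 ^ 19 by norm_num)
    rw [Real.log_div (by norm_num) (by norm_num)] at h1
    norm_num at h1 ⊢
    linarith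
  push_cast at h
  linarith [Real.log_two_lt_d9]

lemma le_log_64_div_17 : 1.3255 ≤ Real.log (64 / 17) := by
  refine le_log_of_le_pow (n := 3) (m := 4) (y := 1.0233) (by norm_num) (by norm_num) ?_ ?_ ?_ <;>
    norm_num

lemma log_le_one_point : Real.log 4.625 ≤ 1.533 := by
  refine log_le_of_pow_le (n := 2) (m := 3) (y := 1.065) (by norm_num) (by norm_num) ?_ ?_ <;>
    norm_num

lemma log_mul_div_two_pi {γ : ℝ} (hγ : 0 < γ) (k : ℕ) (hk : 0 < k) :
    Real.log (k * γ / (2 * Real.pi)) =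
      Real.log k + Real.log (17 / (2 * Real.pi)) + Real.log (γ / 17) := by
  rw [← Real.log_mul (by positivity) (by positivity), ← Real.log_mul (by positivity) (by
    positivity)]
  congr 1
  field_simp

lemma no_zero_of_isolated {ρ₀ : ℂ} (h₀ : riemannXi ρ₀ = 0) (hγ : 64 ≤ ρ₀.im)
    (hη : 1 - ρ₀.re ≤ 0.1195) (hlog : (1 - ρ₀.re) * Real.log (ρ₀.im / 17) ≤ 1 / 6.315)
    (hnear : ∀ ρ, riemannXi ρ = 0 → ∀ k : ℕ, k ≤ 4 → |ρ.im - k * ρ₀.im| < 40 →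
      0.46 * (1 - ρ₀.re) ≤ 1 - ρ.re) : False := by
  set η := 1 - ρ₀.re with hηdef
  have h0 : 0 < η := by linarith [re_lt_one_of_riemannXi_eq_zero h₀]
  have h1 : η < 0.12 := by linarith
  set γ := ρ₀.im with hγdef
  have hγ0 : 0 < γ := by linarith
  have hρ : ρ₀ = (1 - η : ℝ) + γ * I := by
    apply Complex.ext <;> simp [hηdef, hγdef]
  have hρ' : conj ρ₀ = (1 - η : ℝ) - γ * I := by
    apply Complex.ext <;> simp [hηdef, hγdef]
  set b : Fin 8 → ℂ := fun j ↦ (1 - η : ℝ) + expo η j with hb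
  have hbre : ∀ j, 1 < (b j).re := by
    intro j
    have := re_expo_ge h0.le h1 j
    simp only [hb, add_re, ofReal_re]
    linarith
  have key := zero_inequality Finset.univ coef b (f₀ := 1.507) (W := 19.7) (fun j _ ↦ hbre j)
    (by
      intro j _
      refine (norm_add_le _ _).trans ?_
      have := norm_expo_le h0.le h1 j
      rw [norm_real, Real.norm_eq_abs, abs_of_pos (by linarith)]
      linarith)
    (by
      intro j _
      apply norm_le_of_sq_le (by norm_num)
      fin_cases j <;> simp [hb, expo] <;> norm_num <;> nlinarith)
    sum_norm_coef_le sum_coef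
    (by
      have : ∑ j, coef j * b j = ((1 - η) * 1.507 + (2.10455 * η - 0.612274) : ℝ) := by
        rw [ofReal_add, ofReal_mul, ← sum_coef, ← sum_coef_mul_expo, Finset.mul_sum,
          ← Finset.sum_add_distrib]
        refine Finset.sum_congr rfl fun j _ ↦ ?_
        simp only [hb]; ring
      rw [this, ofReal_im])
    (fun n hn ↦ sum_coef_mul_cpow_nonneg hη hn)
    (fun k ↦ ([1.40915121, 2.40264, 1.4711, 0.6, 0.125] : List ℝ).getD k 0)
    (by
      intro k
      rcases k with _ | _ | _ | _ | _ | k <;> norm_num)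
    (by
      intro θ
      have c2 : Real.cos (2 * θ) = 2 * Real.cos θ ^ 2 - 1 := Real.cos_two_mul θ
      have c3 : Real.cos (3 * θ) = 4 * Real.cos θ ^ 3 - 3 * Real.cos θ := Real.cos_three_mul θ
      have c4 : Real.cos (4 * θ) = 2 * (2 * Real.cos θ ^ 2 - 1) ^ 2 - 1 := by
        rw [show 4 * θ = 2 * (2 * θ) by ring, Real.cos_two_mul, c2]
      have : 0 ≤ ((0.93 + Real.cos θ) * (0.27 + Real.cos θ)) ^ 2 := sq_nonneg _
      simp [Finset.sum_range_succ, c2, c3, c4]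
      nlinarith)
    h₀ (by intro h; rw [hηdef, h] at hη; norm_num at hη) (by linarith)
    (by
      intro k hk ρ hρ0
      set z : ℂ := (1 - η : ℝ) + (k * γ : ℝ) * I - ρ with hz
      have hr1 := re_lt_one_of_riemannXi_eq_zero hρ0
      have hr0 := re_pos_of_riemannXi_eq_zero hρ0
      have hzre : z.re = 1 - η - ρ.re := by simp [hz]
      have hzim : z.im = k * γ - ρ.im := by simp [hz]
      have hpos := re_sum_div_nonneg (z := z) h0 h1 (by linarith) (by linarith) (by
        intro hi
        rw [hzim, abs_sub_comm] at hi
        have n1 := hnear ρ hρ0 k hk hi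
        have n2 := hnear (1 - conj ρ) (by rw [riemannXi_one_sub_conj, hρ0, map_zero]) k hk
          (by simpa using hi)
        simp only [sub_re, one_re, conj_re] at n2
        constructor <;> linarith)
      rw [add_re, ← re_sum_div_symm h0.le h1 (by linarith), ← add_re,
        ← Finset.sum_add_distrib] at hpos
      convert hpos using 3 with j
      have hzc : conj z = (1 - η : ℝ) - (k * γ : ℝ) * I - conj ρ := by
        rw [hz, map_sub, map_add, map_mul, conj_ofReal, conj_ofReal, conj_I]; ring
      rw [mul_add, mul_one_div, mul_one_div, hzc]
      congr 2
      · simp only [hb, hz]; ring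
      · simp only [hb]; push_cast; ring)
  have hker : ∀ x : ℝ, -η ≤ x → ∑ j, coef j / ((x : ℂ) + expo η j) = nearKernel η x + farKernel x :=
    fun x hx ↦ sum_div_eq_kernel h0.le h1 (by rw [ofReal_re]; linarith)
  have s1 : ∑ j, coef j * (1 / (b j - 1) - ∑ m ∈ Finset.range 15, 1 / (b j + 2 * (m + 1))
        - 1 / (2 * (b j + 32)) + (b j - 1) / 66) =
      (nearKernel η (-η : ℝ) + farKernel (-η : ℝ)) -
        (∑ m ∈ Finset.range 15, (nearKernel η (2 * m + 3 - η : ℝ) + farKernel (2 * m + 3 - η : ℝ)))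
          -
        (1 / 2 : ℝ) * (nearKernel η (33 - η : ℝ) + farKernel (33 - η : ℝ)) +
        ((2.10455 * η - 0.612274 - 1.507 * η) / 66 : ℝ) := by
    rw [← hker _ le_rfl, ← hker _ (by linarith),
      show (((2.10455 * η - 0.612274 - 1.507 * η) / 66 : ℝ) : ℂ) =
        (∑ j, coef j * expo η j - ∑ j, coef j * η) / 66 by
          rw [← Finset.sum_mul, sum_coef, sum_coef_mul_expo]; push_cast; ring,
      Finset.sum_congr rfl (fun (m : ℕ) _ ↦ (hker (2 * m + 3 - η) (by
        have : (0 : ℝ) ≤ m := m.cast_nonneg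
        linarith)).symm), Finset.sum_comm, ← Finset.sum_sub_distrib, ← Finset.sum_sub_distrib,
      Finset.mul_sum, Finset.sum_div, ← Finset.sum_sub_distrib, ← Finset.sum_add_distrib]
    refine Finset.sum_congr rfl fun j _ ↦ ?_
    rw [mul_add, mul_sub, mul_sub, Finset.mul_sum]
    congr 1
    · congr 1
      · congr 1
        · rw [mul_one_div]; congr 1; simp only [hb]; push_cast; ring
        · refine Finset.sum_congr rfl fun m _ ↦ ?_
          rw [mul_one_div]; congr 1; simp only [hb]; push_cast; ring
      · rw [← one_div_mul_one_div, mul_left_comm, mul_one_div (coef j)]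
        congr 2
        · push_cast; rfl
        · simp only [hb]; push_cast; ring
    · simp only [hb]; push_cast; ring
  have s2 : ∑ j, coef j * (1 / (b j + γ * I - ρ₀) + 1 / (b j + γ * I - 1 + conj ρ₀)) =
      (nearKernel η 0 + farKernel 0) + (nearKernel η (1 - 2 * η : ℝ) + farKernel (1 - 2 * η : ℝ))
        := by
    rw [← hker _ (by linarith), show (0 : ℂ) = (0 : ℝ) by simp, ← hker _ (by linarith),
      ← Finset.sum_add_distrib]
    refine Finset.sum_congr rfl fun j _ ↦ ?_
    rw [mul_add, mul_one_div, mul_one_div, hρ', hρ]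
    congr 2
    · simp only [hb]; push_cast; ring
    · simp only [hb]; push_cast; ring
  rw [s1, s2] at key
  have hfin := kernel_inequality h0 h1
  have hL : Real.log (γ / 17) ≤ 1 / (6.315 * η) := by
    rw [← div_div, le_div_iff₀ h0]; linarith
  have hk : ∀ k : ℕ, 0 < k → ∀ c : ℝ, Real.log k + 0.9954 ≤ c →
      (1.507 : ℝ) * (Real.log (k * γ / (2 * Real.pi)) / 2) + 19.7 * (6.5 / (k * γ) ^ 2) ≤
        1.507 / 2 * (c + 1 / (6.315 * η)) + 19.7 * 6.5 / 64 ^ 2 / k ^ 2 := by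
    intro k hk c hc
    rw [log_mul_div_two_pi hγ0 k hk]
    have h3 : 6.5 / (k * γ) ^ 2 ≤ 6.5 / 64 ^ 2 / k ^ 2 := by
      rw [mul_pow, div_div, mul_comm]
      gcongr
    have := log_17_div_two_pi
    have h4 := mul_le_mul_of_nonneg_left h3 (show (0 : ℝ) ≤ 19.7 by norm_num)
    rw [show (19.7 : ℝ) * (6.5 / 64 ^ 2 / k ^ 2) = 19.7 * 6.5 / 64 ^ 2 / k ^ 2 by ring] at h4
    generalize (19.7 : ℝ) * 6.5 / 64 ^ 2 / k ^ 2 = v at h4 ⊢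
    generalize 19.7 * (6.5 / (k * γ) ^ 2) = u at h4 ⊢
    generalize 1 / (6.315 * η) = q at hL ⊢
    linarith
  have l2 := Real.log_two_lt_d9
  have l3 := log_three_le
  have l4 : Real.log 4 = 2 * Real.log 2 := by
    rw [show (4 : ℝ) = 2 ^ 2 by norm_num, Real.log_pow]; norm_num
  have k1 := hk 1 one_pos 0.9955 (by norm_num)
  have k2 := hk 2 two_pos 1.6886 (by norm_num at l2 ⊢; linarith)
  have k3 := hk 3 three_pos 2.0941 (by norm_num at l3 ⊢; linarith)
  have k4 := hk 4 four_pos 2.3818 (by rw [Nat.cast_ofNat, l4]; norm_num at l2 ⊢; linarith)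
  have l5 := log_33_div_two_pi
  rw [show Finset.Icc 1 4 = {1, 2, 3, 4} by rfl] at key
  simp only [Finset.sum_insert, Finset.mem_insert, Finset.mem_singleton, OfNat.one_ne_ofNat,
    Nat.reduceEqDiff, or_self, not_false_eq_true, Finset.sum_singleton] at key
  simp only [List.getD_cons_zero, List.getD_cons_succ, add_re, sub_re, re_sum, re_ofReal_mul,
    ofReal_re] at key hfin
  rw [← hγdef, show (4.59874 : ℝ) / (6.315 * η) = 4.59874 * (1 / (6.315 * η)) by ring] at *
  norm_num only [Nat.cast_one, Nat.cast_ofNat] at k1 k2 k3 k4 key hfin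
  generalize 1 / (6.315 * η) = q at *
  linarith

lemma riemannXi_zero_lower_bound {ρ : ℂ} (h : riemannXi ρ = 0) (hγ : 64 ≤ ρ.im) :
    1 / 56 * (1.3255 / (1.3255 + 3)) ≤ (1 - ρ.re) * Real.log (ρ.im / 17) := by
  have hc := classical_zero_free_region h (by linarith)
  have h1 : 1.3255 ≤ Real.log (ρ.im / 17) := le_log_64_div_17.trans
    (Real.log_le_log (by norm_num) (by gcongr))
  have h2 : Real.log ρ.im = Real.log (ρ.im / 17) + Real.log 17 := by
    rw [Real.log_div (by linarith) (by norm_num)]; ring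
  have h3 : Real.log 17 ≤ 3 :=
    log_le_of_pow_le (n := 1) (m := 3) (y := 1) one_pos (by norm_num) (by norm_num) (by norm_num)
  have hd : 0 < 1 - ρ.re := by linarith [re_lt_one_of_riemannXi_eq_zero h]
  set L := Real.log (ρ.im / 17)
  have h4 : (1 - ρ.re) * Real.log ρ.im ≤ (1 - ρ.re) * (L * ((1.3255 + 3) / 1.3255)) := by
    apply mul_le_mul_of_nonneg_left _ hd.le
    rw [h2]
    have : L * ((1.3255 + 3) / 1.3255) = L + (L / 1.3255) * 3 := by ring
    have : 1 ≤ L / 1.3255 := by rw [le_div_iff₀ (by norm_num)]; linarith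
    linarith
  linarith

theorem lt_of_riemannXi_eq_zero_of_low
    (hlow : ∀ ρ, riemannXi ρ = 0 → |ρ.im| < 64 → 0.1195 ≤ 1 - ρ.re) {ρ : ℂ}
    (h : riemannXi ρ = 0) (hγ : 64 ≤ ρ.im) :
    1 / 6.315 < (1 - ρ.re) * Real.log (ρ.im / 17) := by
  by_contra! hviol
  set δ : ℂ → ℝ := fun ρ ↦ (1 - ρ.re) * Real.log (ρ.im / 17) with hδ
  set S : Set ℝ := δ '' {ρ | riemannXi ρ = 0 ∧ 64 ≤ ρ.im} with hS
  have hbdd : ∀ x ∈ S, 1 / 56 * (1.3255 / (1.3255 + 3)) ≤ x := by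
    rintro _ ⟨ρ', h', rfl⟩
    exact riemannXi_zero_lower_bound h'.1 h'.2
  have hne : S.Nonempty := ⟨δ ρ, ρ, ⟨h, hγ⟩, rfl⟩
  have hB : BddBelow S := ⟨_, hbdd⟩
  have hD : 0 < sInf S := lt_of_lt_of_le (by norm_num) (le_csInf hne hbdd)
  obtain ⟨ρ₀, h₀, hγ₀, hv₀, hmin⟩ : ∃ ρ₀, riemannXi ρ₀ = 0 ∧ 64 ≤ ρ₀.im ∧ δ ρ₀ ≤ 1 / 6.315 ∧
      0.995 * δ ρ₀ ≤ sInf S := by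
    rcases le_or_gt (0.995 * δ ρ) (sInf S) with hc | hc
    · exact ⟨ρ, h, hγ, hviol, hc⟩
    · obtain ⟨_, ⟨ρ', h', rfl⟩, hlt⟩ := exists_lt_of_csInf_lt hne
        (show sInf S < sInf S / 0.995 by rw [lt_div_iff₀ (by norm_num)]; linarith)
      rw [lt_div_iff₀ (by norm_num)] at hlt
      refine ⟨ρ', h'.1, h'.2, ?_, by linarith⟩
      have : δ ρ ≤ 1 / 6.315 := hviol
      linarith
  have hL : 1.3255 ≤ Real.log (ρ₀.im / 17) := le_log_64_div_17.trans
    (Real.log_le_log (by norm_num) (by gcongr))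
  have hη0 : 0 < 1 - ρ₀.re := by linarith [re_lt_one_of_riemannXi_eq_zero h₀]
  have hη : 1 - ρ₀.re ≤ 0.1195 := by
    simp only [hδ] at hv₀
    nlinarith
  refine no_zero_of_isolated h₀ hγ₀ hη hv₀ fun ρ' h' k hk hnear ↦ ?_
  have hhigh : ∀ ρ' : ℂ, riemannXi ρ' = 0 → 64 ≤ ρ'.im → ρ'.im ≤ 4 * ρ₀.im + 40 →
      0.46 * (1 - ρ₀.re) ≤ 1 - ρ'.re := by
    intro ρ' h' hi hi2
    have hm : 0.995 * δ ρ₀ ≤ δ ρ' := hmin.trans (csInf_le hB ⟨ρ', ⟨h', hi⟩, rfl⟩)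
    have hl : Real.log (ρ'.im / 17) ≤ Real.log (ρ₀.im / 17) + 1.533 := by
      have := Real.log_le_log (show 0 < ρ'.im / 17 by linarith)
        (show ρ'.im / 17 ≤ ρ₀.im / 17 * 4.625 by linarith)
      rw [Real.log_mul (by linarith) (by norm_num)] at this
      linarith [log_le_one_point]
    have hl0 : 0 < Real.log (ρ'.im / 17) := Real.log_pos (by linarith)
    simp only [hδ] at hm
    have h5 : 0.46 * (Real.log (ρ₀.im / 17) + 1.533) ≤ 0.995 * Real.log (ρ₀.im / 17) := by linarith
    have h6 : 0.46 * (1 - ρ₀.re) * Real.log (ρ'.im / 17) ≤ (1 - ρ'.re) * Real.log (ρ'.im / 17) := by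
      nlinarith
    exact le_of_mul_le_mul_right h6 hl0
  have hk4 : (k : ℝ) ≤ 4 := by exact_mod_cast hk
  have hk0 : (0 : ℝ) ≤ k := k.cast_nonneg
  rw [abs_lt] at hnear
  rcases lt_or_ge |ρ'.im| 64 with hi | hi
  · linarith [hlow ρ' h' hi]
  · rcases le_abs'.1 hi with hn | hp
    · have := hhigh (conj ρ') (by rw [riemannXi_conj, h', map_zero]) (by simp; linarith)
        (by simp; nlinarith)
      simpa using this
    · exact hhigh ρ' h' hp (by nlinarith)

end

section

open Complex

/-- The difference between the integral of `x ^ (-s)` over `[n, n + 1]` and its trapezoidal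
approximation, corrected by the derivatives at the end points. -/
noncomputable def emTerm (s : ℂ) (n : ℕ) : ℂ :=
  (n * (n : ℂ) ^ (-s) - (n + 1) * ((n + 1 : ℕ) : ℂ) ^ (-s)) / (s - 1)
    - ((n : ℂ) ^ (-s) + ((n + 1 : ℕ) : ℂ) ^ (-s)) / 2
    + s / 12 * ((n : ℂ) ^ (-s) / n - ((n + 1 : ℕ) : ℂ) ^ (-s) / (n + 1))

/-- A primitive of `x ↦ (x - a)² (1 + a - x)² / 24 * s (s + 1) (s + 2) (s + 3) * x ^ (-s - 4)`. -/
noncomputable def emPrimitive (s a z : ℂ) : ℂ :=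
  z ^ (-s) * (-((z - a) ^ 2 * (1 + a - z) ^ 2 / 24 * (s * (s + 1) * (s + 2)) / z ^ 3)
    - (z - a) * (1 + a - z) * (1 + 2 * a - 2 * z) / 12 * (s * (s + 1)) / z ^ 2
    - (6 * (z - a) ^ 2 - 6 * (z - a) + 1) / 12 * s / z - (z - a - 1 / 2) - z / (s - 1))

theorem hasDerivAt_emPrimitive {s a z : ℂ} (hs : s ≠ 1) (hz : z ∈ slitPlane) :
    HasDerivAt (emPrimitive s a)
      ((z - a) ^ 2 * (1 + a - z) ^ 2 / 24 * (s * (s + 1) * (s + 2) * (s + 3)) * z ^ (-s) / z ^ 4)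
      z := by
  have hz0 : z ≠ 0 := slitPlane_ne_zero hz
  have hs1 : s - 1 ≠ 0 := sub_ne_zero.2 hs
  have hE : HasDerivAt (fun z : ℂ => z ^ (-s)) (-s * (z ^ (-s) / z)) z := by
    have := (hasDerivAt_id z).cpow_const (c := -s) hz
    simpa [cpow_sub _ _ hz0] using this
  have hid := hasDerivAt_id' z
  have hu : HasDerivAt (fun z : ℂ => z - a) 1 z := hid.sub_const a
  have hv : HasDerivAt (fun z : ℂ => 1 + a - z) (-1) z := by simpa using hid.const_sub (1 + a)
  have hw : HasDerivAt (fun z : ℂ => 1 + 2 * a - 2 * z) (-2) z := by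
    simpa using (hid.const_mul 2).const_sub (1 + 2 * a)
  have h1 := ((((hu.pow 2).mul (hv.pow 2)).div_const 24).mul_const
    (s * (s + 1) * (s + 2))).div (hid.pow 3) (pow_ne_zero 3 hz0)
  have h2 := ((((hu.mul hv).mul hw).div_const 12).mul_const (s * (s + 1))).div (hid.pow 2)
    (pow_ne_zero 2 hz0)
  have h3 := ((((((hu.pow 2).const_mul 6).sub (hu.const_mul 6)).add_const 1).div_const
    12).mul_const s).div hid hz0
  have h := hE.mul ((((h1.neg.sub h2).sub h3).sub (hu.sub_const (1 / 2))).sub (hid.div_const (s -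
    1)))
  refine h.congr_deriv ?_
  simp only [Pi.mul_apply, Pi.pow_apply, Pi.sub_apply, Pi.neg_apply, Pi.div_apply]
  field_simp
  ring

theorem emTerm_eq {s : ℂ} (n : ℕ) :
    emTerm s n = emPrimitive s n (n + 1 : ℕ) - emPrimitive s n n := by
  unfold emTerm emPrimitive
  push_cast
  ring

theorem norm_emPrimitive_deriv_le {s : ℂ} {a x : ℝ} (ha : 0 < a) (hx : x ∈ Set.Icc a (a + 1)) :
    ‖((x : ℂ) - a) ^ 2 * (1 + a - x) ^ 2 / 24 * (s * (s + 1) * (s + 2) * (s + 3)) * (x : ℂ) ^ (-s)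
      / (x : ℂ) ^ 4‖ ≤ ‖s * (s + 1) * (s + 2) * (s + 3)‖ / 384 * x ^ (-s.re - 4) := by
  have hx0 : 0 < x := ha.trans_le hx.1
  have h1 : ‖((x : ℂ) - a) ^ 2 * (1 + a - x) ^ 2 / 24‖ ≤ 1 / 384 := by
    rw [show ((x : ℂ) - a) ^ 2 * (1 + a - x) ^ 2 / 24
      = (((x - a) ^ 2 * (1 + a - x) ^ 2 / 24 : ℝ) : ℂ) by push_cast; ring, norm_real,
      Real.norm_of_nonneg (by positivity)]
    have h0 : 0 ≤ (x - a) * (1 + a - x) := mul_nonneg (by linarith [hx.1]) (by linarith [hx.2])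
    have h4 : (x - a) * (1 + a - x) ≤ 1 / 4 := by nlinarith [sq_nonneg (x - a - 1 / 2)]
    nlinarith
  rw [norm_div, norm_mul, norm_mul, norm_cpow_eq_rpow_re_of_pos hx0, norm_pow, norm_real,
    Real.norm_of_nonneg hx0.le, neg_re, Real.rpow_sub hx0,
    show x ^ (4 : ℝ) = x ^ 4 by exact_mod_cast Real.rpow_natCast x 4, mul_div_assoc]
  gcongr
  calc _ ≤ 1 / 384 * ‖s * (s + 1) * (s + 2) * (s + 3)‖ := by gcongr
    _ = _ := by ring

theorem norm_emTerm_le {s : ℂ} (hs : s ≠ 1) (h0 : 0 < s.re) {n : ℕ} (hn : 0 < n) :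
    ‖emTerm s n‖ ≤ ‖s * (s + 1) * (s + 2) * (s + 3)‖ / (384 * (s.re + 3)) *
      ((n : ℝ) ^ (-s.re - 3) - ((n + 1 : ℕ) : ℝ) ^ (-s.re - 3)) := by
  have hn' : (0 : ℝ) < n := by exact_mod_cast hn
  set M := ‖s * (s + 1) * (s + 2) * (s + 3)‖ / 384 with hM
  have key : ∀ x ∈ Set.Icc (n : ℝ) (n + 1), HasDerivAt (fun x : ℝ => emPrimitive s n x)
      (((x : ℂ) - n) ^ 2 * (1 + n - x) ^ 2 / 24 * (s * (s + 1) * (s + 2) * (s + 3)) *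
        (x : ℂ) ^ (-s) / (x : ℂ) ^ 4) x := fun x hx =>
    (hasDerivAt_emPrimitive hs (ofReal_mem_slitPlane.2 (hn'.trans_le hx.1))).comp_ofReal
  have hB : ∀ x ∈ Set.Icc (n : ℝ) (n + 1), HasDerivAt
      (fun x : ℝ => M / (s.re + 3) * ((n : ℝ) ^ (-s.re - 3) - x ^ (-s.re - 3)))
      (M * x ^ (-s.re - 4)) x := by
    intro x hx
    have := ((Real.hasDerivAt_rpow_const (p := -s.re - 3)
      (Or.inl (hn'.trans_le hx.1).ne')).const_sub ((n : ℝ) ^ (-s.re - 3))).const_mul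
        (M / (s.re + 3))
    refine this.congr_deriv ?_
    rw [show -s.re - 3 - 1 = -s.re - 4 by ring]
    have : s.re + 3 ≠ 0 := by positivity
    field_simp
    ring
  have h := image_norm_le_of_norm_deriv_right_le_deriv_boundary' (a := (n : ℝ)) (b := n + 1)
    (f := fun x : ℝ => emPrimitive s n x - emPrimitive s n (n : ℝ))
    (B := fun x : ℝ => M / (s.re + 3) * ((n : ℝ) ^ (-s.re - 3) - x ^ (-s.re - 3)))
    (B' := fun x => M * x ^ (-s.re - 4))
    (fun x hx => ((key x hx).continuousAt.continuousWithinAt).sub continuousWithinAt_const)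
    (fun x hx => ((key x ⟨hx.1, hx.2.le⟩).sub_const _).hasDerivWithinAt)
    (by simp) (fun x hx => (hB x hx).continuousAt.continuousWithinAt)
    (fun x hx => (hB x ⟨hx.1, hx.2.le⟩).hasDerivWithinAt)
    (fun x hx => by
      have := norm_emPrimitive_deriv_le (s := s) hn' (x := x) ⟨hx.1, hx.2.le⟩
      simpa [hM] using this)
    (Set.right_mem_Icc.2 (by linarith))
  rw [emTerm_eq]
  calc _ = ‖emPrimitive s n ((n + 1 : ℝ) : ℝ) - emPrimitive s n (n : ℝ)‖ := by push_cast; rfl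
    _ ≤ _ := h
    _ = _ := by rw [hM, div_div]; push_cast; rfl

theorem norm_emTerm_le' {s : ℂ} (hs : s ≠ 1) (h0 : 0 < s.re) {n : ℕ} (hn : 0 < n) :
    ‖emTerm s n‖ ≤ ‖s * (s + 1) * (s + 2) * (s + 3)‖ * (1 / (n : ℝ) ^ 4) := by
  have hn' : (0 : ℝ) < n := by exact_mod_cast hn
  have key : ∀ x ∈ Set.Icc (n : ℝ) (n + 1), HasDerivAt (fun x : ℝ => emPrimitive s n x)
      (((x : ℂ) - n) ^ 2 * (1 + n - x) ^ 2 / 24 * (s * (s + 1) * (s + 2) * (s + 3)) *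
        (x : ℂ) ^ (-s) / (x : ℂ) ^ 4) x := fun x hx =>
    (hasDerivAt_emPrimitive hs (ofReal_mem_slitPlane.2 (hn'.trans_le hx.1))).comp_ofReal
  have h := Convex.norm_image_sub_le_of_norm_hasDerivWithin_le
    (C := ‖s * (s + 1) * (s + 2) * (s + 3)‖ * (1 / (n : ℝ) ^ 4))
    (fun x hx => (key x hx).hasDerivWithinAt)
    (fun x hx => by
      have := norm_emPrimitive_deriv_le (s := s) hn' (x := x) hx
      refine (by simpa using this : _ ≤ _).trans ?_
      have hx1 : (1 : ℝ) ≤ x := le_trans (by exact_mod_cast hn) hx.1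
      have : x ^ (-s.re - 4) ≤ 1 / (n : ℝ) ^ 4 := by
        calc x ^ (-s.re - 4) ≤ x ^ (-4 : ℝ) := Real.rpow_le_rpow_of_exponent_le hx1 (by linarith)
          _ = 1 / x ^ 4 := by
            rw [Real.rpow_neg (by linarith), one_div]
            congr 1
            exact_mod_cast Real.rpow_natCast x 4
          _ ≤ _ := by
            have := hx.1
            gcongr
      have h3 : ‖s * (s + 1) * (s + 2) * (s + 3)‖ / 384 ≤ ‖s * (s + 1) * (s + 2) * (s + 3)‖ := by
        linarith [norm_nonneg (s * (s + 1) * (s + 2) * (s + 3))]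
      have h4 : 0 ≤ x ^ (-s.re - 4) := Real.rpow_nonneg (by linarith) _
      simp only [norm_mul] at *
      gcongr)
    (convex_Icc (n : ℝ) (n + 1)) (Set.left_mem_Icc.2 (by linarith))
    (Set.right_mem_Icc.2 (by linarith))
  rw [emTerm_eq]
  calc _ = ‖emPrimitive s n ((n + 1 : ℝ) : ℝ) - emPrimitive s n (n : ℝ)‖ := by push_cast; rfl
    _ ≤ _ := h
    _ = _ := by simp

end

section

open Complex Filter Topology

theorem sum_emTerm (s : ℂ) {N M : ℕ} (hNM : N ≤ M) :
    ∑ n ∈ Finset.Ico N M, emTerm s n =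
      (N : ℂ) ^ (-s) * (1 / 2 + N / (s - 1) + s / 12 / N)
        - (M : ℂ) ^ (-s) * (1 / 2 + M / (s - 1) + s / 12 / M)
        - ∑ n ∈ Finset.Ico N M, (n : ℂ) ^ (-s) := by
  induction M, hNM using Nat.le_induction with
  | base => simp
  | succ M hM ih =>
    rw [Finset.sum_Ico_succ_top hM, Finset.sum_Ico_succ_top hM, ih]
    unfold emTerm
    push_cast
    ring

theorem summable_emTerm {s : ℂ} (hs : s ≠ 1) (h0 : 0 < s.re) {N : ℕ} (hN : 0 < N) :
    Summable fun n => emTerm s (N + n) := by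
  refine Summable.of_norm_bounded (g := fun n : ℕ =>
    ‖s * (s + 1) * (s + 2) * (s + 3)‖ * (1 / ((N + n : ℕ) : ℝ) ^ 4)) ?_
    fun n => norm_emTerm_le' hs h0 (by omega)
  refine Summable.mul_left _ ?_
  have := (summable_nat_add_iff N).2 (Real.summable_one_div_nat_pow (p := 4).2 (by norm_num))
  simpa [add_comm] using this

theorem sum_range_emTerm (s : ℂ) (N k : ℕ) :
    ∑ n ∈ Finset.range k, emTerm s (N + n) = ∑ n ∈ Finset.Ico N (N + k), emTerm s n := by
  rw [Finset.sum_Ico_eq_sum_range]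
  simp

theorem norm_tsum_emTerm_le {s : ℂ} (hs : s ≠ 1) (h0 : 0 < s.re) {N : ℕ} (hN : 0 < N) :
    ‖∑' n, emTerm s (N + n)‖ ≤
      ‖s * (s + 1) * (s + 2) * (s + 3)‖ / (384 * (s.re + 3)) * (N : ℝ) ^ (-s.re - 3) := by
  refine le_of_tendsto (summable_emTerm hs h0 hN).hasSum.tendsto_sum_nat.norm
    (Eventually.of_forall fun k => ?_)
  have hC : 0 ≤ ‖s * (s + 1) * (s + 2) * (s + 3)‖ / (384 * (s.re + 3)) := by positivity
  have : ‖∑ n ∈ Finset.range k, emTerm s (N + n)‖ ≤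
      ‖s * (s + 1) * (s + 2) * (s + 3)‖ / (384 * (s.re + 3)) *
        ((N : ℝ) ^ (-s.re - 3) - ((N + k : ℕ) : ℝ) ^ (-s.re - 3)) := by
    induction k with
    | zero => simp
    | succ k ih =>
      rw [Finset.sum_range_succ]
      refine (norm_add_le _ _).trans ?_
      have := norm_emTerm_le hs h0 (n := N + k) (by omega)
      calc _ ≤ _ := add_le_add ih this
        _ = _ := by rw [add_assoc N k 1]; ring
  refine this.trans (mul_le_mul_of_nonneg_left ?_ hC)
  have : 0 ≤ ((N + k : ℕ) : ℝ) ^ (-s.re - 3) := by positivity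
  linarith

theorem tendsto_sum_Ico_cpow {s : ℂ} (hs : 1 < s.re) :
    Tendsto (fun M : ℕ => ∑ n ∈ Finset.Ico 1 M, (n : ℂ) ^ (-s)) atTop (𝓝 (riemannZeta s)) := by
  have h := zeta_eq_tsum_one_div_nat_cpow hs
  have hsum : Summable fun n : ℕ => 1 / (n : ℂ) ^ s := Complex.summable_one_div_nat_cpow.2 hs
  have h1 := hsum.hasSum.tendsto_sum_nat
  rw [← h] at h1
  refine h1.congr' ?_
  filter_upwards [eventually_ge_atTop 1] with M hM
  rw [Finset.range_eq_Ico, Finset.sum_eq_sum_Ico_succ_bot (by omega)]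
  have hs0 : s ≠ 0 := by rintro rfl; norm_num at hs
  simp [zero_cpow hs0, cpow_neg]

theorem riemannZeta_eq_of_one_lt_re {s : ℂ} (hs : 1 < s.re) {N : ℕ} (hN : 0 < N) :
    riemannZeta s = ∑ n ∈ Finset.Ico 1 N, (n : ℂ) ^ (-s)
      + (N : ℂ) ^ (-s) * (1 / 2 + N / (s - 1) + s / 12 / N) - ∑' n, emTerm s (N + n) := by
  have hs1 : s ≠ 1 := by rintro rfl; norm_num at hs
  have h1 := (summable_emTerm hs1 (by linarith) hN).hasSum.tendsto_sum_nat
  have hadd : Tendsto (fun k => N + k) atTop atTop := tendsto_add_atTop_iff_nat N |>.2 tendsto_id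
    |>.congr fun k => by simp [add_comm]
  have hz := (tendsto_sum_Ico_cpow hs).comp hadd
  have hM : Tendsto (fun M : ℕ => (M : ℂ) ^ (-s) * (1 / 2 + M / (s - 1) + s / 12 / M)) atTop
      (𝓝 0) := by
    have ha : Tendsto (fun M : ℕ => (M : ℂ) ^ (-s) * M) atTop (𝓝 0) := by
      rw [tendsto_zero_iff_norm_tendsto_zero]
      have := (tendsto_rpow_neg_atTop (y := s.re - 1) (by linarith)).comp
        (tendsto_natCast_atTop_atTop (R := ℝ))
      refine this.congr' ?_
      filter_upwards [eventually_gt_atTop 0] with M hM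
      have hM' : (0 : ℝ) < M := by exact_mod_cast hM
      rw [norm_mul, norm_natCast_cpow_of_pos hM, norm_natCast, Function.comp_apply,
        show -(s.re - 1) = (-s).re + 1 by simp; ring, Real.rpow_add_one hM'.ne']
    have hb : Tendsto (fun M : ℕ => ((M : ℂ))⁻¹) atTop (𝓝 0) :=
      tendsto_inv_atTop_nhds_zero_nat (𝕜 := ℂ)
    have hc := ha.mul (((hb.mul_const (1 / 2)).add_const (1 / (s - 1))).add
      ((hb.mul hb).mul_const (s / 12)))
    rw [zero_mul] at hc
    refine hc.congr' ?_
    filter_upwards [eventually_gt_atTop 0] with M hM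
    have : (M : ℂ) ≠ 0 := by exact_mod_cast hM.ne'
    have := sub_ne_zero.2 hs1
    field_simp
  have h2 : Tendsto (fun k => ∑ n ∈ Finset.range k, emTerm s (N + n)) atTop
      (𝓝 ((N : ℂ) ^ (-s) * (1 / 2 + N / (s - 1) + s / 12 / N) - 0
        - (riemannZeta s - ∑ n ∈ Finset.Ico 1 N, (n : ℂ) ^ (-s)))) := by
    refine (((hM.comp hadd).const_sub _).sub (hz.sub_const _)).congr fun k => ?_
    rw [sum_range_emTerm, sum_emTerm s (Nat.le_add_right N k)]
    simp only [Function.comp_apply]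
    rw [← Finset.sum_Ico_consecutive _ (show 1 ≤ N by omega) (Nat.le_add_right N k)]
    ring
  have := tendsto_nhds_unique h1 h2
  rw [this]
  ring

/-- The Euler-Maclaurin formula for the zeta function in the upper half plane. -/
theorem riemannZeta_eq_of_pos {s : ℂ} (h0 : 0 < s.re) (h1 : 0 < s.im) {N : ℕ} (hN : 0 < N) :
    riemannZeta s = ∑ n ∈ Finset.Ico 1 N, (n : ℂ) ^ (-s)
      + (N : ℂ) ^ (-s) * (1 / 2 + N / (s - 1) + s / 12 / N) - ∑' n, emTerm s (N + n) := by
  set U : Set ℂ := {z | 0 < z.re} ∩ {z | 0 < z.im} ∩ Metric.ball 0 (‖s‖ + 3) with hU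
  have hUo : IsOpen U := ((isOpen_lt continuous_const continuous_re).inter
    (isOpen_lt continuous_const continuous_im)).inter Metric.isOpen_ball
  have hUc : Convex ℝ U :=
    ((convex_halfSpace_re_gt 0).inter (convex_halfSpace_im_gt 0)).inter (convex_ball _ _)
  have hne : ∀ z ∈ U, z ≠ 1 := by
    rintro z hz rfl
    simpa using hz.1.2
  have hzeta : DifferentiableOn ℂ riemannZeta U := fun z hz =>
    (differentiableAt_riemannZeta (hne z hz)).differentiableWithinAt
  have hpow : ∀ n : ℕ, 0 < n → DifferentiableOn ℂ (fun z : ℂ => (n : ℂ) ^ (-z)) U := fun n hn =>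
    (differentiable_id.neg.const_cpow (Or.inl (by exact_mod_cast hn.ne'))).differentiableOn
  have hsub : ∀ z ∈ U, z - 1 ≠ 0 := fun z hz => sub_ne_zero.2 (hne z hz)
  have hid : DifferentiableOn ℂ (fun z : ℂ => z) U := differentiableOn_id
  have hterm : ∀ n : ℕ, DifferentiableOn ℂ (fun z => emTerm z (N + n)) U := by
    intro n
    unfold emTerm
    have ha := hpow (N + n) (by omega)
    have hb := hpow (N + n + 1) (by omega)
    exact ((((ha.const_mul _).sub (hb.const_mul _)).div (hid.sub_const 1) hsub).sub
      ((ha.add hb).div_const 2)).add ((hid.div_const 12).mul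
        ((ha.div_const _).sub (hb.div_const _)))
  set R := ‖s‖ + 3 with hR
  have hR0 : 0 < R := by positivity
  have htsum : DifferentiableOn ℂ (fun z => ∑' n, emTerm z (N + n)) U := by
    refine differentiableOn_tsum_of_summable_norm (u := fun n : ℕ =>
      (R * (R + 1) * (R + 2) * (R + 3)) * (1 / ((N + n : ℕ) : ℝ) ^ 4)) ?_ hterm hUo ?_
    · refine Summable.mul_left _ ?_
      have := (summable_nat_add_iff N).2 (Real.summable_one_div_nat_pow (p := 4).2 (by norm_num))
      simpa [add_comm] using this
    · intro n z hz
      refine (norm_emTerm_le' (hne z hz) hz.1.1 (by omega)).trans ?_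
      have hzR : ‖z‖ ≤ R := by simpa using (mem_ball_zero_iff.1 hz.2).le
      have ht : ∀ a : ℝ, 0 ≤ a → ‖z + a‖ ≤ R + a := fun a ha => (norm_add_le _ _).trans (by
        rw [norm_real, Real.norm_of_nonneg ha]; linarith)
      have h1 := ht 1 (by norm_num)
      have h2 := ht 2 (by norm_num)
      have h3 := ht 3 (by norm_num)
      push_cast at h1 h2 h3
      rw [norm_mul, norm_mul, norm_mul]
      gcongr
  have hrhs : DifferentiableOn ℂ (fun s : ℂ => ∑ n ∈ Finset.Ico 1 N, (n : ℂ) ^ (-s)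
      + (N : ℂ) ^ (-s) * (1 / 2 + N / (s - 1) + s / 12 / N) - ∑' n, emTerm s (N + n)) U := by
    refine DifferentiableOn.sub (DifferentiableOn.add (DifferentiableOn.fun_sum fun n hn =>
      hpow n (by have := Finset.mem_Ico.1 hn; omega)) ((hpow N hN).mul ?_)) htsum
    exact (((differentiableOn_const _).div (hid.sub_const 1) hsub).const_add _).add
      ((hid.div_const 12).div_const _)
  have hp : (2 + I : ℂ) ∈ U := by
    refine ⟨⟨by simp, by simp⟩, ?_⟩
    rw [mem_ball_zero_iff]
    calc ‖(2 + I : ℂ)‖ < 3 := by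
          rw [← sq_lt_sq₀ (norm_nonneg _) (by norm_num), ← normSq_eq_norm_sq]
          simp [normSq_apply]; norm_num
      _ ≤ R := by rw [hR]; linarith [norm_nonneg s]
  have hev : riemannZeta =ᶠ[𝓝 (2 + I)] (fun s : ℂ => ∑ n ∈ Finset.Ico 1 N, (n : ℂ) ^ (-s)
      + (N : ℂ) ^ (-s) * (1 / 2 + N / (s - 1) + s / 12 / N) - ∑' n, emTerm s (N + n)) := by
    filter_upwards [(isOpen_lt continuous_const continuous_re).mem_nhds
      (show (1 : ℝ) < (2 + I : ℂ).re by simp)] with z hz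
    exact riemannZeta_eq_of_one_lt_re hz hN
  exact (hzeta.analyticOnNhd hUo).eqOn_of_preconnected_of_eventuallyEq (hrhs.analyticOnNhd hUo)
    hUc.isPreconnected hp hev ⟨⟨h0, h1⟩, by simp⟩

theorem norm_riemannZeta_sub_le {s : ℂ} (h0 : 0 < s.re) (h1 : 0 < s.im) {N : ℕ} (hN : 0 < N) :
    ‖riemannZeta s - (∑ n ∈ Finset.Ico 1 N, (n : ℂ) ^ (-s)
      + (N : ℂ) ^ (-s) * (1 / 2 + N / (s - 1) + s / 12 / N))‖ ≤
      ‖s * (s + 1) * (s + 2) * (s + 3)‖ / (384 * (s.re + 3)) * (N : ℝ) ^ (-s.re - 3) := by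
  have hs : s ≠ 1 := by rintro rfl; simp at h1
  rw [riemannZeta_eq_of_pos h0 h1 hN, sub_sub_cancel_left, norm_neg]
  exact norm_tsum_emTerm_le hs h0 hN

theorem norm_riemannZeta_sub_le_one {s : ℂ} (h0 : 0 < s.re) (h1 : 0 ≤ s.im) (hs : s ≠ 1) :
    ‖riemannZeta s - (s + 2) * (s + 3) / (12 * (s - 1))‖ ≤
      ‖s * (s + 1) * (s + 2) * (s + 3)‖ / (384 * (s.re + 3)) := by
  have key : ∀ z : ℂ, 0 < z.re → 0 < z.im → ‖riemannZeta z - (z + 2) * (z + 3) / (12 * (z - 1))‖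
      ≤ ‖z * (z + 1) * (z + 2) * (z + 3)‖ / (384 * (z.re + 3)) := by
    intro z h0 h1
    have hz : z - 1 ≠ 0 := by
      intro h
      rw [sub_eq_zero.1 h] at h1
      simp at h1
    have h := norm_riemannZeta_sub_le h0 h1 (N := 1) one_pos
    simp only [Finset.Ico_self, Finset.sum_empty, Nat.cast_one, one_cpow, Real.one_rpow,
      mul_one, one_mul, zero_add] at h
    convert h using 3
    field_simp
    ring
  have hs1 : s - 1 ≠ 0 := sub_ne_zero.2 hs
  have hline : Tendsto (fun ε : ℝ => s + ε * I) (𝓝[>] 0) (𝓝 s) := by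
    have : Continuous fun ε : ℝ => s + ε * I := by fun_prop
    simpa using (this.tendsto 0).mono_left nhdsWithin_le_nhds
  have hl : ContinuousAt
      (fun z => ‖riemannZeta z - (z + 2) * (z + 3) / (12 * (z - 1))‖) s := by
    have := (differentiableAt_riemannZeta hs).continuousAt
    refine (this.sub (ContinuousAt.div ?_ ?_ ?_)).norm
    · fun_prop
    · fun_prop
    · exact mul_ne_zero (by norm_num) hs1
  have hr : ContinuousAt
      (fun z : ℂ => ‖z * (z + 1) * (z + 2) * (z + 3)‖ / (384 * (z.re + 3))) s := by
    refine ContinuousAt.div ?_ ?_ (by positivity)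
    · fun_prop
    · fun_prop
  refine le_of_tendsto_of_tendsto (hl.tendsto.comp hline) (hr.tendsto.comp hline) ?_
  filter_upwards [self_mem_nhdsWithin] with ε hε
  have hε' : (0 : ℝ) < ε := hε
  exact key _ (by simpa using h0) (by simpa using by linarith)

/-- The zeta function does not vanish near the real segment `[1/2, 1)`. -/
theorem riemannZeta_ne_zero_of_im_le_four {s : ℂ} (h0 : 1 / 2 ≤ s.re) (h1 : s.re < 1)
    (h2 : 0 ≤ s.im) (h3 : s.im ≤ 4) : riemannZeta s ≠ 0 := by
  intro hz
  have hs : s ≠ 1 := by rintro rfl; simp at h1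
  have h := norm_riemannZeta_sub_le_one (by linarith) h2 hs
  have hs1 : 0 < ‖s - 1‖ := norm_pos_iff.2 (sub_ne_zero.2 hs)
  have hpos : ∀ a : ℝ, 0 ≤ a → 0 < ‖s + a‖ := fun a ha => norm_pos_iff.2 fun hc => by
    have := congrArg re hc
    simp at this
    linarith
  have hs2 := hpos 2 (by norm_num)
  have hs3 := hpos 3 (by norm_num)
  push_cast at hs2 hs3
  rw [hz, zero_sub, norm_neg, norm_div, norm_mul, norm_mul, norm_mul, norm_mul, norm_mul,
    norm_ofNat, div_le_div_iff₀ (by positivity) (by positivity)] at h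
  have h4 : 32 * (s.re + 3) ≤ ‖s‖ * ‖s + 1‖ * ‖s - 1‖ := by
    have h5 : 0 < ‖s + 2‖ * ‖s + 3‖ := by positivity
    refine le_of_mul_le_mul_left ?_ h5
    linarith
  have hsq : ‖s‖ ^ 2 * ‖s + 1‖ ^ 2 * ‖s - 1‖ ^ 2 ≤ 17 * 20 * (65 / 4) := by
    have e1 : ‖s‖ ^ 2 ≤ 17 := by
      rw [← normSq_eq_norm_sq, normSq_apply]; nlinarith
    have e2 : ‖s + 1‖ ^ 2 ≤ 20 := by
      rw [← normSq_eq_norm_sq, normSq_apply]; simp; nlinarith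
    have e3 : ‖s - 1‖ ^ 2 ≤ 65 / 4 := by
      rw [← normSq_eq_norm_sq, normSq_apply]; simp; nlinarith
    gcongr
  have h5 : (32 * (7 / 2) : ℝ) ^ 2 ≤ (‖s‖ * ‖s + 1‖ * ‖s - 1‖) ^ 2 :=
    pow_le_pow_left₀ (by norm_num) (by linarith) 2
  nlinarith

end

section

open Complex

/-- A disk in the complex plane; centre and radius are in units of `2 ^ (-64)`. -/
structure CBall where
  re : ℤ
  im : ℤ
  rad : ℕ

namespace CBall

/-- The inverse of the unit. -/
def scale : ℕ := 18446744073709551616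

def center (x : CBall) : ℂ := x.re + x.im * I

/-- The number `z` lies in the disk `x`. -/
def Has (x : CBall) (z : ℂ) : Prop := ‖scale * z - x.center‖ ≤ x.rad

def absCenter (x : CBall) : ℕ := x.re.natAbs + x.im.natAbs

def mul (x y : CBall) : CBall :=
  ⟨(x.re * y.re - x.im * y.im) / scale, (x.re * y.im + x.im * y.re) / scale,
    (x.absCenter * y.rad + (y.absCenter + y.rad) * x.rad) / scale + 3⟩

def divNat (x : CBall) (d : ℕ) : CBall := ⟨x.re / d, x.im / d, x.rad / d + 3⟩

def addOne (x : CBall) : CBall := ⟨x.re + scale, x.im, x.rad⟩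

/-- `1 + w / k + w ^ 2 / (k * (k + 1)) + ⋯` with `n` terms after the first. -/
def taylor (w : CBall) : ℕ → ℕ → CBall
  | _, 0 => ⟨scale, 0, 0⟩
  | k, n + 1 => ((w.mul (taylor w (k + 1) n)).divNat k).addOne

def iterSq (w : CBall) : ℕ → CBall
  | 0 => w
  | n + 1 => (w.mul w).iterSq n

def expSmall (w : CBall) : CBall :=
  let e := taylor w 1 9
  ⟨e.re, e.im, e.rad + 6000⟩

def isSmall (w : CBall) : Bool := (w.absCenter + w.rad) * 8 ≤ scale

theorem scale_pos : (0 : ℝ) < scale := by norm_num [scale]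

theorem norm_center_le (x : CBall) : ‖x.center‖ ≤ x.absCenter := by
  unfold center absCenter
  refine (norm_add_le _ _).trans ?_
  rw [norm_mul, norm_I, mul_one, norm_intCast, norm_intCast]
  push_cast [Nat.cast_natAbs]
  rfl

theorem natCast_div_le (x y : ℕ) : (x : ℝ) / y ≤ (x / y : ℕ) + 1 := by
  rw [← Nat.floor_div_eq_div (K := ℝ)]
  exact (Nat.lt_floor_add_one _).le

theorem abs_sub_intDiv_le (a : ℤ) (d : ℕ) :
    |(a : ℝ) / d - ((a / (d : ℤ) : ℤ) : ℝ)| ≤ 1 := by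
  rcases Nat.eq_zero_or_pos d with rfl | hd
  · simp
  have hd' : (0 : ℝ) < d := by exact_mod_cast hd
  have h1 : (((a / (d : ℤ) : ℤ) : ℝ)) * d ≤ a := by
    exact_mod_cast Int.ediv_mul_le a (by exact_mod_cast hd.ne')
  have h2 : (a : ℝ) < (((a / (d : ℤ) : ℤ) : ℝ) + 1) * d := by
    exact_mod_cast Int.lt_ediv_add_one_mul_self a (by exact_mod_cast hd)
  rw [abs_le, le_sub_iff_add_le, sub_le_iff_le_add, le_div_iff₀ hd', div_le_iff₀ hd']
  constructor <;> linarith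

theorem norm_sub_intDiv_le (a b : ℤ) (d : ℕ) :
    ‖((a : ℂ) + b * I) / d - (((a / (d : ℤ) : ℤ) : ℂ) + ((b / (d : ℤ) : ℤ) : ℂ) * I)‖ ≤ 2 := by
  rw [show ((a : ℂ) + b * I) / d - (((a / (d : ℤ) : ℤ) : ℂ) + ((b / (d : ℤ) : ℤ) : ℂ) * I)
    = (((a : ℝ) / d - ((a / (d : ℤ) : ℤ) : ℝ) : ℝ) : ℂ)
      + (((b : ℝ) / d - ((b / (d : ℤ) : ℤ) : ℝ) : ℝ) : ℂ) * I by push_cast; ring]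
  refine (norm_add_le _ _).trans ?_
  rw [norm_mul, norm_I, mul_one, norm_real, norm_real, Real.norm_eq_abs, Real.norm_eq_abs]
  linarith [abs_sub_intDiv_le a d, abs_sub_intDiv_le b d]

theorem Has.mul {x y : CBall} {z w : ℂ} (hx : x.Has z) (hy : y.Has w) : (x.mul y).Has (z * w) := by
  have hS := scale_pos
  have hS' : (scale : ℂ) ≠ 0 := by exact_mod_cast hS.ne'
  unfold Has at *
  have hc := norm_sub_intDiv_le (x.re * y.re - x.im * y.im) (x.re * y.im + x.im * y.re) scale
  have hprod : x.center * y.center = ((x.re * y.re - x.im * y.im : ℤ) : ℂ)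
      + ((x.re * y.im + x.im * y.re : ℤ) : ℂ) * I := by
    unfold center
    push_cast
    linear_combination (x.im * y.im : ℂ) * I_sq
  rw [← hprod] at hc
  have h1 : ‖(scale * z) * (scale * w) - x.center * y.center‖ ≤
      x.absCenter * y.rad + (y.absCenter + y.rad) * x.rad := by
    rw [show (scale * z) * (scale * w) - x.center * y.center =
      x.center * (scale * w - y.center) + (scale * z - x.center) * (scale * w) by ring]
    have h2 : ‖(scale : ℂ) * w‖ ≤ y.absCenter + y.rad := by
      rw [show (scale : ℂ) * w = y.center + (scale * w - y.center) by ring]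
      exact (norm_add_le _ _).trans (add_le_add y.norm_center_le hy)
    refine (norm_add_le _ _).trans ?_
    rw [norm_mul, norm_mul, mul_comm ((y.absCenter : ℝ) + y.rad)]
    have := x.norm_center_le
    gcongr
  have h3 : ‖((scale * z) * (scale * w) - x.center * y.center) / scale‖ ≤
      ((x.absCenter * y.rad + (y.absCenter + y.rad) * x.rad) / scale : ℕ) + 1 := by
    refine le_trans ?_ (natCast_div_le _ _)
    rw [norm_div, norm_natCast]
    push_cast
    gcongr
  calc _ = ‖((scale * z) * (scale * w) - x.center * y.center) / scale
        + (x.center * y.center / scale - (x.mul y).center)‖ := by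
        congr 1
        field_simp
        ring
    _ ≤ _ := norm_add_le _ _
    _ ≤ (((x.absCenter * y.rad + (y.absCenter + y.rad) * x.rad) / scale : ℕ) + 1) + 2 :=
      add_le_add h3 hc
    _ = _ := by unfold CBall.mul; push_cast; ring

theorem Has.divNat {x : CBall} {z : ℂ} (hx : x.Has z) (d : ℕ) : (x.divNat d).Has (z / d) := by
  unfold Has at *
  have hc := norm_sub_intDiv_le x.re x.im d
  calc _ = ‖(scale * z - x.center) / d + (x.center / d - (x.divNat d).center)‖ := by
        congr 1
        ring
    _ ≤ _ := norm_add_le _ _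
    _ ≤ ((x.rad / d : ℕ) + 1) + 2 := by
      refine add_le_add ((le_trans ?_ (natCast_div_le _ _))) hc
      rw [norm_div, norm_natCast]
      gcongr
    _ = _ := by unfold CBall.divNat; push_cast; ring

theorem Has.addOne {x : CBall} {z : ℂ} (hx : x.Has z) : x.addOne.Has (1 + z) := by
  unfold Has at *
  rw [show scale * (1 + z) - x.addOne.center = scale * z - x.center by
    unfold CBall.addOne center
    push_cast
    ring]
  exact hx

theorem Has.add_rad {x : CBall} {z w : ℂ} (hx : x.Has z) {d : ℕ} (h : ‖scale * (w - z)‖ ≤ d) :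
    (⟨x.re, x.im, x.rad + d⟩ : CBall).Has w := by
  unfold Has at *
  calc _ = ‖(scale * z - x.center) + scale * (w - z)‖ := by
        unfold center
        ring_nf
    _ ≤ _ := (norm_add_le _ _).trans (add_le_add hx h)
    _ = _ := by push_cast; rfl

theorem has_of_eq {a b : ℤ} {z : ℂ} (h : scale * z = a + b * I) : (⟨a, b, 0⟩ : CBall).Has z := by
  unfold Has center
  simp [h]

/-- The exact value of `CBall.taylor`. -/
noncomputable def taylorSum (w : ℂ) : ℕ → ℕ → ℂ
  | _, 0 => 1
  | k, n + 1 => 1 + w * taylorSum w (k + 1) n / k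

theorem Has.taylor {x : CBall} {w : ℂ} (hx : x.Has w) (k n : ℕ) :
    (x.taylor k n).Has (taylorSum w k n) := by
  induction n generalizing k with
  | zero => exact has_of_eq (by simp [taylorSum])
  | succ n ih => exact ((hx.mul (ih (k + 1))).divNat k).addOne

theorem Has.norm_le {x : CBall} {z : ℂ} (hx : x.Has z) :
    scale * ‖z‖ ≤ x.absCenter + x.rad := by
  calc scale * ‖z‖ = ‖x.center + (scale * z - x.center)‖ := by
        rw [add_sub_cancel, norm_mul, norm_natCast]
    _ ≤ _ := (norm_add_le _ _).trans (add_le_add x.norm_center_le hx)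

theorem Has.expSmall {x : CBall} {w : ℂ} (hx : x.Has w) (h : x.isSmall) :
    x.expSmall.Has (exp w) := by
  have h1 : ‖w‖ ≤ 1 / 8 := by
    have h2 := hx.norm_le
    have h3 : (x.absCenter + x.rad) * 8 ≤ scale := by simpa [isSmall] using h
    have h4 : ((x.absCenter : ℝ) + x.rad) * 8 ≤ scale := by exact_mod_cast h3
    have := scale_pos
    have : scale * ‖w‖ ≤ scale * (1 / 8) := by linarith
    exact le_of_mul_le_mul_left this scale_pos
  have h2 := exp_bound (x := w) (by linarith) (n := 10) (by norm_num)
  have h3 : ∑ m ∈ Finset.range 10, w ^ m / (m.factorial : ℂ) = taylorSum w 1 9 := by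
    simp [Finset.sum_range_succ, taylorSum, Nat.factorial]
    ring
  rw [h3] at h2
  refine (hx.taylor 1 9).add_rad ?_
  rw [norm_mul, norm_natCast]
  have h4 : ‖w‖ ^ 10 ≤ (1 / 8) ^ 10 := pow_le_pow_left₀ (norm_nonneg _) h1 10
  have h5 : ‖exp w - taylorSum w 1 9‖ ≤ (1 / 8) ^ 10 * (11 / 36288000) := by
    refine h2.trans (mul_le_mul h4 ?_ (by positivity) (by positivity))
    norm_num [Nat.factorial]
  calc _ ≤ (scale : ℝ) * ((1 / 8) ^ 10 * (11 / 36288000)) := by gcongr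
    _ ≤ _ := by norm_num [scale]

theorem Has.iterSq {x : CBall} {w : ℂ} (n : ℕ) (hx : x.Has w) : (x.iterSq n).Has (w ^ 2 ^ n) := by
  induction n generalizing x w with
  | zero => simpa [CBall.iterSq] using hx
  | succ n ih =>
    have := ih (hx.mul hx)
    rwa [← pow_two, ← pow_mul, ← pow_succ'] at this

/-- An upper bound for the modulus, found by one Newton step for the square root. -/
def normBound (x : CBall) : ℕ :=
  let p := max x.re.natAbs x.im.natAbs
  let q := min x.re.natAbs x.im.natAbs
  let g := p + 3 * q / 8 + 1
  (g + (p * p + q * q) / g) / 2 + x.rad + 2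

theorem Has.norm_le_normBound {x : CBall} {z : ℂ} (hx : x.Has z) : scale * ‖z‖ ≤ x.normBound := by
  have h1 : scale * ‖z‖ ≤ ‖x.center‖ + x.rad := by
    calc scale * ‖z‖ = ‖x.center + (scale * z - x.center)‖ := by
          rw [add_sub_cancel, norm_mul, norm_natCast]
      _ ≤ _ := (norm_add_le _ _).trans (add_le_add le_rfl hx)
  refine h1.trans ?_
  unfold normBound
  simp only
  set p := max x.re.natAbs x.im.natAbs with hp
  set q := min x.re.natAbs x.im.natAbs with hq
  set g := p + 3 * q / 8 + 1 with hg
  have hsq : ‖x.center‖ ^ 2 = ((p * p + q * q : ℕ) : ℝ) := by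
    have : p * p + q * q = x.re.natAbs * x.re.natAbs + x.im.natAbs * x.im.natAbs := by
      rcases le_total x.re.natAbs x.im.natAbs with h | h
      · rw [hp, hq, max_eq_right h, min_eq_left h, add_comm]
      · rw [hp, hq, max_eq_left h, min_eq_right h]
    rw [this, ← normSq_eq_norm_sq, normSq_apply]
    unfold center
    push_cast [Nat.cast_natAbs]
    simp [← pow_two, sq_abs]
  have hg0 : (0 : ℝ) < g := by rw [hg]; positivity
  have h2 := natCast_div_le (p * p + q * q) g
  have h3 := natCast_div_le (g + (p * p + q * q) / g) 2
  rw [← hsq] at h2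
  have h4 : 2 * ‖x.center‖ ≤ g + ‖x.center‖ ^ 2 / g := by
    rw [← sub_nonneg]
    have : g + ‖x.center‖ ^ 2 / g - 2 * ‖x.center‖ = (g - ‖x.center‖) ^ 2 / g := by
      field_simp
      ring
    rw [this]
    positivity
  push_cast at h3 h2 ⊢
  linarith

end CBall

theorem norm_cpow_sub_le {n : ℕ} (hn : 0 < n) {s z : ℂ} {a c r : ℝ} (ha : ‖(n : ℂ) ^ (-s)‖ ≤ a)
    (hr : ‖z - s‖ ≤ r) (hc : Real.exp (r * Real.log n) - 1 ≤ c) :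
    ‖(n : ℂ) ^ (-z) - (n : ℂ) ^ (-s)‖ ≤ a * c := by
  have hn' : (n : ℂ) ≠ 0 := by exact_mod_cast hn.ne'
  have hlog : 0 ≤ Real.log n := Real.log_natCast_nonneg n
  have h1 : (n : ℂ) ^ (-z) = (n : ℂ) ^ (-s) * exp (-(z - s) * Real.log n) := by
    rw [show -z = -s + -(z - s) by ring, cpow_add _ _ hn', ofReal_log (Nat.cast_nonneg n),
      ofReal_natCast, cpow_def_of_ne_zero hn' (-(z - s)), mul_comm (log _)]
  have h2 : ‖exp (-(z - s) * Real.log n) - 1‖ ≤ c := by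
    have h3 : ‖-(z - s) * Real.log n‖ ≤ r * Real.log n := by
      rw [norm_mul, norm_neg, norm_real, Real.norm_of_nonneg hlog]
      gcongr
    have h4 := norm_exp_sub_sum_le_exp_norm_sub_sum (-(z - s) * Real.log n) 1
    simp only [Finset.range_one, Finset.sum_singleton, pow_zero, Nat.factorial_zero,
      Nat.cast_one, div_one] at h4
    linarith [Real.exp_le_exp.2 h3]
  rw [h1, show ∀ u v : ℂ, u * v - u = u * (v - 1) by intros; ring, norm_mul]
  gcongr
  exact (norm_nonneg _).trans ha

theorem exp_sub_one_le {x u : ℝ} (hx : x ≤ u) (h0 : 0 ≤ u) (h1 : u ≤ 1) :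
    Real.exp x - 1 ≤ u + u ^ 2 / 2 + u ^ 3 / 4 := by
  have h := Real.exp_bound' h0 h1 (n := 3) (by norm_num)
  norm_num [Finset.sum_range_succ, Nat.factorial] at h
  have := Real.exp_le_exp.2 hx
  have := pow_nonneg h0 3
  linarith

/-- The correction factor of the last term in the Euler-Maclaurin formula. -/
noncomputable def emFactor (N : ℕ) (s : ℂ) : ℂ := 1 / 2 + N / (s - 1) + s / 12 / N

theorem norm_emFactor_sub_le {N : ℕ} {s z : ℂ} {r : ℝ} (hr : ‖z - s‖ ≤ r)
    (h : r < s.im) : ‖emFactor N z - emFactor N s‖ ≤ r * (N / (s.im - r) ^ 2 + 1 / 12 / N) := by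
  have hr0 : 0 ≤ r := (norm_nonneg _).trans hr
  have him : ∀ w : ℂ, s.im - r ≤ w.im → s.im - r ≤ ‖w - 1‖ := fun w hw => by
    have := (le_abs_self _).trans (abs_im_le_norm (w - 1))
    simp at this
    linarith
  have hz : s.im - r ≤ z.im := by
    have := (neg_le_abs _).trans ((abs_im_le_norm (z - s)).trans hr)
    simp at this
    linarith
  have h1 := him s (by linarith)
  have h2 := him z hz
  have h3 : 0 < s.im - r := by linarith
  have hs1 : s - 1 ≠ 0 := norm_pos_iff.1 (h3.trans_le h1)
  have hz1 : z - 1 ≠ 0 := norm_pos_iff.1 (h3.trans_le h2)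
  have : emFactor N z - emFactor N s =
      (z - s) * (-(N / ((s - 1) * (z - 1))) + 1 / 12 / N) := by
    unfold emFactor
    rw [show ((N : ℂ)) / ((s - 1) * (z - 1)) = N * ((s - 1)⁻¹ * (z - 1)⁻¹) by
      rw [div_eq_mul_inv, mul_inv]]
    have e : (z - s) * ((s - 1)⁻¹ * (z - 1)⁻¹) = (s - 1)⁻¹ - (z - 1)⁻¹ := by
      field_simp
      ring
    linear_combination (N : ℂ) * e
  rw [this, norm_mul]
  refine mul_le_mul hr ((norm_add_le _ _).trans ?_) (norm_nonneg _) hr0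
  rw [norm_neg, norm_div, norm_mul, Complex.norm_natCast, norm_div, norm_div,
    Complex.norm_natCast, norm_one,
    norm_ofNat, pow_two]
  gcongr

theorem norm_mul_add_le {s z : ℂ} {r : ℝ} (hr : ‖z - s‖ ≤ r) (h0 : 0 ≤ z.re) (h1 : 0 ≤ z.im) :
    ‖z * (z + 1) * (z + 2) * (z + 3)‖ ≤
      ((s.re + r) ^ 2 + 3 * (s.re + r) + 7 / 2 + (s.im + r) ^ 2) ^ 2 := by
  have hre : z.re ≤ s.re + r := by
    have := (le_abs_self _).trans ((abs_re_le_norm (z - s)).trans hr)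
    simp at this
    linarith
  have him : z.im ≤ s.im + r := by
    have := (le_abs_self _).trans ((abs_im_le_norm (z - s)).trans hr)
    simp at this
    linarith
  have e : ∀ k : ℝ, ‖z + k‖ ^ 2 = (z.re + k) ^ 2 + z.im ^ 2 := fun k => by
    rw [← normSq_eq_norm_sq, normSq_apply]
    simp
    ring
  have e0 := e 0
  have e1 := e 1
  have e2 := e 2
  have e3 := e 3
  push_cast at e0 e1 e2 e3
  rw [add_zero] at e0
  have hm : (‖z‖ ^ 2 + ‖z + 1‖ ^ 2 + ‖z + 2‖ ^ 2 + ‖z + 3‖ ^ 2) / 4 ≤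
      (s.re + r) ^ 2 + 3 * (s.re + r) + 7 / 2 + (s.im + r) ^ 2 := by
    rw [e0, e1, e2, e3]
    nlinarith
  rw [norm_mul, norm_mul, norm_mul]
  refine le_trans ?_ (pow_le_pow_left₀ (by positivity) hm 2)
  have a1 := two_mul_le_add_sq ‖z‖ ‖z + 1‖
  have a2 := two_mul_le_add_sq ‖z + 2‖ ‖z + 3‖
  have b1 : ‖z‖ * ‖z + 1‖ * ‖z + 2‖ * ‖z + 3‖ ≤
      ((‖z‖ ^ 2 + ‖z + 1‖ ^ 2) / 2) * ((‖z + 2‖ ^ 2 + ‖z + 3‖ ^ 2) / 2) := by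
    rw [mul_assoc (‖z‖ * ‖z + 1‖)]
    gcongr
    · linarith
    · linarith
  refine b1.trans ?_
  nlinarith [sq_nonneg ((‖z‖ ^ 2 + ‖z + 1‖ ^ 2) - (‖z + 2‖ ^ 2 + ‖z + 3‖ ^ 2))]

/-- A lower bound for the real part of zeta on a disk, from data at its centre. -/
theorem re_riemannZeta_ge_of_disk {N : ℕ} (hN : 0 < N) {s z : ℂ} {r d p : ℝ} {a c : ℕ → ℝ}
    (hr : ‖z - s‖ ≤ r) (hs : 1 / 2 + r ≤ s.re) (ht : r < s.im)
    (ha : ∀ n ∈ Finset.Icc 1 N, ‖(n : ℂ) ^ (-s)‖ ≤ a n)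
    (hc : ∀ n ∈ Finset.Icc 1 N, Real.exp (r * Real.log n) - 1 ≤ c n)
    (hp : ‖emFactor N s‖ ≤ p) (hd : r * (N / (s.im - r) ^ 2 + 1 / 12 / N) ≤ d) :
    (∑ n ∈ Finset.Ico 1 N, (((n : ℂ) ^ (-s)).re - a n * c n)) + ((N : ℂ) ^ (-s) * emFactor N s).re
      - (a N * c N * (p + d) + a N * d)
      - ((s.re + r) ^ 2 + 3 * (s.re + r) + 7 / 2 + (s.im + r) ^ 2) ^ 2 / 1344
        * ((a N + a N * c N) / N ^ 3) ≤ (riemannZeta z).re := by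
  have hr0 : 0 ≤ r := (norm_nonneg _).trans hr
  have hN' : (0 : ℝ) < N := by exact_mod_cast hN
  have hzre : 1 / 2 ≤ z.re := by
    have := (neg_le_abs _).trans ((abs_re_le_norm (z - s)).trans hr)
    simp at this
    linarith
  have hzim : 0 < z.im := by
    have := (neg_le_abs _).trans ((abs_im_le_norm (z - s)).trans hr)
    simp at this
    linarith
  have hdiff : ∀ n ∈ Finset.Icc 1 N, ‖(n : ℂ) ^ (-z) - (n : ℂ) ^ (-s)‖ ≤ a n * c n := fun n hn =>
    norm_cpow_sub_le (Finset.mem_Icc.1 hn).1 (ha n hn) hr (hc n hn)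
  have hNmem : N ∈ Finset.Icc 1 N := Finset.mem_Icc.2 ⟨hN, le_rfl⟩
  have haN : 0 ≤ a N := (norm_nonneg _).trans (ha N hNmem)
  have hcN : 0 ≤ c N := by
    have := hc N hNmem
    have : 1 ≤ Real.exp (r * Real.log N) :=
      Real.one_le_exp (mul_nonneg hr0 (Real.log_natCast_nonneg N))
    linarith
  have hmain := norm_riemannZeta_sub_le (s := z) (by linarith) hzim hN
  have h1 : ∑ n ∈ Finset.Ico 1 N, (((n : ℂ) ^ (-s)).re - a n * c n) ≤
      (∑ n ∈ Finset.Ico 1 N, (n : ℂ) ^ (-z)).re := by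
    rw [re_sum]
    refine Finset.sum_le_sum fun n hn => ?_
    have h := (neg_le_abs _).trans ((abs_re_le_norm _).trans
      (hdiff n (Finset.mem_Icc.2 ⟨(Finset.mem_Ico.1 hn).1, (Finset.mem_Ico.1 hn).2.le⟩)))
    simp at h
    linarith
  have hfac := (norm_emFactor_sub_le (N := N) hr ht).trans hd
  have h2 : ‖(N : ℂ) ^ (-z) * emFactor N z - (N : ℂ) ^ (-s) * emFactor N s‖ ≤
      a N * c N * (p + d) + a N * d := by
    rw [show (N : ℂ) ^ (-z) * emFactor N z - (N : ℂ) ^ (-s) * emFactor N s =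
      ((N : ℂ) ^ (-z) - (N : ℂ) ^ (-s)) * emFactor N z
        + (N : ℂ) ^ (-s) * (emFactor N z - emFactor N s) by ring]
    have h3 : ‖emFactor N z‖ ≤ p + d := by
      rw [show emFactor N z = emFactor N s + (emFactor N z - emFactor N s) by ring]
      exact (norm_add_le _ _).trans (add_le_add hp hfac)
    refine (norm_add_le _ _).trans ?_
    rw [norm_mul, norm_mul]
    have := hdiff N hNmem
    have := ha N hNmem
    gcongr
  have h3 : ‖z * (z + 1) * (z + 2) * (z + 3)‖ / (384 * (z.re + 3)) * (N : ℝ) ^ (-z.re - 3) ≤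
      ((s.re + r) ^ 2 + 3 * (s.re + r) + 7 / 2 + (s.im + r) ^ 2) ^ 2 / 1344
        * ((a N + a N * c N) / N ^ 3) := by
    have h4 : (N : ℝ) ^ (-z.re - 3) ≤ (a N + a N * c N) / N ^ 3 := by
      rw [Real.rpow_sub hN', show (N : ℝ) ^ (3 : ℝ) = (N : ℝ) ^ 3 by
        exact_mod_cast Real.rpow_natCast (N : ℝ) 3, ← neg_re, ← norm_natCast_cpow_of_pos hN]
      gcongr
      rw [show (N : ℂ) ^ (-z) = (N : ℂ) ^ (-s) + ((N : ℂ) ^ (-z) - (N : ℂ) ^ (-s)) by ring]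
      exact (norm_add_le _ _).trans (add_le_add (ha N hNmem) (hdiff N hNmem))
    have h5 := norm_mul_add_le hr (by linarith) hzim.le
    have h6 : 1344 ≤ 384 * (z.re + 3) := by linarith
    gcongr
  have h4 := (neg_le_abs _).trans ((abs_re_le_norm _).trans hmain)
  have h5 := (neg_le_abs _).trans ((abs_re_le_norm _).trans h2)
  unfold emFactor at *
  simp only [sub_re, add_re] at h4 h5
  linarith

namespace CBall

/-- The indices of the powers in the tables below. -/
def tableIndex : List ℕ := [20, 2, 3, 4, 5, 6, 7, 8, 9, 10, 11, 12, 13, 14, 15, 16, 17, 18, 19]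

/-- The table of a completely multiplicative function, from its values at the primes. -/
def fromPrimes {α : Type*} (op : α → α → α) (p2 p3 p5 p7 p11 p13 p17 p19 : α) : List α :=
  let p4 := op p2 p2
  let p8 := op p2 p4
  let p9 := op p3 p3
  [op p4 p5, p2, p3, p4, p5, op p2 p3, p7, p8, p9, op p2 p5, p11, op p3 p4, p13, op p2 p7,
    op p3 p5, op p2 p8, p17, op p2 p9, p19]

theorem forall₂_fromPrimes {α : Type*} {op : α → α → α} {P : ℕ → α → Prop}
    (hP : ∀ m n x y, 0 < m → 0 < n → P m x → P n y → P (m * n) (op x y))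
    {p2 p3 p5 p7 p11 p13 p17 p19 : α} (h2 : P 2 p2) (h3 : P 3 p3) (h5 : P 5 p5) (h7 : P 7 p7)
    (h11 : P 11 p11) (h13 : P 13 p13) (h17 : P 17 p17) (h19 : P 19 p19) :
    List.Forall₂ P tableIndex (fromPrimes op p2 p3 p5 p7 p11 p13 p17 p19) := by
  have hP' : ∀ {m n k x y}, P m x → P n y → 0 < m → 0 < n → m * n = k → P k (op x y) :=
    fun hx hy hm hn h => h ▸ hP _ _ _ _ hm hn hx hy
  have h4 := hP' h2 h2 two_pos two_pos rfl
  have h8 := hP' h2 h4 two_pos (by norm_num) rfl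
  have h9 := hP' h3 h3 (by norm_num) (by norm_num) rfl
  unfold tableIndex fromPrimes
  simp only [List.forall₂_cons, List.forall₂_nil_left_iff, and_true]
  exact ⟨hP' h4 h5 (by norm_num) (by norm_num) rfl, h2, h3, h4, h5,
    hP' h2 h3 (by norm_num) (by norm_num) rfl, h7, h8, h9,
    hP' h2 h5 (by norm_num) (by norm_num) rfl, h11, hP' h3 h4 (by norm_num) (by norm_num) rfl, h13,
    hP' h2 h7 (by norm_num) (by norm_num) rfl, hP' h3 h5 (by norm_num) (by norm_num) rfl,
    hP' h2 h8 (by norm_num) (by norm_num) rfl, h17, hP' h2 h9 (by norm_num) (by norm_num) rfl, h19⟩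

/-- The table `zs` contains the values of `n ^ (-s)`. -/
def PowTable (s : ℂ) (ns : List ℕ) (zs : List CBall) : Prop :=
  List.Forall₂ (fun n x => 0 < n ∧ x.Has ((n : ℂ) ^ (-s))) ns zs

theorem PowTable.zipWith {s w : ℂ} {ns : List ℕ} {zs ms : List CBall} (h : PowTable s ns zs)
    (hm : PowTable w ns ms) : PowTable (s + w) ns (List.zipWith mul zs ms) := by
  induction h generalizing ms with
  | nil => cases hm; exact .nil
  | @cons n x ns zs hx _ ih =>
    cases hm with
    | @cons _ y _ ms hy hm =>
      refine .cons ⟨hx.1, ?_⟩ (ih hm)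
      have hn : (n : ℂ) ≠ 0 := by exact_mod_cast hx.1.ne'
      rw [neg_add, cpow_add _ _ hn]
      exact hx.2.mul hy.2

/-- The table `cs` contains upper bounds for `n ^ r - 1`. -/
def GrowthTable (r : ℝ) (ns cs : List ℕ) : Prop :=
  List.Forall₂ (fun n c : ℕ => 0 < n ∧ scale * (Real.exp (r * Real.log n) - 1) ≤ c) ns cs

def mulUp (x y : ℕ) : ℕ := x * y / scale + 1

theorem le_mulUp {x y : ℝ} {a b : ℕ} (hx : scale * x ≤ a) (hy : scale * y ≤ b) (hy0 : 0 ≤ y) :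
    scale * (x * y) ≤ mulUp a b := by
  have hS := scale_pos
  have h := natCast_div_le (a * b) scale
  have h1 : (scale * x) * (scale * y) ≤ a * b :=
    mul_le_mul hx hy (by positivity) (Nat.cast_nonneg a)
  have h2 : scale * (x * y) ≤ ((a * b : ℕ) : ℝ) / scale := by
    rw [le_div_iff₀ hS]
    push_cast
    linarith
  unfold mulUp
  push_cast at *
  linarith

def lowerSum : List CBall → List ℕ → ℤ
  | z :: zs, c :: cs => z.re - z.rad - mulUp z.normBound c + lowerSum zs cs
  | _, _ => 0

theorem Has.re_ge {x : CBall} {z : ℂ} (h : x.Has z) : (x.re : ℝ) - x.rad ≤ scale * z.re := by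
  have := (neg_le_abs _).trans ((abs_re_le_norm _).trans h)
  simp [center] at this
  linarith

theorem lowerSum_le {s : ℂ} {r : ℝ} (hr : 0 ≤ r) {ns cs : List ℕ} {zs : List CBall}
    (hz : PowTable s ns zs) (hc : GrowthTable r ns cs) :
    (lowerSum zs cs : ℝ) ≤ scale * (ns.map fun n : ℕ => ((n : ℂ) ^ (-s)).re
      - ‖(n : ℂ) ^ (-s)‖ * (Real.exp (r * Real.log n) - 1)).sum := by
  induction hz generalizing cs with
  | nil => simp [lowerSum]
  | @cons n x ns zs hx _ ih =>
    cases hc with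
    | @cons _ c _ cs hc1 hc =>
      have h1 := hx.2.re_ge
      have h2 := le_mulUp hx.2.norm_le_normBound hc1.2 (by
        have := Real.one_le_exp (mul_nonneg hr (Real.log_natCast_nonneg n))
        linarith)
      have h3 := ih hc
      rw [List.map_cons, List.sum_cons, lowerSum]
      push_cast
      linarith

def factorBall (a b : ℕ) : CBall :=
  let q := ((a : ℤ) - 512).natAbs ^ 2 + b ^ 2
  ⟨9223372036854775808 + 10240 * scale * ((a : ℤ) - 512) / q + (a * scale / 122880 : ℕ),
    (b * scale / 122880 : ℕ) - ((10240 * scale * b / q : ℕ) : ℤ), 4⟩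

theorem has_factorBall {a b : ℕ} (hb : 0 < b) :
    (factorBall a b).Has (emFactor 20 ((a + b * I) / 512)) := by
  set q := ((a : ℤ) - 512).natAbs ^ 2 + b ^ 2 with hq
  have hq0 : 0 < q := by positivity
  have hq1 : (q : ℝ) = (a - 512) ^ 2 + b ^ 2 := by
    rw [hq]
    push_cast [Nat.cast_natAbs]
    rw [sq_abs]
  have hq2 : (0 : ℝ) < q := by exact_mod_cast hq0
  have key : emFactor 20 ((a + b * I) / 512) =
      ((1 / 2 + 10240 * (a - 512) / q + a / 122880 : ℝ) : ℂ)
        + ((b / 122880 - 10240 * b / q : ℝ) : ℂ) * I := by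
    have hqc : (q : ℂ) = (a - 512 + b * I) * (a - 512 - b * I) := by
      have : (q : ℂ) = ((a - 512 : ℂ)) ^ 2 + b ^ 2 := by exact_mod_cast congrArg ofReal hq1
      rw [this]
      linear_combination (b : ℂ) ^ 2 * I_sq
    have hqc0 : (q : ℂ) ≠ 0 := by exact_mod_cast hq0.ne'
    have h1 : (a - 512 + b * I : ℂ) ≠ 0 := left_ne_zero_of_mul (hqc ▸ hqc0)
    have h2 : 20 / ((a + b * I : ℂ) / 512 - 1) = 10240 * (a - 512 - b * I) / q := by
      rw [div_eq_div_iff (by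
        intro h
        apply h1
        linear_combination 512 * h) hqc0, hqc]
      ring
    unfold emFactor
    push_cast
    rw [h2]
    ring
  rw [key]
  have e1 := abs_sub_intDiv_le (10240 * scale * ((a : ℤ) - 512)) q
  have e2 := abs_sub_intDiv_le ((a * scale : ℕ) : ℤ) 122880
  have e3 := abs_sub_intDiv_le ((b * scale : ℕ) : ℤ) 122880
  have e4 := abs_sub_intDiv_le ((10240 * scale * b : ℕ) : ℤ) q
  unfold Has
  have hre : ∀ x y : ℝ, ‖((x : ℂ) + y * I)‖ ≤ |x| + |y| := fun x y =>
    (norm_add_le _ _).trans (by simp)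
  set d1 : ℤ := 10240 * scale * ((a : ℤ) - 512) / q
  set d2 : ℤ := ((a * scale : ℕ) : ℤ) / (122880 : ℕ)
  set d3 : ℤ := ((b * scale : ℕ) : ℤ) / (122880 : ℕ)
  set d4 : ℤ := ((10240 * scale * b : ℕ) : ℤ) / q
  have hc : (factorBall a b).center =
      ((9223372036854775808 + d1 + d2 : ℝ) : ℂ) + ((d3 - d4 : ℝ) : ℂ) * I := by
    simp only [center, factorBall, d1, d2, d3, d4, ← hq]
    push_cast
    rfl
  rw [hc, show ∀ u v x y k : ℂ, k * (u + v * I) - (x + y * I) = (k * u - x) + (k * v - y) * I by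
    intros; ring]
  rw [← ofReal_natCast, ← ofReal_mul, ← ofReal_mul, ← ofReal_sub, ← ofReal_sub]
  refine (hre _ _).trans ?_
  have hs : (scale : ℝ) / 2 = 9223372036854775808 := by norm_num [scale]
  have f1 : |scale * (1 / 2 + 10240 * ((a : ℝ) - 512) / q + a / 122880) -
      (9223372036854775808 + d1 + d2)| ≤ 2 := by
    rw [show scale * (1 / 2 + 10240 * ((a : ℝ) - 512) / q + a / 122880) -
      (9223372036854775808 + d1 + d2) = (10240 * scale * ((a : ℝ) - 512) / q - d1)
        + (a * scale / 122880 - d2) by rw [← hs]; ring]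
    refine (abs_add_le _ _).trans ?_
    push_cast at e1 e2
    linarith
  have f2 : |scale * ((b : ℝ) / 122880 - 10240 * b / q) - (d3 - d4)| ≤ 2 := by
    rw [show scale * ((b : ℝ) / 122880 - 10240 * b / q) - (d3 - d4) =
      (b * scale / 122880 - d3) - (10240 * scale * b / q - d4) by ring]
    refine (abs_sub _ _).trans ?_
    push_cast at e3 e4
    linarith
  calc _ ≤ (2 : ℝ) + 2 := add_le_add f1 f2
    _ = _ := by norm_num [factorBall]

end CBall

namespace CBall

/-- A sufficient condition for `ζ` to have positive real part in the disk with centre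
`(a + b * I) / 512` and radius `ρ / 512`. -/
def diskCheck : List CBall → List ℕ → ℕ → ℕ → ℕ → Bool
  | z :: zs, c :: cs, a, b, ρ =>
    let L := z.mul (factorBall a b)
    let A := z.normBound
    let C := mulUp A c
    let P := (factorBall a b).absCenter + (factorBall a b).rad
    let d := ρ * 10240 * scale / (b - ρ) ^ 2 + ρ * scale / 122880 + 2
    let M := (a + ρ) ^ 2 + 1536 * (a + ρ) + 917504 + (b + ρ) ^ 2
    let R := M ^ 2 * (A + C) / 738871813865472000 + 1
    256 + ρ ≤ a && ρ < b &&
      (mulUp C (P + d) + mulUp A d + R : ℕ) < scale + lowerSum zs cs + (L.re - L.rad)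
  | _, _, _, _, _ => false

theorem re_riemannZeta_pos_of_diskCheck {zs : List CBall} {cs : List ℕ} {a b ρ : ℕ} {z : ℂ}
    (hz : PowTable ((a + b * I) / 512) tableIndex zs) (hc : GrowthTable (ρ / 512) tableIndex cs)
    (h : diskCheck zs cs a b ρ) (hzs : ‖z - (a + b * I) / 512‖ ≤ ρ / 512) :
    0 < (riemannZeta z).re := by
  set s : ℂ := (a + b * I) / 512 with hs
  set r : ℝ := ρ / 512 with hr
  have hsre : s.re = a / 512 := by
    rw [hs, show (512 : ℂ) = ((512 : ℝ) : ℂ) by norm_num, div_ofReal_re]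
    simp
  have hsim : s.im = b / 512 := by
    rw [hs, show (512 : ℂ) = ((512 : ℝ) : ℂ) by norm_num, div_ofReal_im]
    simp
  have hr0 : 0 ≤ r := by positivity
  have hS := scale_pos
  unfold tableIndex at hz hc
  cases hz with
  | @cons _ w _ zs hw hz =>
  cases hc with
  | @cons _ c _ cs hcw hc =>
  set φ := factorBall a b with hφ
  simp only [diskCheck, ← hφ, Bool.and_eq_true, decide_eq_true_eq] at h
  obtain ⟨⟨ha, hb⟩, h⟩ := h
  set A := w.normBound with hA
  set C := mulUp A c with hC
  set d := ρ * 10240 * scale / (b - ρ) ^ 2 + ρ * scale / 122880 + 2 with hd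
  set P := φ.absCenter + φ.rad with hP
  set M := (a + ρ) ^ 2 + 1536 * (a + ρ) + 917504 + (b + ρ) ^ 2 with hM
  set f : ℕ → ℝ := fun n => ((n : ℂ) ^ (-s)).re
      - ‖(n : ℂ) ^ (-s)‖ * (Real.exp (r * Real.log n) - 1) with hf
  have hfac : φ.Has (emFactor 20 s) := has_factorBall (by lia)
  have hsum := lowerSum_le hr0 hz hc
  have hL := (hw.2.mul hfac).re_ge
  have hA' := hw.2.norm_le_normBound
  have hc0 : 0 ≤ Real.exp (r * Real.log (20 : ℕ)) - 1 := by
    have := Real.one_le_exp (mul_nonneg hr0 (Real.log_natCast_nonneg 20))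
    linarith
  have hC' := le_mulUp hA' hcw.2 hc0
  rw [← hC] at hC'
  have hP' : scale * ‖emFactor 20 s‖ ≤ P := by
    have := hfac.norm_le
    push_cast [hP]
    exact this
  have hbρ : (ρ : ℝ) < b := by exact_mod_cast hb
  have hd' : scale * (r * ((20 : ℕ) / (s.im - r) ^ 2 + 1 / 12 / (20 : ℕ))) ≤ d := by
    have h1 := natCast_div_le (ρ * 10240 * scale) ((b - ρ) ^ 2)
    have h2 := natCast_div_le (ρ * scale) 122880
    push_cast [Nat.cast_sub hb.le] at h1 h2
    have : (scale : ℝ) * (r * ((20 : ℕ) / (s.im - r) ^ 2 + 1 / 12 / (20 : ℕ))) =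
        ρ * 10240 * scale / (b - ρ) ^ 2 + ρ * scale / 122880 := by
      rw [hsim, hr]
      have : (b : ℝ) - ρ ≠ 0 := by linarith
      field_simp
      push_cast
      ring
    rw [this]
    push_cast [hd]
    linarith
  have hd0 : 0 ≤ r * ((20 : ℕ) / (s.im - r) ^ 2 + 1 / 12 / (20 : ℕ)) := by positivity
  set dr : ℝ := r * ((20 : ℕ) / (s.im - r) ^ 2 + 1 / 12 / (20 : ℕ)) with hdr
  set cr : ℝ := Real.exp (r * Real.log (20 : ℕ)) - 1 with hcr
  set ar : ℝ := ‖((20 : ℕ) : ℂ) ^ (-s)‖ with har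
  set pr : ℝ := ‖emFactor 20 s‖ with hpr
  have hpd : scale * (pr + dr) ≤ (P + d : ℕ) := by
    push_cast
    linarith
  have hCP := le_mulUp hC' hpd (by positivity)
  have hAd := le_mulUp hA' hd' hd0
  have hR : scale * (((s.re + r) ^ 2 + 3 * (s.re + r) + 7 / 2 + (s.im + r) ^ 2) ^ 2 / 1344
      * ((ar + ar * cr) / (20 : ℕ) ^ 3)) ≤ (M ^ 2 * (A + C) / 738871813865472000 + 1 : ℕ) := by
    have h1 := natCast_div_le (M ^ 2 * (A + C)) 738871813865472000
    have h2 : (s.re + r) ^ 2 + 3 * (s.re + r) + 7 / 2 + (s.im + r) ^ 2 = M / 262144 := by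
      rw [hsre, hsim, hr]
      push_cast [hM]
      ring
    rw [h2]
    have h3 : scale * (ar + ar * cr) ≤ A + C := by linarith
    have h4 : ((M : ℝ) ^ 2 * (scale * (ar + ar * cr))) ≤ M ^ 2 * (A + C) := by gcongr
    push_cast at h1 ⊢
    refine le_trans ?_ h1
    rw [le_div_iff₀ (by norm_num)]
    refine le_trans (le_of_eq ?_) h4
    ring
  have key := re_riemannZeta_ge_of_disk (N := 20) (by norm_num) (s := s) (z := z) (r := r) (d := dr)
    (p := pr) (a := fun n => ‖(n : ℂ) ^ (-s)‖) (c := fun n => Real.exp (r * Real.log n) - 1)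
    hzs (by rw [hsre, hr]; have : (256 + ρ : ℝ) ≤ a := (by exact_mod_cast ha); linarith)
    (by rw [hsim, hr]; linarith) (fun _ _ => le_rfl) (fun _ _ => le_rfl) le_rfl le_rfl
  have hsum' : ∑ n ∈ Finset.Ico 1 20, f n = 1 +
      ([2, 3, 4, 5, 6, 7, 8, 9, 10, 11, 12, 13, 14, 15, 16, 17, 18, 19].map f).sum := by
    rw [Finset.sum_eq_sum_Ico_succ_bot (by norm_num)]
    congr 1
    simp [hf]
  rw [hsum'] at key
  refine lt_of_lt_of_le ?_ key
  have h' : (mulUp C (P + d) : ℝ) + mulUp A d + (M ^ 2 * (A + C) / 738871813865472000 + 1 : ℕ) <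
      scale + lowerSum zs cs + ((w.mul φ).re - (w.mul φ).rad) := by
    have := Int.cast_lt (R := ℝ).2 h
    push_cast at this ⊢
    exact this
  refine pos_of_mul_pos_right (a := (scale : ℝ)) ?_ hS.le
  have e := hL
  rw [← har, ← hcr]
  clear_value dr cr ar pr M d C
  rw [mul_sub, mul_sub, mul_add, mul_add, mul_add]
  push_cast at *
  linarith

end CBall

namespace CBall

/-- An upper bound for `exp (ρ * u / 512) - 1`, in units of `1 / scale`. -/
def growthEntry (ρ u : ℕ) : ℕ :=
  let x := u * ρ / 512 + 1
  x + (x ^ 2 / (2 * scale) + 1) + (x ^ 3 / (4 * scale ^ 2) + 1)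

theorem le_growthEntry {ρ u : ℕ} {w : ℝ} (hu : scale * w ≤ u)
    (h : u * ρ / 512 + 1 ≤ scale) :
    scale * (Real.exp (ρ / 512 * w) - 1) ≤ growthEntry ρ u := by
  have hS := scale_pos
  set x := u * ρ / 512 + 1 with hx
  have h1 := natCast_div_le (u * ρ) 512
  have h2 := natCast_div_le (x ^ 2) (2 * scale)
  have h3 := natCast_div_le (x ^ 3) (4 * scale ^ 2)
  have h4 : ρ / 512 * w ≤ x / scale := by
    rw [le_div_iff₀ hS]
    have : (ρ : ℝ) * (scale * w) ≤ ρ * u := by gcongr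
    push_cast [hx] at h1 ⊢
    linarith
  have h5 := exp_sub_one_le h4 (by positivity)
    (by rw [div_le_one hS]; exact_mod_cast h)
  have h6 := mul_le_mul_of_nonneg_left h5 hS.le
  refine h6.trans ?_
  rw [growthEntry]
  push_cast [← hx] at h2 h3 ⊢
  have h7 : (scale : ℝ) * (x / scale + (x / scale) ^ 2 / 2 + (x / scale) ^ 3 / 4) =
      x + x ^ 2 / (2 * scale) + x ^ 3 / (4 * scale ^ 2) := by
    field_simp
  linarith

theorem growthTable_map {ρ : ℕ} {ns us : List ℕ}
    (hu : List.Forall₂ (fun n u : ℕ => 0 < n ∧ scale * Real.log n ≤ u) ns us)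
    (h : us.all fun u => u * ρ / 512 + 1 ≤ scale) :
    GrowthTable (ρ / 512) ns (us.map (growthEntry ρ)) := by
  induction hu with
  | nil => exact .nil
  | @cons n u ns us h1 _ ih =>
    rw [List.all_cons, Bool.and_eq_true, decide_eq_true_eq] at h
    exact .cons ⟨h1.1, le_growthEntry h1.2 h.1⟩ (ih h.2)

/-- The accuracy of the logarithms below. -/
def logError : ℕ := 4096

def IsLog (n l : ℕ) : Prop := |scale * Real.log n - l| ≤ logError

def argBall (l a b : ℕ) : CBall :=
  ((⟨l, 0, logError⟩ : CBall).mul ⟨-(a * 36028797018963968 : ℕ), -(b * 36028797018963968 : ℕ),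
    0⟩).divNat
    2048

theorem IsLog.has_argBall {n l : ℕ} (h : IsLog n l) (a b : ℕ) :
    (argBall l a b).Has (Real.log n * -((a + b * I) / 512) / 2048) := by
  have h1 : (⟨l, 0, logError⟩ : CBall).Has (Real.log n) := by
    unfold Has center
    rw [← ofReal_natCast, ← ofReal_mul]
    simp only [Int.cast_natCast, Int.cast_zero, zero_mul, add_zero]
    rw [← ofReal_natCast, ← ofReal_sub, norm_real]
    exact h
  have h2 : (⟨-(a * 36028797018963968 : ℕ), -(b * 36028797018963968 : ℕ), 0⟩ : CBall).Has
      (-((a + b * I) / 512)) := by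
    apply has_of_eq
    push_cast [scale]
    ring
  have := (h1.mul h2).divNat 2048
  exact_mod_cast this

def power (l a b : ℕ) : CBall := (argBall l a b).expSmall.iterSq 11

theorem IsLog.has_power {n l : ℕ} (hn : 0 < n) (h : IsLog n l) {a b : ℕ}
    (hs : (argBall l a b).isSmall) : (power l a b).Has ((n : ℂ) ^ (-((a + b * I) / 512 : ℂ))) := by
  have h1 := ((h.has_argBall a b).expSmall hs).iterSq 11
  rw [← Complex.exp_nat_mul] at h1
  rw [cpow_def_of_ne_zero (by exact_mod_cast hn.ne'), ← natCast_log]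
  convert h1 using 2
  · rfl
  · push_cast
    ring

def log2 : ℕ := 12786308645202655659
def log3 : ℕ := 20265819725292939638
def log5 : ℕ := 29688889273197213359
def log7 : ℕ := 35895706510057370950
def log11 : ℕ := 44233360412869490423
def log13 : ℕ := 47314964359118725072
def log17 : ℕ := 52263561464023824863
def log19 : ℕ := 54315312289337937472

structure IsLogs : Prop where
  two : IsLog 2 log2
  three : IsLog 3 log3
  five : IsLog 5 log5
  seven : IsLog 7 log7
  eleven : IsLog 11 log11
  thirteen : IsLog 13 log13
  seventeen : IsLog 17 log17
  nineteen : IsLog 19 log19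

def powTable (a b : ℕ) : List CBall :=
  fromPrimes mul (power log2 a b) (power log3 a b) (power log5 a b) (power log7 a b)
    (power log11 a b) (power log13 a b) (power log17 a b) (power log19 a b)

def tableSmall (a b : ℕ) : Bool :=
  (argBall log2 a b).isSmall && (argBall log3 a b).isSmall && (argBall log5 a b).isSmall &&
  (argBall log7 a b).isSmall && (argBall log11 a b).isSmall && (argBall log13 a b).isSmall &&
  (argBall log17 a b).isSmall && (argBall log19 a b).isSmall

theorem IsLogs.powTable (hl : IsLogs) {a b : ℕ} (h : tableSmall a b) :
    PowTable ((a + b * I) / 512) tableIndex (powTable a b) := by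
  simp only [tableSmall, Bool.and_eq_true] at h
  obtain ⟨⟨⟨⟨⟨⟨⟨h2, h3⟩, h5⟩, h7⟩, h11⟩, h13⟩, h17⟩, h19⟩ := h
  refine forall₂_fromPrimes (fun m n x y hm hn hx hy => ⟨by positivity, ?_⟩)
    ⟨two_pos, hl.two.has_power two_pos h2⟩ ⟨by norm_num, hl.three.has_power (by norm_num) h3⟩
    ⟨by norm_num, hl.five.has_power (by norm_num) h5⟩
    ⟨by norm_num, hl.seven.has_power (by norm_num) h7⟩
    ⟨by norm_num, hl.eleven.has_power (by norm_num) h11⟩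
    ⟨by norm_num, hl.thirteen.has_power (by norm_num) h13⟩
    ⟨by norm_num, hl.seventeen.has_power (by norm_num) h17⟩
    ⟨by norm_num, hl.nineteen.has_power (by norm_num) h19⟩
  rw [Nat.cast_mul, natCast_mul_natCast_cpow]
  exact hx.2.mul hy.2

/-- Upper bounds for the logarithms, in units of `1 / scale`. -/
def logTable : List ℕ :=
  fromPrimes (· + ·) (log2 + logError) (log3 + logError) (log5 + logError) (log7 + logError)
    (log11 + logError) (log13 + logError) (log17 + logError) (log19 + logError)

theorem IsLog.le {n l : ℕ} (h : IsLog n l) : scale * Real.log n ≤ (l + logError : ℕ) := by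
  have := (le_abs_self _).trans h
  push_cast
  linarith

theorem IsLogs.logTable (hl : IsLogs) :
    List.Forall₂ (fun n u : ℕ => 0 < n ∧ scale * Real.log n ≤ u) tableIndex logTable := by
  refine forall₂_fromPrimes (fun m n x y hm hn hx hy => ⟨by positivity, ?_⟩)
    ⟨two_pos, hl.two.le⟩ ⟨by norm_num, hl.three.le⟩ ⟨by norm_num, hl.five.le⟩
    ⟨by norm_num, hl.seven.le⟩ ⟨by norm_num, hl.eleven.le⟩ ⟨by norm_num, hl.thirteen.le⟩
    ⟨by norm_num, hl.seventeen.le⟩ ⟨by norm_num, hl.nineteen.le⟩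
  push_cast
  rw [Real.log_mul (by positivity) (by positivity), mul_add]
  exact add_le_add hx.2 hy.2

/-- Apply `diskCheck` at `n` points of an arithmetic progression. -/
def runCheck (ms : List CBall) (cs : List ℕ) (ρ da db : ℕ) : ℕ → List CBall → ℕ → ℕ → Bool
  | 0, _, _, _ => true
  | n + 1, zs, a, b => diskCheck zs cs a b ρ &&
      runCheck ms cs ρ da db n (List.zipWith mul zs ms) (a + da) (b + db)

theorem pos_of_runCheck {ms : List CBall} {cs : List ℕ} {ρ dx dy : ℕ} (hd : dx + dy ≤ 1)
    (hm : PowTable (((dx * (2 * ρ) : ℕ) + (dy * (2 * ρ) : ℕ) * I) / 512) tableIndex ms)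
    (hc : GrowthTable (ρ / 512) tableIndex cs) {n : ℕ} {zs : List CBall} {a b : ℕ}
    (hz : PowTable ((a + b * I) / 512) tableIndex zs)
    (h : runCheck ms cs ρ (dx * (2 * ρ)) (dy * (2 * ρ)) n zs a b) {x : ℝ} (hx : -ρ ≤ x)
    (hx' : x < (2 * n - 1) * ρ) : 0 < (riemannZeta ((a + dx * x + (b + dy * x) * I) / 512)).re := by
  induction n generalizing zs a b x with
  | zero =>
    push_cast at hx'
    linarith
  | succ n ih =>
    rw [runCheck, Bool.and_eq_true] at h
    rcases le_or_gt x ρ with hxρ | hxρ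
    · refine re_riemannZeta_pos_of_diskCheck hz hc h.1 ?_
      rw [show ((a + dx * x + (b + dy * x) * I) / 512 - (a + b * I) / 512 : ℂ) =
        ((x / 512 : ℝ) : ℂ) * (dx + dy * I) by push_cast; ring, norm_mul, norm_real,
        Real.norm_eq_abs, abs_div, abs_of_pos (by norm_num : (0 : ℝ) < 512)]
      have h1 : ‖(dx + dy * I : ℂ)‖ ≤ 1 := by
        refine (norm_add_le _ _).trans ?_
        rw [norm_mul, norm_I, mul_one, Complex.norm_natCast, Complex.norm_natCast]
        exact_mod_cast hd
      have h2 : |x| ≤ ρ := abs_le.2 ⟨hx, hxρ⟩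
      calc |x| / 512 * ‖(dx + dy * I : ℂ)‖ ≤ ρ / 512 * 1 := by gcongr
        _ = _ := mul_one _
    · have hz' := hz.zipWith hm
      have := ih (zs := List.zipWith mul zs ms) (a := a + dx * (2 * ρ)) (b := b + dy * (2 * ρ))
        (x := x - 2 * ρ) (by convert hz' using 1; push_cast; ring) h.2 (by linarith)
        (by push_cast at hx'; linarith)
      convert this using 4
      push_cast
      ring

/-- Sufficient condition for `ζ` to have positive real part on a segment. -/
def edgeCheck (dx dy : ℕ) : ℕ → ℕ → List (ℕ × ℕ) → Bool
  | _, _, [] => true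
  | a, b, (ρ, n) :: L =>
    logTable.all (fun u => u * ρ / 512 + 1 ≤ scale) && tableSmall (dx * (2 * ρ)) (dy * (2 * ρ)) &&
    tableSmall (a + dx * ρ) (b + dy * ρ) &&
    runCheck (powTable (dx * (2 * ρ)) (dy * (2 * ρ))) (logTable.map (growthEntry ρ)) ρ
      (dx * (2 * ρ)) (dy * (2 * ρ)) n (powTable (a + dx * ρ) (b + dy * ρ))
      (a + dx * ρ) (b + dy * ρ) &&
    edgeCheck dx dy (a + dx * (2 * ρ * n)) (b + dy * (2 * ρ * n)) L

def edgeLength : List (ℕ × ℕ) → ℕ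
  | [] => 0
  | (ρ, n) :: L => 2 * ρ * n + edgeLength L

theorem pos_of_edgeCheck (hl : IsLogs) {dx dy : ℕ} (hd : dx + dy ≤ 1) {L : List (ℕ × ℕ)} {a b : ℕ}
    (h : edgeCheck dx dy a b L) {x : ℝ} (hx : 0 ≤ x) (hx' : x < edgeLength L) :
    0 < (riemannZeta ((a + dx * x + (b + dy * x) * I) / 512)).re := by
  induction L generalizing a b x with
  | nil =>
    simp only [edgeLength, Nat.cast_zero] at hx'
    linarith
  | cons p L ih =>
    obtain ⟨ρ, n⟩ := p
    simp only [edgeCheck, Bool.and_eq_true] at h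
    obtain ⟨⟨⟨⟨h1, h2⟩, h3⟩, h4⟩, h5⟩ := h
    rcases lt_or_ge x (2 * ρ * n) with hxn | hxn
    · have := pos_of_runCheck hd (hl.powTable h2) (growthTable_map hl.logTable h1) (hl.powTable h3)
        h4 (x := x - ρ) (by linarith) (by linarith)
      convert this using 4
      push_cast
      ring
    · have := ih h5 (x := x - 2 * ρ * n) (by linarith)
        (by simp only [edgeLength] at hx'; push_cast at hx'; linarith)
      convert this using 4
      push_cast
      ring

end CBall

namespace CBall

/-- Sufficient condition for `ζ` to have positive real part on the left and top edges of a sequence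
of rectangles with right edge on the line `σ = 2`. The bottom left corner of the first one is
`(a + b * I) / 512`. Each rectangle is given by the left coordinate, the top coordinate and the
disks for the left and the top edge. -/
def stairCheck (a b : ℕ) : List (ℕ × ℕ × List (ℕ × ℕ) × List (ℕ × ℕ)) → Bool
  | [] => true
  | (c, d, left, top) :: L =>
    a ≤ c && d ≤ b + edgeLength left && 1024 ≤ c + edgeLength top && b < d && c < 1024 &&
    edgeCheck 0 1 c b left && edgeCheck 1 0 c d top && stairCheck c d L

/-- The disks for the bottom edge of the rectangle `0.875 ≤ σ ≤ 2`, `4 ≤ t ≤ 24`. -/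
def lowBottom : List (ℕ × ℕ) := [(48, 6)]

/-- The rectangle `0.875 ≤ σ ≤ 2`, `4 ≤ t ≤ 24`. -/
def lowStair : List (ℕ × ℕ × List (ℕ × ℕ) × List (ℕ × ℕ)) :=
  [(448, 12288, [(32, 19), (64, 24), (32, 8), (16, 21), (24, 11), (64, 16), (24, 25), (64, 8)],
    [(64, 5)])]

def highBottom : List (ℕ × ℕ) := [(32, 3), (96, 3)]

/-- Rectangles covering the zero-free region for `24 ≤ t ≤ 64`. -/
def highStair : List (ℕ × ℕ × List (ℕ × ℕ) × List (ℕ × ℕ)) :=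
  [(276, 12736, [(12, 14), (4, 14)], [(4, 6), (12, 8), (64, 4)]),
  (298, 13568, [(4, 10), (2, 13), (2, 40), (4, 10), (8, 11), (24, 6)], [(64, 6)]),
  (329, 15104, [(48, 14), (16, 6)], [(24, 5), (128, 2)]),
  (364, 18496, [(8, 1), (8, 40), (24, 19), (8, 33), (16, 10), (64, 8)], [(128, 3)]),
  (404, 23808, [(24, 21), (48, 11), (16, 19), (32, 14), (16, 19), (64, 9)], [(128, 3)]),
  (431, 27456, [(32, 6), (12, 18), (24, 17), (16, 11), (32, 26)], [(96, 4)]),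
  (441, 32768, [(64, 9), (32, 23), (16, 33), (8, 24), (24, 6), (96, 5)], [(128, 3)])]

theorem edgeCheck_lowBottom : edgeCheck 1 0 448 2048 lowBottom := by decide +kernel

theorem stairCheck_lowStair : stairCheck 448 2048 lowStair := by decide +kernel

theorem edgeCheck_highBottom : edgeCheck 1 0 276 12288 highBottom := by decide +kernel

theorem stairCheck_highStair : stairCheck 276 12288 highStair := by decide +kernel

end CBall

theorem abs_log_succ_sub_log_sub_le {m : ℕ} (hm : 0 < m) {c l e : ℝ} (hc : 0 ≤ c) (k : ℕ)
    (h : |c * (2 * ∑ i ∈ Finset.range k, (1 / (2 * m + 1) : ℝ) ^ (2 * i + 1) / (2 * i + 1)) - l|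
      + c * (2 * ((1 / (2 * m + 1) : ℝ) ^ (2 * k + 1) / (1 - (1 / (2 * m + 1)) ^ 2))) ≤ e) :
    |c * (Real.log (m + 1) - Real.log m) - l| ≤ e := by
  have hm' : (0 : ℝ) < m := by exact_mod_cast hm
  have hx : (1 / (2 * m + 1) : ℝ) < 1 := by
    rw [div_lt_one (by positivity)]
    linarith
  have h1 := Real.sum_range_le_log_div (x := 1 / (2 * m + 1)) (by positivity) hx k
  have h2 := Real.log_div_le_sum_range_add (x := 1 / (2 * m + 1)) (by positivity) hx k
  have h3 : (1 + 1 / (2 * m + 1)) / (1 - 1 / (2 * m + 1)) = ((m + 1) / m : ℝ) := by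
    have : (2 * m + 1 - 1 : ℝ) ≠ 0 := by linarith
    field_simp
    ring
  rw [h3, Real.log_div (by positivity) hm'.ne'] at h1 h2
  set S := ∑ i ∈ Finset.range k, (1 / (2 * m + 1) : ℝ) ^ (2 * i + 1) / (2 * i + 1)
  set δ := (1 / (2 * m + 1) : ℝ) ^ (2 * k + 1) / (1 - (1 / (2 * m + 1)) ^ 2)
  set D := Real.log (m + 1) - Real.log m
  have h4 : |c * D - c * (2 * S)| ≤ c * (2 * δ) := by
    rw [← mul_sub, abs_mul, abs_of_nonneg hc]
    gcongr
    rw [abs_le]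
    constructor <;> linarith
  calc |c * D - l| = |(c * D - c * (2 * S)) + (c * (2 * S) - l)| := by ring_nf
    _ ≤ _ := abs_add_le _ _
    _ ≤ e := by linarith

namespace CBall

theorem isLogs : IsLogs := by
  have hS := scale_pos.le
  have h1 := abs_log_succ_sub_log_sub_le (m := 1) (by norm_num) hS 20 (l := 12786308645202655659)
    (e := 8) (by norm_num [scale, Finset.sum_range_succ, abs_le])
  have h2 := abs_log_succ_sub_log_sub_le (m := 2) (by norm_num) hS 14 (l := 7479511080090283978)
    (e := 8) (by norm_num [scale, Finset.sum_range_succ, abs_le])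
  have h4 := abs_log_succ_sub_log_sub_le (m := 4) (by norm_num) hS 10 (l := 4116271982791902040)
    (e := 8) (by norm_num [scale, Finset.sum_range_succ, abs_le])
  have h7 := abs_log_succ_sub_log_sub_le (m := 7) (by norm_num) hS 8 (l := 2463219425550596028)
    (e := 8) (by norm_num [scale, Finset.sum_range_succ, abs_le])
  have h10 := abs_log_succ_sub_log_sub_le (m := 10) (by norm_num) hS 7 (l := 1758162494469621403)
    (e := 8) (by norm_num [scale, Finset.sum_range_succ, abs_le])
  have h12 := abs_log_succ_sub_log_sub_le (m := 12) (by norm_num) hS 7 (l := 1476527343420474114)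
    (e := 8) (by norm_num [scale, Finset.sum_range_succ, abs_le])
  have h16 := abs_log_succ_sub_log_sub_le (m := 16) (by norm_num) hS 6 (l := 1118326883213202224)
    (e := 8) (by norm_num [scale, Finset.sum_range_succ, abs_le])
  have h18 := abs_log_succ_sub_log_sub_le (m := 18) (by norm_num) hS 6 (l := 997364193549402534)
    (e := 8) (by norm_num [scale, Finset.sum_range_succ, abs_le])
  have hmul : ∀ x y : ℝ, 0 < x → 0 < y → scale * Real.log (x * y) =
      scale * Real.log x + scale * Real.log y := fun x y hx hy => by
    rw [Real.log_mul hx.ne' hy.ne', mul_add]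
  have e4 := hmul 2 2 (by norm_num) (by norm_num)
  have e8 := hmul 2 4 (by norm_num) (by norm_num)
  have e10 := hmul 2 5 (by norm_num) (by norm_num)
  have e12 := hmul 3 4 (by norm_num) (by norm_num)
  have e16 := hmul 4 4 (by norm_num) (by norm_num)
  have e9 := hmul 3 3 (by norm_num) (by norm_num)
  have e18 := hmul 2 9 (by norm_num) (by norm_num)
  norm_num only [mul_sub, abs_le] at h1 h2 h4 h7 h10 h12 h16 h18 e4 e8 e10 e12 e16 e9 e18
  rw [Real.log_one] at h1
  constructor <;>
  · unfold IsLog logError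
    rw [abs_le]
    simp only [log2, log3, log5, log7, log11, log13, log17, log19]
    norm_num only
    constructor <;> linarith

end CBall

end

section

open Complex ComplexConjugate

theorem re_riemannZeta_pos_of_two_le {z : ℂ} (hz : 2 ≤ z.re) : 0 < (riemannZeta z).re := by
  have hsum : HasSum (fun n : ℕ => (1 : ℝ) / ((n + 2 : ℕ) : ℝ) ^ 2) (Real.pi ^ 2 / 6 - 1) := by
    have := (hasSum_nat_add_iff' 2).2 hasSum_zeta_two
    simpa [Finset.sum_range_succ] using this
  have hle : ∀ n : ℕ, ‖1 / ((n + 2 : ℕ) : ℂ) ^ z‖ ≤ 1 / ((n + 2 : ℕ) : ℝ) ^ 2 := fun n => by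
    rw [norm_div, norm_one, Complex.norm_natCast_cpow_of_pos (by lia), ← Real.rpow_natCast]
    gcongr
    · norm_cast
      lia
    · exact_mod_cast hz
  have hs := Complex.summable_one_div_nat_cpow.2 (by linarith : 1 < z.re)
  have h1 : riemannZeta z = 1 + ∑' n : ℕ, 1 / ((n + 2 : ℕ) : ℂ) ^ z := by
    rw [zeta_eq_tsum_one_div_nat_cpow (by linarith), ← hs.sum_add_tsum_nat_add 2]
    have : z ≠ 0 := by
      rintro rfl
      norm_num at hz
    simp [Finset.sum_range_succ, this]
  have h2 : ‖∑' n : ℕ, 1 / ((n + 2 : ℕ) : ℂ) ^ z‖ ≤ Real.pi ^ 2 / 6 - 1 :=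
    tsum_of_norm_bounded hsum hle
  have h3 := (neg_le_abs _).trans ((abs_re_le_norm _).trans h2)
  rw [h1, add_re, one_re]
  nlinarith [Real.pi_lt_d2, Real.pi_pos]

/-- Minimum principle for the real part of `ζ` on a rectangle. -/
theorem re_riemannZeta_pos_of_boundary {a c b d : ℝ} (hac : a < c) (hb : 0 < b) (hbd : b < d)
    (hleft : ∀ z : ℂ, z.re = a → b ≤ z.im → z.im ≤ d → 0 < (riemannZeta z).re)
    (hright : ∀ z : ℂ, z.re = c → b ≤ z.im → z.im ≤ d → 0 < (riemannZeta z).re)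
    (hbot : ∀ z : ℂ, a ≤ z.re → z.re ≤ c → z.im = b → 0 < (riemannZeta z).re)
    (htop : ∀ z : ℂ, a ≤ z.re → z.re ≤ c → z.im = d → 0 < (riemannZeta z).re)
    {z : ℂ} (h1 : a ≤ z.re) (h2 : z.re ≤ c) (h3 : b ≤ z.im) (h4 : z.im ≤ d) :
    0 < (riemannZeta z).re := by
  set U : Set ℂ := Set.Ioo a c ×ℂ Set.Ioo b d with hU
  have hcl : closure U = Set.Icc a c ×ℂ Set.Icc b d := by
    rw [hU, closure_reProdIm, closure_Ioo hac.ne, closure_Ioo hbd.ne]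
  have hdiff : DifferentiableOn ℂ (fun w => exp (-riemannZeta w)) (closure U) := by
    intro w hw
    rw [hcl, mem_reProdIm] at hw
    refine (differentiableAt_riemannZeta ?_).neg.cexp.differentiableWithinAt
    rintro rfl
    have := hw.2.1
    norm_num at this
    linarith
  obtain ⟨w, hw, hmax⟩ := exists_mem_frontier_isMaxOn_norm
    ((Metric.isBounded_Ioo a c).reProdIm (Metric.isBounded_Ioo b d))
    (⟨((a + c) / 2 : ℝ) + ((b + d) / 2 : ℝ) * I, by
      rw [mem_reProdIm]
      constructor <;> constructor <;> simp <;> linarith⟩ : U.Nonempty) hdiff.diffContOnCl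
  have hwpos : 0 < (riemannZeta w).re := by
    rw [frontier_reProdIm, closure_Ioo hac.ne, closure_Ioo hbd.ne, frontier_Ioo hac,
      frontier_Ioo hbd] at hw
    rcases hw with ⟨hw1, hw2 | hw2⟩ | ⟨hw1 | hw1, hw2⟩
    · exact hbot w hw1.1 hw1.2 hw2
    · exact htop w hw1.1 hw1.2 hw2
    · exact hleft w hw1 hw2.1 hw2.2
    · exact hright w hw1 hw2.1 hw2.2
  have hz : z ∈ closure U := by
    rw [hcl, mem_reProdIm]
    exact ⟨⟨h1, h2⟩, h3, h4⟩
  have := hmax hz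
  simp only [Set.mem_ofPred_eq, Function.comp_apply, norm_exp, Real.exp_le_exp, neg_re] at this
  linarith

namespace CBall

theorem re_riemannZeta_pos_of_vertical {L : List (ℕ × ℕ)} {a b : ℕ} (h : edgeCheck 0 1 a b L)
    {z : ℂ} (hz : z.re = a / 512) (h1 : b / 512 ≤ z.im) (h2 : z.im < (b + edgeLength L) / 512) :
    0 < (riemannZeta z).re := by
  have := pos_of_edgeCheck isLogs (by norm_num) h (x := 512 * z.im - b) (by linarith)
    (by linarith)
  convert this using 3
  rw [← re_add_im z, hz]
  push_cast
  simp
  ring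

theorem re_riemannZeta_pos_of_horizontal {L : List (ℕ × ℕ)} {a b : ℕ} (h : edgeCheck 1 0 a b L)
    (hL : 1024 ≤ a + edgeLength L) {z : ℂ} (hz : z.im = b / 512) (h1 : a / 512 ≤ z.re) :
    0 < (riemannZeta z).re := by
  rcases le_or_gt 2 z.re with h2 | h2
  · exact re_riemannZeta_pos_of_two_le h2
  have hL' : (1024 : ℝ) ≤ a + edgeLength L := by exact_mod_cast hL
  have := pos_of_edgeCheck isLogs (by norm_num) h (x := 512 * z.re - a) (by linarith)
    (by linarith)
  convert this using 3
  rw [← re_add_im z, hz]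
  push_cast
  simp
  ring

/-- The bottom left corners of the rectangles. -/
def corners (b : ℕ) : List (ℕ × ℕ × List (ℕ × ℕ) × List (ℕ × ℕ)) → List (ℕ × ℕ)
  | [] => []
  | (a', b', _, _) :: L => (a', b) :: corners b' L

def stairTop (b : ℕ) : List (ℕ × ℕ × List (ℕ × ℕ) × List (ℕ × ℕ)) → ℕ
  | [] => b
  | (_, b', _, _) :: L => stairTop b' L

theorem exists_corner_of_stairCheck {L : List (ℕ × ℕ × List (ℕ × ℕ) × List (ℕ × ℕ))} {a b : ℕ}
    (hb : 0 < b) (hbot : ∀ z : ℂ, z.im = b / 512 → a / 512 ≤ z.re → 0 < (riemannZeta z).re)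
    (h : stairCheck a b L) {t : ℝ} (h1 : b / 512 ≤ t) (h2 : t < stairTop b L / 512) :
    ∃ p ∈ corners b L, p.2 / 512 ≤ t ∧
      ∀ z : ℂ, z.im = t → p.1 / 512 ≤ z.re → 0 < (riemannZeta z).re := by
  induction L generalizing a b with
  | nil =>
    rw [stairTop] at h2
    linarith
  | cons p L ih =>
    obtain ⟨a', b', left, top⟩ := p
    simp only [stairCheck, Bool.and_eq_true, decide_eq_true_eq] at h
    obtain ⟨⟨⟨⟨⟨⟨⟨haa, hbl⟩, hat⟩, hbb⟩, ha'⟩, hl⟩, ht⟩, hrec⟩ := h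
    have htop : ∀ z : ℂ, z.im = b' / 512 → a' / 512 ≤ z.re → 0 < (riemannZeta z).re :=
      fun z => re_riemannZeta_pos_of_horizontal ht hat
    rcases lt_or_ge t (b' / 512) with htb | htb
    · refine ⟨(a', b), List.mem_cons_self, h1, fun z hz hza => ?_⟩
      rcases le_or_gt 2 z.re with hz2 | hz2
      · exact re_riemannZeta_pos_of_two_le hz2
      have haa' : (a : ℝ) ≤ a' := by exact_mod_cast haa
      have hbb' : (b : ℝ) < b' := by exact_mod_cast hbb
      have hbl' : (b' : ℝ) ≤ b + edgeLength left := by exact_mod_cast hbl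
      have ha'' : (a' : ℝ) < 1024 := by exact_mod_cast ha'
      refine re_riemannZeta_pos_of_boundary (a := a' / 512) (c := 2) (b := b / 512) (d := b' / 512)
        (by linarith) (by positivity) (by linarith) (fun w hw hw1 hw2 => ?_)
        (fun w hw _ _ => re_riemannZeta_pos_of_two_le hw.ge)
        (fun w hw _ hw2 => hbot w hw2 (by linarith)) (fun w hw _ hw2 => htop w hw2 hw)
        hza hz2.le (hz ▸ h1) (hz ▸ htb.le)
      rcases hw2.lt_or_eq with hw2 | hw2
      · exact re_riemannZeta_pos_of_vertical hl hw hw1 (by linarith)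
      · exact htop w hw2 hw.ge
    · obtain ⟨p, hp, hp'⟩ := ih (by lia) htop hrec htb h2
      exact ⟨p, List.mem_cons_of_mem _ hp, hp'⟩

end CBall

open CBall

theorem riemannZeta_ne_zero_of_low {s : ℂ} (h1 : 4 ≤ s.im) (h2 : s.im < 24) (h3 : 0.875 ≤ s.re) :
    riemannZeta s ≠ 0 := by
  obtain ⟨p, hp, -, hpos⟩ := exists_corner_of_stairCheck (by norm_num)
    (fun z => re_riemannZeta_pos_of_horizontal edgeCheck_lowBottom (by decide)) stairCheck_lowStair
    (t := s.im) (by norm_num; exact h1) (by norm_num [lowStair, stairTop]; exact h2)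
  simp only [lowStair, corners, List.mem_singleton] at hp
  subst hp
  have := hpos s rfl (by norm_num at *; linarith)
  exact fun h => by simp [h] at this

theorem exists_corner_of_high {t : ℝ} (h1 : 24 ≤ t) (h2 : t < 64) :
    ∃ p ∈ corners 12288 highStair, p.2 / 512 ≤ t ∧
      ∀ z : ℂ, z.im = t → p.1 / 512 ≤ z.re → 0 < (riemannZeta z).re :=
  exists_corner_of_stairCheck (by norm_num)
    (fun z => re_riemannZeta_pos_of_horizontal edgeCheck_highBottom (by decide))
    stairCheck_highStair (by norm_num; exact h1) (by norm_num [highStair, stairTop]; exact h2)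

theorem le_log_of_le_sum {x y c : ℝ} (n : ℕ) (hx : 0 ≤ x) (hx1 : x < 1)
    (hy : y = (1 + x) / (1 - x))
    (h : c ≤ 2 * ∑ i ∈ Finset.range n, x ^ (2 * i + 1) / (2 * i + 1)) : c ≤ Real.log y := by
  have := Real.sum_range_le_log_div hx hx1 n
  rw [hy]
  linarith

theorem corner_le {p : ℕ × ℕ} (hp : p ∈ corners 12288 highStair) :
    (p.1 : ℝ) / 512 ≤ 1 - 1 / (6.315 * Real.log (p.2 / 512 / 17)) ∧ p.1 ≤ 441 ∧ 12288 ≤ p.2 := by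
  have key : ∀ a b : ℕ, a < 512 → 8704 < b → 512 / (6.315 * (512 - a)) ≤
      2 * ∑ i ∈ Finset.range 12, (((b - 8704) / (b + 8704) : ℝ)) ^ (2 * i + 1) / (2 * i + 1) →
      (a : ℝ) / 512 ≤ 1 - 1 / (6.315 * Real.log (b / 512 / 17)) := by
    intro a b ha hb h
    have ha' : (a : ℝ) < 512 := by exact_mod_cast ha
    have hb' : (8704 : ℝ) < b := by exact_mod_cast hb
    have h1 : 512 / (6.315 * (512 - a)) ≤ Real.log (b / 512 / 17) := by
      refine le_log_of_le_sum 12 (div_nonneg (by linarith) (by linarith)) ?_ ?_ h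
      · rw [div_lt_one (by linarith)]
        linarith
      · have : (b + 8704 : ℝ) ≠ 0 := by linarith
        field_simp
        ring
    have h0 : (0 : ℝ) < 512 / (6.315 * (512 - a)) :=
      div_pos (by norm_num) (mul_pos (by norm_num) (by linarith))
    have h2 : 1 / (6.315 * Real.log (b / 512 / 17)) ≤ (512 - a) / 512 := by
      rw [div_le_div_iff₀ (mul_pos (by norm_num) (by linarith)) (by norm_num)]
      rw [div_le_iff₀ (mul_pos (by norm_num) (by linarith))] at h1
      linarith
    linarith
  simp only [highStair, corners, List.mem_cons, List.not_mem_nil, or_false] at hp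
  rcases hp with rfl | rfl | rfl | rfl | rfl | rfl | rfl <;>
  · refine ⟨key _ _ (by norm_num) (by norm_num) ?_, by norm_num, by norm_num⟩
    norm_num [Finset.sum_range_succ]

theorem riemannZeta_ne_zero_of_high {s : ℂ} (h1 : 24 ≤ s.im) (h2 : s.im < 64)
    (h3 : 1 - 1 / (6.315 * Real.log (s.im / 17)) ≤ s.re) : riemannZeta s ≠ 0 := by
  obtain ⟨p, hp, hpt, hpos⟩ := exists_corner_of_high h1 h2
  obtain ⟨hc, -, hp2⟩ := corner_le hp
  have hp2' : (12288 : ℝ) ≤ p.2 := by exact_mod_cast hp2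
  have hlog : 0 < Real.log (p.2 / 512 / 17) := Real.log_pos (by linarith)
  have := hpos s rfl (by
    refine hc.trans (le_trans ?_ h3)
    gcongr)
  exact fun h => by simp [h] at this

theorem le_one_sub_re_of_abs_im_lt {ρ : ℂ} (h : riemannXi ρ = 0) (him : |ρ.im| < 64) :
    0.1195 ≤ 1 - ρ.re := by
  wlog hρ : 0 ≤ ρ.im generalizing ρ
  · simpa using this (ρ := conj ρ) (by rw [riemannXi_conj, h, map_zero]) (by simpa using him)
      (by simp; linarith)
  rw [abs_of_nonneg hρ] at him
  have h1 := re_lt_one_of_riemannXi_eq_zero h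
  have h0 := re_pos_of_riemannXi_eq_zero h
  have hζ := (riemannXi_eq_zero_iff h0 (by rintro rfl; simp at h1)).1 h
  by_contra! hlt
  norm_num at hlt
  rcases le_or_gt ρ.im 4 with h4 | h4
  · exact riemannZeta_ne_zero_of_im_le_four (by linarith) h1 hρ h4 hζ
  rcases lt_or_ge ρ.im 24 with h24 | h24
  · exact riemannZeta_ne_zero_of_low h4.le h24 (by norm_num; linarith) hζ
  obtain ⟨p, hp, -, hpos⟩ := exists_corner_of_high h24 him
  have hp' : (p.1 : ℝ) ≤ 441 := by exact_mod_cast (corner_le hp).2.1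
  have := hpos ρ rfl (by linarith)
  simp [hζ] at this

end

/-- The Riemann zeta-function has no zeros in the region
`σ ≥ 1 - 1/(6.315 log(|t|/17))` for `|t| ≥ 24`. -/
theorem zeta_zero_free_region' (σ t : ℝ) (ht : 24 ≤ |t|)
    (hσ : 1 - 1 / (6.315 * Real.log (|t| / 17)) ≤ σ) :
    riemannZeta (σ + t * Complex.I) ≠ 0 := by
  wlog ht0 : 0 ≤ t generalizing t
  · have := this (-t) (by rwa [abs_neg]) (by rwa [abs_neg]) (by linarith)
    intro h
    apply this
    rw [show (σ + (-t : ℝ) * Complex.I : ℂ) = (starRingEnd ℂ) (σ + t * Complex.I : ℂ) by simp,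
      riemannZeta_conj, h, map_zero]
  rw [abs_of_nonneg ht0] at ht hσ
  set s : ℂ := σ + t * Complex.I with hs
  have hre : s.re = σ := by simp [hs]
  have him : s.im = t := by simp [hs]
  rcases le_or_gt 1 σ with h1 | h1
  · exact riemannZeta_ne_zero_of_one_le_re (hre ▸ h1)
  rcases lt_or_ge t 64 with h64 | h64
  · exact riemannZeta_ne_zero_of_high (him ▸ ht) (him ▸ h64) (by rwa [him, hre])
  intro h
  have hlog : 1 ≤ Real.log (t / 17) := by
    rw [Real.le_log_iff_exp_le (by positivity)]
    linarith [Real.exp_one_lt_d9]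
  have hσ0 : 0 < σ := by
    have : 1 / (6.315 * Real.log (t / 17)) < 1 := by
      rw [div_lt_one (by positivity)]
      linarith
    linarith
  have hξ := (riemannXi_eq_zero_iff (hre ▸ hσ0)
    (fun h' => by rw [h'] at him; simp at him; linarith)).2 h
  have := lt_of_riemannXi_eq_zero_of_low (fun ρ hρ hρ' => le_one_sub_re_of_abs_im_lt hρ hρ') hξ
    (him ▸ h64)
  rw [him, hre] at this
  rw [show 1 / (6.315 * Real.log (t / 17)) = 1 / 6.315 / Real.log (t / 17) by
    rw [div_div], sub_le_comm, le_div_iff₀ (by linarith)] at hσ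
  linarith
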